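/- Under the normalized setup with the quadratic asymptotic expansion, set Q(x,t) := −τt + ½xᵀAx, choose b ∈ ℝⁿ so that w̃(x,t) := u(x,t) − Q(x,t) − b·x satisfies w̃(e_k, 0) = w̃(−e_k, 0) for all 1 ≤ k ≤ n, let ξ₁ ∈ C²(ℝⁿ) be the unique function with ξ₁(x + eᵢ) = ξ₁(x) for 1 ≤ i ≤ n, ξ₁(0) = 0, A + D_x²ξ₁ > 0, and det(A + D_x²ξ₁) = det A · f₁ in ℝⁿ, and set ξ₂(t) := −τ·∫₀ᵗ (f₂(s) − 1) ds and h := w̃ − ξ₁ − ξ₂. Then sup_{ℝ^{n+1}_−} h < ∞. -/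

import Mathlib

open Set MeasureTheory

noncomputable section

abbrev En (n : ℕ) : Type := EuclideanSpace ℝ (Fin n)

namespace PMA

variable {n : ℕ}

/-- The lower half-space `ℝⁿ × (−∞,0]`. -/
def halfSpace (n : ℕ) : Set (En n × ℝ) := univ ×ˢ Iic (0:ℝ)

/-- The time derivative `u_t`. -/
def timeDeriv (u : En n → ℝ → ℝ) (x : En n) (t : ℝ) : ℝ := deriv (u x) t

/-- The spatial gradient `D_x u`. -/
def spaceGrad (u : En n → ℝ → ℝ) (x : En n) (t : ℝ) : En n := gradient (fun y => u y t) x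

/-- The spatial Hessian `D_x² u`, as an `n × n` matrix. -/
def spaceHess (u : En n → ℝ → ℝ) (x : En n) (t : ℝ) : Matrix (Fin n) (Fin n) ℝ :=
  fun i j => iteratedFDeriv ℝ 2 (fun y => u y t) x
    ![EuclideanSpace.single i 1, EuclideanSpace.single j 1]

/-- A function is parabolically convex on `D` if it is convex in `x` and nonincreasing in `t`. -/
def ParabolicallyConvexOn (D : Set (En n × ℝ)) (u : En n → ℝ → ℝ) : Prop :=
  (∀ t : ℝ, ConvexOn ℝ {x | (x, t) ∈ D} (fun x => u x t)) ∧
  (∀ x : En n, ∀ s t : ℝ, s ≤ t → (x, s) ∈ D → (x, t) ∈ D → u x t ≤ u x s)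

/-- The time slice `D(t)`. -/
def slice (D : Set (En n × ℝ)) (t : ℝ) : Set (En n) := {x | (x, t) ∈ D}

/-- Bowl-shaped domain. -/
def IsBowlShaped (D : Set (En n × ℝ)) : Prop :=
  D ⊆ halfSpace n ∧ (∀ t, Convex ℝ (slice D t)) ∧
  ∀ t₁ t₂ : ℝ, t₁ ≤ t₂ → (slice D t₂).Nonempty → slice D t₁ ⊆ slice D t₂

/-- The parabolic boundary `∂_p D`. -/
def parabolicBoundary (D : Set (En n × ℝ)) : Set (En n × ℝ) :=
  (closure (slice D (sInf {t | (slice D t).Nonempty})) ×ˢ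
      ({sInf {t | (slice D t).Nonempty}} : Set ℝ)) ∪
  ⋃ t ∈ Iic (0:ℝ), frontier (slice D t) ×ˢ ({t} : Set ℝ)

/-- Parabolic distance between two points. -/
def pdist (X Y : En n × ℝ) : ℝ := Real.sqrt (‖X.1 - Y.1‖^2 + |X.2 - Y.2|)

/-- Parabolic distance from a point to a set. -/
def pdistSet (Z : En n × ℝ) (S : Set (En n × ℝ)) : ℝ := sInf (pdist Z '' S)

/-- `C^{2k,k}` regularity on a set: all mixed derivatives `D_x^i D_t^j u` with `i + 2j ≤ 2k`
exist and are continuous. -/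
def IsC2kOn (k : ℕ) (u : En n → ℝ → ℝ) (D : Set (En n × ℝ)) : Prop :=
  ∀ i j : ℕ, i + 2*j ≤ 2*k →
    (∀ p ∈ D, ContDiffAt ℝ i (fun y => iteratedDeriv j (u y) p.2) p.1 ∧
      ContDiffAt ℝ j (u p.1) p.2) ∧
    ContinuousOn
      (fun p : En n × ℝ => iteratedFDeriv ℝ i (fun y => iteratedDeriv j (u y) p.2) p.1) D

/-- A matrix acting on `ℝⁿ`. -/
def mApply (M : Matrix (Fin n) (Fin n) ℝ) (x : En n) : En n :=
  (WithLp.equiv 2 (Fin n → ℝ)).symm (M.mulVec (WithLp.equiv 2 (Fin n → ℝ) x))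

/-- The quadratic form `xᵀ A x`. -/
def quadForm (A : Matrix (Fin n) (Fin n) ℝ) (x : En n) : ℝ := ∑ i, ∑ j, A i j * x i * x j

/-- The dot product `b · x` on `ℝⁿ`. -/
def dotp (b x : En n) : ℝ := ∑ i, b i * x i

/-- Second-order difference quotient `Δ_e² u`. -/
def sdq (u : En n → ℝ → ℝ) (e : En n) (x : En n) (t : ℝ) : ℝ :=
  (u (x + e) t + u (x - e) t - 2 * u x t) / ‖e‖^2

end PMA

namespace PMA

/-! ### Polynomial weights and functions of controlled growth -/

section Growth

variable {E : Type*} [NormedAddCommGroup E]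

/-- The weight `1 + ‖p‖²`. -/
def japSq (p : E) : ℝ := 1 + ‖p‖ ^ 2

lemma one_le_japSq (p : E) : 1 ≤ japSq p := by
  unfold japSq; nlinarith [sq_nonneg ‖p‖]

lemma japSq_pos (p : E) : 0 < japSq p := zero_lt_one.trans_le (one_le_japSq p)

lemma norm_le_japSq (p : E) : ‖p‖ ≤ japSq p := by
  unfold japSq; nlinarith [sq_nonneg (‖p‖ - 1), norm_nonneg p]

lemma continuous_japSq : Continuous (japSq : E → ℝ) := by
  unfold japSq; fun_prop

lemma japSq_add_le (x y : E) : japSq (x + y) ≤ 2 * japSq x * japSq y := by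
  have h := norm_add_le x y
  have h0 := norm_nonneg (x + y)
  have hx := norm_nonneg x
  have hy := norm_nonneg y
  unfold japSq
  nlinarith [sq_nonneg (‖x‖ - ‖y‖), mul_nonneg (sq_nonneg ‖x‖) (sq_nonneg ‖y‖)]

lemma japSq_neg (x : E) : japSq (-x) = japSq x := by simp [japSq]

lemma japSq_sub_le (x y : E) : japSq (x - y) ≤ 2 * japSq x * japSq y := by
  rw [sub_eq_add_neg, ← japSq_neg y]; exact japSq_add_le x (-y)

lemma japSq_le_four_mul {z p : E} (h : ‖z - p‖ ≤ 1 / 4 * (1 + ‖p‖)) : japSq z ≤ 4 * japSq p := by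
  have h1 : ‖z‖ ≤ ‖p‖ + ‖z - p‖ := by simpa using norm_add_le p (z - p)
  have hz := norm_nonneg z
  have hp := norm_nonneg p
  unfold japSq
  nlinarith [sq_nonneg (‖p‖ - 1)]

lemma japSq_le_four_mul' {z p : E} (h : ‖z - p‖ ≤ 1 / 4 * (1 + ‖p‖)) :
    japSq p ≤ 4 * japSq z := by
  have h1 : ‖p‖ ≤ ‖z‖ + ‖z - p‖ := by
    have := norm_sub_le z (z - p); simpa using this
  have hz := norm_nonneg z
  have hp := norm_nonneg p
  have h2 : ‖p‖ ≤ 4 / 3 * ‖z‖ + 1 / 3 := by linarith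
  unfold japSq
  nlinarith [sq_nonneg (‖z‖ - 1)]

/-- A jointly continuous function of `(p, t)` bounded on `t ∈ [-1, 0]` by a multiple of
`(1 + ‖p‖²) ^ i`. -/
structure Growth (i : ℤ) (f : E → ℝ → ℝ) : Prop where
  cont : Continuous fun z : E × ℝ => f z.1 z.2
  bound : ∃ C, 0 ≤ C ∧ ∀ p, ∀ t ∈ Icc (-1 : ℝ) 0, |f p t| ≤ C * japSq p ^ i

namespace Growth

variable {i j : ℤ} {f g : E → ℝ → ℝ}

lemma mono (h : Growth i f) (hij : i ≤ j) : Growth j f := by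
  refine ⟨h.cont, ?_⟩
  obtain ⟨C, hC, hb⟩ := h.bound
  refine ⟨C, hC, fun p t ht => (hb p t ht).trans ?_⟩
  gcongr
  exact one_le_japSq p

lemma of_le (hf : Continuous fun z : E × ℝ => f z.1 z.2) (hg : Growth i g) (C : ℝ)
    (h : ∀ p, ∀ t ∈ Icc (-1 : ℝ) 0, |f p t| ≤ C * |g p t|) : Growth i f := by
  obtain ⟨D, hD, hb⟩ := hg.bound
  refine ⟨hf, |C| * D, by positivity, fun p t ht => (h p t ht).trans ?_⟩
  calc C * |g p t| ≤ |C| * |g p t| := by gcongr; exact le_abs_self C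
    _ ≤ |C| * (D * japSq p ^ i) := by gcongr; exact hb p t ht
    _ = _ := by ring

lemma add (hf : Growth i f) (hg : Growth i g) : Growth i fun p t => f p t + g p t := by
  obtain ⟨C, hC, hb⟩ := hf.bound
  obtain ⟨D, hD, hb'⟩ := hg.bound
  refine ⟨hf.cont.add hg.cont, C + D, by positivity, fun p t ht => (abs_add_le _ _).trans ?_⟩
  have := hb p t ht
  have := hb' p t ht
  linarith

lemma neg (hf : Growth i f) : Growth i fun p t => -f p t :=
  of_le hf.cont.neg hf 1 fun p t _ => by simp

lemma sub (hf : Growth i f) (hg : Growth i g) : Growth i fun p t => f p t - g p t := by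
  simpa only [sub_eq_add_neg] using hf.add hg.neg

lemma mul (hf : Growth i f) (hg : Growth j g) : Growth (i + j) fun p t => f p t * g p t := by
  obtain ⟨C, hC, hb⟩ := hf.bound
  obtain ⟨D, hD, hb'⟩ := hg.bound
  refine ⟨hf.cont.mul hg.cont, C * D, by positivity, fun p t ht => ?_⟩
  rw [abs_mul, zpow_add₀ (japSq_pos p).ne']
  have h1 := hb p t ht
  have h2 := hb' p t ht
  calc |f p t| * |g p t| ≤ (C * japSq p ^ i) * (D * japSq p ^ j) :=
        mul_le_mul h1 h2 (abs_nonneg _) ((abs_nonneg _).trans h1)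
    _ = _ := by ring

lemma const_mul (hf : Growth i f) (c : ℝ) : Growth i fun p t => c * f p t :=
  of_le (continuous_const.mul hf.cont) hf |c| fun p t _ => by rw [abs_mul]

lemma of_time {g : ℝ → ℝ} (hg : Continuous g) : Growth 0 fun (_ : E) t => g t := by
  refine ⟨hg.comp continuous_snd, ?_⟩
  obtain ⟨C, hC⟩ := isCompact_Icc.exists_bound_of_continuousOn (s := Icc (-1 : ℝ) 0)
    hg.continuousOn
  refine ⟨|C|, abs_nonneg _, fun p t ht => ?_⟩
  simpa using (hC t ht).trans (le_abs_self C)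

lemma norm {F : Type*} [NormedAddCommGroup F] {f : E → ℝ → F}
    (hf : Continuous fun z : E × ℝ => f z.1 z.2) (C : ℝ)
    (h : ∀ p, ∀ t ∈ Icc (-1 : ℝ) 0, ‖f p t‖ ≤ C * japSq p ^ i) :
    Growth i fun p t => ‖f p t‖ := by
  refine ⟨hf.norm, |C|, abs_nonneg _, fun p t ht => ?_⟩
  rw [abs_of_nonneg (norm_nonneg _)]
  refine (h p t ht).trans ?_
  have := zpow_pos (japSq_pos p) i
  gcongr
  exact le_abs_self C

lemma japSq_zpow (i : ℤ) : Growth i fun (p : E) _ => japSq p ^ i := by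
  refine ⟨?_, 1, zero_le_one, fun p t _ => ?_⟩
  · exact (continuous_japSq.comp continuous_fst).zpow₀ _ fun z => Or.inl (japSq_pos _).ne'
  · rw [abs_of_pos (zpow_pos (japSq_pos p) i), one_mul]

variable [InnerProductSpace ℝ E] [FiniteDimensional ℝ E] [MeasurableSpace E] [BorelSpace E]

lemma integrable_japSq_zpow (hi : i ≤ -(Module.finrank ℝ E + 1 : ℤ)) :
    Integrable fun p : E => japSq p ^ i := by
  have h := integrable_rpow_neg_one_add_norm_sq (E := E) (μ := volume)
    (r := 2 * (Module.finrank ℝ E + 1)) (by linarith)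
  refine h.mono' ?_ (ae_of_all _ fun p => ?_)
  · exact (continuous_japSq.zpow₀ _ fun z => Or.inl (japSq_pos _).ne').aestronglyMeasurable
  · rw [Real.norm_of_nonneg (zpow_pos (japSq_pos p) i).le, ← Real.rpow_intCast]
    refine Real.rpow_le_rpow_of_exponent_le (one_le_japSq p) ?_
    have : (i : ℝ) ≤ -((Module.finrank ℝ E : ℝ) + 1) := by exact_mod_cast hi
    linarith

variable (hi : i ≤ -(Module.finrank ℝ E + 1 : ℤ))
include hi

lemma integrable (hf : Growth i f) {t : ℝ} (ht : t ∈ Icc (-1 : ℝ) 0) :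
    Integrable fun p => f p t := by
  obtain ⟨C, hC, hb⟩ := hf.bound
  refine ((integrable_japSq_zpow hi).const_mul C).mono' ?_ (ae_of_all _ fun p => hb p t ht)
  exact (hf.cont.comp (Continuous.prodMk_left t)).aestronglyMeasurable

lemma continuousOn_integral (hf : Growth i f) :
    ContinuousOn (fun t => ∫ p, f p t) (Icc (-1 : ℝ) 0) := by
  obtain ⟨C, hC, hb⟩ := hf.bound
  refine continuousOn_of_dominated (bound := fun p => C * japSq p ^ i) ?_ ?_ ?_ ?_
  · exact fun t _ => (hf.cont.comp (Continuous.prodMk_left t)).aestronglyMeasurable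
  · exact fun t ht => ae_of_all _ fun p => hb p t ht
  · exact (integrable_japSq_zpow hi).const_mul C
  · exact ae_of_all _ fun p => (hf.cont.comp (Continuous.prodMk_right p)).continuousOn

lemma intervalIntegrable (hf : Growth i f) {a b : ℝ} (ha : a ∈ Icc (-1 : ℝ) 0)
    (hb : b ∈ Icc (-1 : ℝ) 0) : IntervalIntegrable (fun t => ∫ p, f p t) volume a b :=
  ((hf.continuousOn_integral hi).mono (uIcc_subset_Icc ha hb)).intervalIntegrable

lemma integrable_prod (hf : Growth i f) {a b : ℝ} (ha : -1 ≤ a) (hb : b ≤ 0) :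
    Integrable (fun z : E × ℝ => f z.1 z.2)
      ((volume : Measure E).prod (volume.restrict (Ioc a b))) := by
  obtain ⟨C, hC, hbd⟩ := hf.bound
  have h1 : Integrable (fun z : E × ℝ => (C * japSq z.1 ^ i) * (1 : ℝ))
      ((volume : Measure E).prod (volume.restrict (Ioc a b))) :=
    ((integrable_japSq_zpow hi).const_mul C).mul_prod (integrable_const _)
  refine h1.mono' hf.cont.aestronglyMeasurable ?_
  have : ∀ᵐ z ∂((volume : Measure E).prod (volume.restrict (Ioc a b))), z.2 ∈ Ioc a b := by
    have h2 : (volume : Measure E).prod (volume.restrict (Ioc a b))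
        = ((volume : Measure E).prod volume).restrict (univ ×ˢ Ioc a b) := by
      rw [← Measure.prod_restrict, Measure.restrict_univ]
    rw [h2]
    filter_upwards [ae_restrict_mem (MeasurableSet.univ.prod measurableSet_Ioc)] with z hz
    exact hz.2
  filter_upwards [this] with z hz
  rw [mul_one]
  exact hbd z.1 z.2 ⟨by linarith [hz.1], by linarith [hz.2]⟩

lemma integral_interval_swap (hf : Growth i f) {a b : ℝ} (ha : -1 ≤ a) (hab : a ≤ b)
    (hb : b ≤ 0) : ∫ p, ∫ t in a..b, f p t = ∫ t in a..b, ∫ p, f p t := by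
  simp_rw [intervalIntegral.integral_of_le hab]
  exact integral_integral_swap (hf.integrable_prod hi ha hb)

/-- Fundamental theorem of calculus for slice integrals. -/
lemma integral_sub_integral {f' : E → ℝ → ℝ} (hf : Growth i f) (hf' : Growth i f') {a b : ℝ}
    (ha : -1 ≤ a) (hab : a ≤ b) (hb : b ≤ 0)
    (hd : ∀ p, ∀ t ∈ Ioo a b, HasDerivAt (f p) (f' p t) t) :
    (∫ p, f p b) - ∫ p, f p a = ∫ t in a..b, ∫ p, f' p t := by
  rw [← hf'.integral_interval_swap hi ha hab hb,
    ← integral_sub (hf.integrable hi ⟨by linarith, hb⟩) (hf.integrable hi ⟨ha, by linarith⟩)]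
  refine integral_congr_ae (ae_of_all _ fun p => ?_)
  refine (intervalIntegral.integral_eq_sub_of_hasDerivAt_of_le hab ?_ (hd p) ?_).symm
  · exact (hf.cont.comp (Continuous.prodMk_right p)).continuousOn
  · exact (hf'.cont.comp (Continuous.prodMk_right p)).intervalIntegrable _ _

lemma interval_mono (hf : Growth i f) (hg : Growth i g) {a b : ℝ} (ha : -1 ≤ a) (hab : a ≤ b)
    (hb : b ≤ 0) (h : ∀ p, ∀ t ∈ Icc a b, f p t ≤ g p t) :
    ∫ t in a..b, ∫ p, f p t ≤ ∫ t in a..b, ∫ p, g p t := by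
  have ha' : a ∈ Icc (-1 : ℝ) 0 := ⟨ha, hab.trans hb⟩
  have hb' : b ∈ Icc (-1 : ℝ) 0 := ⟨ha.trans hab, hb⟩
  refine intervalIntegral.integral_mono_on hab (hf.intervalIntegrable hi ha' hb')
    (hg.intervalIntegrable hi ha' hb') fun t ht => ?_
  have ht' : t ∈ Icc (-1 : ℝ) 0 := ⟨ha.trans ht.1, ht.2.trans hb⟩
  exact integral_mono (hf.integrable hi ht') (hg.integrable hi ht') fun p => h p t ht

end Growth

end Growth

section Weight

variable {E : Type*} [NormedAddCommGroup E] [InnerProductSpace ℝ E]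

variable (E) in
/-- The exponent of the integrable weight. -/
def wtExp : ℕ := Module.finrank ℝ E + 7

/-- The integrable weight `(1 + ‖p‖²) ^ (-(d + 7))`. -/
def wt (p : E) : ℝ := (japSq p ^ wtExp E)⁻¹

lemma wt_pos (p : E) : 0 < wt p := inv_pos.2 (pow_pos (japSq_pos p) _)

lemma wt_eq_zpow (p : E) : wt p = japSq p ^ (-(wtExp E : ℤ)) := by
  rw [wt, zpow_neg, zpow_natCast]

lemma continuous_wt : Continuous (wt : E → ℝ) :=
  (continuous_japSq.pow _).inv₀ fun p => (pow_pos (japSq_pos p) _).ne'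

lemma growth_wt : Growth (-(wtExp E : ℤ)) fun (p : E) _ => wt p := by
  simpa only [wt_eq_zpow] using Growth.japSq_zpow (E := E) (-(wtExp E : ℤ))

lemma wt_le_mul_of_japSq_le {z p : E} {c : ℝ} (h : japSq p ≤ c * japSq z) :
    wt z ≤ c ^ wtExp E * wt p := by
  unfold wt
  rw [← div_eq_mul_inv, le_div_iff₀ (pow_pos (japSq_pos p) _), inv_mul_le_iff₀
    (pow_pos (japSq_pos z) _), ← mul_pow, mul_comm]
  exact pow_le_pow_left₀ (japSq_pos p).le h _

lemma wt_le_of_near {z p : E} (h : ‖z - p‖ ≤ 1 / 4 * (1 + ‖p‖)) : wt z ≤ 4 ^ wtExp E * wt p :=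
  wt_le_mul_of_japSq_le (japSq_le_four_mul' h)

lemma wt_ge_of_near {z p : E} (h : ‖z - p‖ ≤ 1 / 4 * (1 + ‖p‖)) : wt p ≤ 4 ^ wtExp E * wt z :=
  wt_le_mul_of_japSq_le (japSq_le_four_mul h)

lemma abs_pow_sub_pow_le {a b M : ℝ} (ha : 0 ≤ a) (hb : 0 ≤ b) (haM : a ≤ M) (hbM : b ≤ M)
    (m : ℕ) : |a ^ m - b ^ m| ≤ m * M ^ (m - 1) * |a - b| := by
  have h := (convex_Icc (0 : ℝ) M).norm_image_sub_le_of_norm_hasDerivWithin_le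
    (f := fun x : ℝ => x ^ m) (f' := fun x : ℝ => m * x ^ (m - 1)) (C := m * M ^ (m - 1)) (x := b) (y := a)
    (fun x _ => (hasDerivAt_pow m x).hasDerivWithinAt) (fun x hx => ?_) ⟨hb, hbM⟩ ⟨ha, haM⟩
  · simpa using h
  · rw [Real.norm_of_nonneg (by have := hx.1; positivity)]
    have := hx.1
    gcongr
    exact hx.2

/-- A constant for the Lipschitz estimate of the weight. -/
def wtLip (m : ℕ) : ℝ := m * 4 ^ (m - 1) * 8 * 16 ^ m

lemma wtLip_nonneg (m : ℕ) : 0 ≤ wtLip m := by unfold wtLip; positivity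

lemma abs_wt_sub_wt_le {z y p : E} (hz : ‖z - p‖ ≤ 1 / 4 * (1 + ‖p‖))
    (hy : ‖y - p‖ ≤ 1 / 4 * (1 + ‖p‖)) :
    |wt z - wt y| ≤ wtLip (wtExp E) * (wt p * ‖z - y‖) := by
  have hm : 1 ≤ wtExp E := by unfold wtExp; omega
  set m := wtExp E with hmdef
  have hz4 := japSq_le_four_mul hz
  have hy4 := japSq_le_four_mul hy
  have hz4' := japSq_le_four_mul' hz
  have hy4' := japSq_le_four_mul' hy
  have hJ := japSq_pos p
  have hJz := japSq_pos z
  have hJy := japSq_pos y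
  have h1 : |japSq y - japSq z| ≤ 8 * japSq p * ‖z - y‖ := by
    have h2 : |‖y‖ - ‖z‖| ≤ ‖z - y‖ := by
      rw [norm_sub_rev]; exact abs_norm_sub_norm_le y z
    have h3 : japSq y - japSq z = (‖y‖ - ‖z‖) * (‖y‖ + ‖z‖) := by unfold japSq; ring
    rw [h3, abs_mul, abs_of_nonneg (by positivity : 0 ≤ ‖y‖ + ‖z‖), mul_comm]
    have := norm_le_japSq y
    have := norm_le_japSq z
    gcongr
    linarith
  have h2 := abs_pow_sub_pow_le hJy.le hJz.le hy4 hz4 m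
  have h3 : wt z - wt y = (japSq y ^ m - japSq z ^ m) * (wt z * wt y) := by
    unfold wt
    rw [← hmdef]
    have := (pow_pos hJz m).ne'
    have := (pow_pos hJy m).ne'
    field_simp
  have h4 : wt z * wt y ≤ (4 ^ m * wt p) * (4 ^ m * wt p) :=
    mul_le_mul (wt_le_of_near hz) (wt_le_of_near hy) (wt_pos y).le
      (by have := wt_pos p; positivity)
  have hw : wt p * japSq p ^ m = 1 := by
    unfold wt; rw [← hmdef]; exact inv_mul_cancel₀ (pow_pos hJ m).ne'
  rw [h3, abs_mul, abs_of_pos (mul_pos (wt_pos z) (wt_pos y))]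
  calc |japSq y ^ m - japSq z ^ m| * (wt z * wt y)
      ≤ (m * (4 * japSq p) ^ (m - 1) * (8 * japSq p * ‖z - y‖)) *
          ((4 ^ m * wt p) * (4 ^ m * wt p)) := by
        refine mul_le_mul (h2.trans ?_) h4 (mul_pos (wt_pos z) (wt_pos y)).le (by positivity)
        gcongr
    _ = wtLip m * (wt p * ‖z - y‖) * (wt p * (japSq p ^ (m - 1) * japSq p)) := by
        have : (16 : ℝ) ^ m = 4 ^ m * 4 ^ m := by rw [← mul_pow]; norm_num
        unfold wtLip; rw [mul_pow, this]; ring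
    _ = wtLip m * (wt p * ‖z - y‖) := by
        rw [← pow_succ, Nat.sub_add_cancel hm, hw, mul_one]

end Weight

end PMA

namespace PMA

/-! ### Legendre flows -/

section Flow

variable {E : Type*} [NormedAddCommGroup E] [InnerProductSpace ℝ E] [FiniteDimensional ℝ E]
  [MeasurableSpace E] [BorelSpace E]

variable (E) in
/-- A strictly convex evolution `u`, its Legendre transform `v` with gradient `X` and time derivative
`w ∘ X`, together with a stationary strictly convex profile `U`, its Legendre transform `V` with
gradient `Y = P⁻¹`, coupled by the transport identity that expresses that both solve the same
Monge-Ampère equation. -/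
structure LegendreFlow (c₀ m₁ m₂ : ℝ) where
  U : E → ℝ
  V : E → ℝ
  P : E → E
  Y : E → E
  u : E → ℝ → ℝ
  v : E → ℝ → ℝ
  w : E → ℝ → ℝ
  X : E → ℝ → E
  g : ℝ → ℝ
  G : ℝ → ℝ
  cont_U : Continuous U
  cont_P : Continuous P
  cont_Y : Continuous Y
  cont_u : Continuous fun z : E × ℝ => u z.1 z.2
  cont_v : Continuous fun z : E × ℝ => v z.1 z.2
  cont_w : Continuous fun z : E × ℝ => w z.1 z.2
  cont_X : Continuous fun z : E × ℝ => X z.1 z.2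
  cont_g : Continuous g
  cont_G : Continuous G
  gradV : ∀ p, HasGradientAt V (Y p) p
  gradv : ∀ p t, HasGradientAt (fun q => v q t) (X p t) p
  Y_P : ∀ x, Y (P x) = x
  P_Y : ∀ p, P (Y p) = p
  young : ∀ p x, inner ℝ p x - V p + c₀ * ‖x - Y p‖ ^ 2 ≤ U x
  U_Y : ∀ p, U (Y p) = inner ℝ p (Y p) - V p
  le_u : ∀ p x t, inner ℝ p x - v p t ≤ u x t
  u_X : ∀ p t, u (X p t) t = inner ℝ p (X p t) - v p t
  deriv_v : ∀ p, ∀ t < 0, HasDerivAt (v p) (w (X p t) t) t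
  deriv_u : ∀ x, ∀ t < 0, HasDerivAt (u x) (-w x t) t
  deriv_G : ∀ t < 0, HasDerivAt G (g t) t
  w_mem : ∀ x t, w x t ∈ Icc m₁ m₂
  g_mem : ∀ t, g t ∈ Icc m₁ m₂
  transport : ∀ t (η : E → ℝ), ∫ p, η (X p t) * w (X p t) t = g t * ∫ p, η (Y p)
  growth_u : ∀ T, ∃ C, ∀ x, ∀ t ∈ Icc (-T) 0, |u x t| ≤ C * japSq x

namespace LegendreFlow

variable {c₀ m₁ m₂ : ℝ} (D : LegendreFlow E c₀ m₁ m₂)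

/-- The time derivative of the Legendre transform. -/
def ν (p : E) (t : ℝ) : ℝ := D.w (D.X p t) t

/-- The difference of the two Legendre transforms. -/
def k (p : E) (t : ℝ) : ℝ := D.v p t - D.V p - D.G t

/-- The spatial gradient of the difference of the Legendre transforms. -/
def r (p : E) (t : ℝ) : E := D.X p t - D.Y p

omit [FiniteDimensional ℝ E] [MeasurableSpace E] [BorelSpace E] in
lemma hasGradientAt_comp_affine [CompleteSpace E] {f : E → ℝ} {R : ℝ} (hR : 0 < R)
    {c p x : E} (h : HasGradientAt f x (R • p + c)) (d : ℝ) :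
    HasGradientAt (fun q => (f (R • q + c) - d) / R ^ 2) (R⁻¹ • x) p := by
  rw [hasGradientAt_iff_hasFDerivAt] at h ⊢
  have h1 : HasFDerivAt (fun q : E => R • q + c) (R • ContinuousLinearMap.id ℝ E) p :=
    ((hasFDerivAt_id p).const_smul R).add_const c
  have h2 := ((h.comp p h1).sub_const d).mul_const (R ^ 2)⁻¹
  refine (h2.congr_fderiv ?_).congr_of_eventuallyEq (Filter.Eventually.of_forall fun q => ?_)
  · ext y
    simp
    field_simp
  · simp [div_eq_mul_inv]

/-- The parabolic rescaling of a flow, after subtraction of an affine function. -/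
def rescale (R : ℝ) (hR : 0 < R) (c : E) (d : ℝ) : LegendreFlow E c₀ m₁ m₂ where
  U x := D.U (R • x) / R ^ 2
  V p := D.V (R • p) / R ^ 2
  P x := R⁻¹ • D.P (R • x)
  Y p := R⁻¹ • D.Y (R • p)
  u x t := (D.u (R • x) (R ^ 2 * t) - R * inner ℝ c x + d) / R ^ 2
  v p t := (D.v (R • p + c) (R ^ 2 * t) - d) / R ^ 2
  w x t := D.w (R • x) (R ^ 2 * t)
  X p t := R⁻¹ • D.X (R • p + c) (R ^ 2 * t)
  g t := D.g (R ^ 2 * t)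
  G t := D.G (R ^ 2 * t) / R ^ 2
  cont_U := (D.cont_U.comp (continuous_const_smul R)).div_const _
  cont_P := (D.cont_P.comp (continuous_const_smul R)).const_smul _
  cont_Y := (D.cont_Y.comp (continuous_const_smul R)).const_smul _
  cont_u := by
    have := D.cont_u.comp (f := fun z : E × ℝ => (R • z.1, R ^ 2 * z.2)) (by fun_prop)
    exact ((this.sub (by fun_prop)).add_const d).div_const _
  cont_v := by
    have := D.cont_v.comp (f := fun z : E × ℝ => (R • z.1 + c, R ^ 2 * z.2)) (by fun_prop)
    exact (this.sub continuous_const).div_const _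
  cont_w := D.cont_w.comp (f := fun z : E × ℝ => (R • z.1, R ^ 2 * z.2)) (by fun_prop)
  cont_X := by
    have := D.cont_X.comp (f := fun z : E × ℝ => (R • z.1 + c, R ^ 2 * z.2)) (by fun_prop)
    exact this.const_smul _
  cont_g := D.cont_g.comp (by fun_prop)
  cont_G := (D.cont_G.comp (by fun_prop)).div_const _
  gradV p := by
    simpa using hasGradientAt_comp_affine hR (c := 0) (p := p)
      (by simpa using D.gradV (R • p)) 0
  gradv p t := hasGradientAt_comp_affine hR (D.gradv (R • p + c) (R ^ 2 * t)) d
  Y_P x := by simp [smul_smul, hR.ne', D.Y_P]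
  P_Y p := by simp [smul_smul, hR.ne', D.P_Y]
  young p x := by
    have h := D.young (R • p) (R • x)
    have h1 : x - R⁻¹ • D.Y (R • p) = R⁻¹ • (R • x - D.Y (R • p)) := by
      rw [smul_sub, smul_smul, inv_mul_cancel₀ hR.ne', one_smul]
    rw [h1, norm_smul, Real.norm_of_nonneg (inv_pos.2 hR).le, le_div_iff₀ (by positivity)]
    simp only [inner_smul_left, inner_smul_right, RCLike.conj_to_real] at h
    calc _ = R * (R * inner ℝ p x) - D.V (R • p) + c₀ * ‖R • x - D.Y (R • p)‖ ^ 2 := by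
            field_simp
      _ ≤ _ := h
  U_Y p := by
    have h := D.U_Y (R • p)
    simp only [smul_smul, mul_inv_cancel₀ hR.ne', one_smul, h, inner_smul_left, inner_smul_right,
      RCLike.conj_to_real]
    field_simp
  le_u p x t := by
    have h := D.le_u (R • p + c) (R • x) (R ^ 2 * t)
    simp only [inner_add_left, inner_smul_left, inner_smul_right, RCLike.conj_to_real] at h
    rw [le_div_iff₀ (by positivity), sub_mul, div_mul_cancel₀ _ (by positivity)]
    linarith
  u_X p t := by
    have h := D.u_X (R • p + c) (R ^ 2 * t)
    simp only [smul_smul, mul_inv_cancel₀ hR.ne', one_smul, h, inner_add_left, inner_smul_left,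
      inner_smul_right, RCLike.conj_to_real]
    field_simp
    ring
  deriv_v p t ht := by
    have h := D.deriv_v (R • p + c) (R ^ 2 * t) (by have := sq_pos_of_pos hR; nlinarith)
    have h1 : HasDerivAt (fun t : ℝ => R ^ 2 * t) (R ^ 2) t := by
      simpa using (hasDerivAt_id t).const_mul (R ^ 2)
    have h2 := ((h.comp t h1).sub_const d).div_const (R ^ 2)
    refine h2.congr_deriv ?_
    rw [mul_div_cancel_right₀ _ (by positivity), smul_smul, mul_inv_cancel₀ hR.ne', one_smul]
  deriv_u x t ht := by
    have h := D.deriv_u (R • x) (R ^ 2 * t) (by have := sq_pos_of_pos hR; nlinarith)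
    have h1 : HasDerivAt (fun t : ℝ => R ^ 2 * t) (R ^ 2) t := by
      simpa using (hasDerivAt_id t).const_mul (R ^ 2)
    have h2 := (((h.comp t h1).sub_const (R * inner ℝ c x)).add_const d).div_const (R ^ 2)
    exact h2.congr_deriv (mul_div_cancel_right₀ _ (by positivity))
  deriv_G t ht := by
    have h := D.deriv_G (R ^ 2 * t) (by have := sq_pos_of_pos hR; nlinarith)
    have h1 : HasDerivAt (fun t : ℝ => R ^ 2 * t) (R ^ 2) t := by
      simpa using (hasDerivAt_id t).const_mul (R ^ 2)
    have h2 := (h.comp t h1).div_const (R ^ 2)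
    exact h2.congr_deriv (mul_div_cancel_right₀ _ (by positivity))
  w_mem x t := D.w_mem _ _
  g_mem t := D.g_mem _
  transport t η := by
    have h := D.transport (R ^ 2 * t) (fun y => η (R⁻¹ • y))
    simp only [smul_smul, mul_inv_cancel₀ hR.ne', one_smul]
    have h1 := Measure.integral_comp_smul (volume : Measure E)
      (fun p => η (R⁻¹ • D.X (p + c) (R ^ 2 * t)) * D.w (D.X (p + c) (R ^ 2 * t)) (R ^ 2 * t)) R
    have h2 := Measure.integral_comp_smul (volume : Measure E) (fun p => η (R⁻¹ • D.Y p)) R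
    have h3 := integral_add_right_eq_self (μ := (volume : Measure E))
      (fun p => η (R⁻¹ • D.X p (R ^ 2 * t)) * D.w (D.X p (R ^ 2 * t)) (R ^ 2 * t)) c
    rw [h1, h2, h3, h]
    simp only [smul_eq_mul]
    ring
  growth_u T := by
    obtain ⟨C, hC⟩ := D.growth_u (R ^ 2 * T)
    have hC0 : 0 ≤ C * japSq (0 : E) ∨ T < 0 := by
      rcases lt_or_ge T 0 with h | h
      · exact Or.inr h
      · exact Or.inl ((abs_nonneg _).trans (hC 0 0 ⟨by have := sq_nonneg R; nlinarith, le_rfl⟩))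
    rcases hC0 with hC0 | hT
    swap
    · exact ⟨0, fun x t ht => by have := ht.1; have := ht.2; linarith⟩
    have hC0 : 0 ≤ C := by simpa [japSq] using hC0
    refine ⟨(C * (1 + R ^ 2) + R * ‖c‖ + |d|) / R ^ 2, fun x t ht => ?_⟩
    have h1 := hC (R • x) (R ^ 2 * t)
      ⟨by have := ht.1; have := sq_nonneg R; nlinarith, by have := ht.2; have := sq_nonneg R; nlinarith⟩
    have h2 : japSq (R • x) ≤ (1 + R ^ 2) * japSq x := by
      unfold japSq; rw [norm_smul, mul_pow, Real.norm_eq_abs, sq_abs]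
      nlinarith [sq_nonneg R, sq_nonneg ‖x‖]
    have h3 : |R * inner ℝ c x| ≤ R * ‖c‖ * japSq x := by
      rw [abs_mul, abs_of_pos hR, mul_assoc]
      gcongr
      exact (abs_real_inner_le_norm c x).trans (by gcongr; exact norm_le_japSq x)
    rw [abs_div, abs_of_pos (by positivity : 0 < R ^ 2), div_mul_eq_mul_div]
    gcongr
    calc _ ≤ |D.u (R • x) (R ^ 2 * t)| + |R * inner ℝ c x| + |d| := by
            refine (abs_add_le _ _).trans ?_
            gcongr
            exact abs_sub _ _
      _ ≤ C * ((1 + R ^ 2) * japSq x) + R * ‖c‖ * japSq x + |d| * japSq x := by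
            gcongr
            · exact h1.trans (by gcongr)
            · exact le_mul_of_one_le_right (abs_nonneg _) (one_le_japSq x)
      _ = _ := by ring

lemma rescale_k (R : ℝ) (hR : 0 < R) (c : E) (d : ℝ) (p : E) (t : ℝ) :
    (D.rescale R hR c d).k p t =
      (D.v (R • p + c) (R ^ 2 * t) - d - D.V (R • p) - D.G (R ^ 2 * t)) / R ^ 2 := by
  simp only [k, rescale]; ring

/-- The weighted energy of the difference of the Legendre transforms. -/
def energy : ℝ := ∫ t in (-1 : ℝ)..0, ∫ p, wt p * D.k p t ^ 2

lemma energy_rescale_rescale (R K : ℝ) (hR : 0 < R) (hK : 0 < K) (c c' : E) (d d' : ℝ) :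
    ((D.rescale R hR c d).rescale K⁻¹ (inv_pos.2 hK) c' d').energy =
      (D.rescale (R / K) (div_pos hR hK) (c + R • c') (d + R ^ 2 * d')).energy := by
  have : ∀ p t, ((D.rescale R hR c d).rescale K⁻¹ (inv_pos.2 hK) c' d').k p t =
      (D.rescale (R / K) (div_pos hR hK) (c + R • c') (d + R ^ 2 * d')).k p t := by
    intro p t
    rw [rescale_k, rescale_k]
    simp only [rescale]
    have e1 : R • (K⁻¹ • p + c') + c = (R / K) • p + (c + R • c') := by
      rw [smul_add, smul_smul, div_eq_mul_inv]; abel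
    have e2 : R ^ 2 * (K⁻¹ ^ 2 * t) = (R / K) ^ 2 * t := by field_simp
    have e3 : R • K⁻¹ • p = (R / K) • p := by rw [smul_smul, div_eq_mul_inv]
    rw [e1, e2, e3]
    field_simp
    ring
  simp only [energy, this]

lemma m₁_le_m₂ (D : LegendreFlow E c₀ m₁ m₂) : m₁ ≤ m₂ := (D.g_mem 0).1.trans (D.g_mem 0).2

lemma ν_mem (p : E) (t : ℝ) : D.ν p t ∈ Icc m₁ m₂ := D.w_mem _ _

lemma cont_V : Continuous D.V :=
  continuous_iff_continuousAt.2 fun p => (D.gradV p).hasFDerivAt.continuousAt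

lemma cont_k : Continuous fun z : E × ℝ => D.k z.1 z.2 :=
  (D.cont_v.sub (D.cont_V.comp continuous_fst)).sub (D.cont_G.comp continuous_snd)

lemma cont_r : Continuous fun z : E × ℝ => D.r z.1 z.2 :=
  D.cont_X.sub (D.cont_Y.comp continuous_fst)

lemma gradk (p : E) (t : ℝ) : HasGradientAt (fun q => D.k q t) (D.r p t) p := by
  have h1 := (D.gradv p t).hasFDerivAt
  have h2 := (D.gradV p).hasFDerivAt
  rw [hasGradientAt_iff_hasFDerivAt]
  have h3 := (h1.sub h2).sub_const (D.G t)
  rw [r, map_sub]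
  exact h3

lemma deriv_k (p : E) {t : ℝ} (ht : t < 0) : HasDerivAt (D.k p) (D.ν p t - D.g t) t :=
  ((D.deriv_v p t ht).sub_const _).sub (D.deriv_G t ht)

lemma transport' (t : ℝ) (η : E → ℝ) :
    ∫ p, η (D.X p t) * D.ν p t = D.g t * ∫ p, η (D.Y p) := D.transport t η

/-- Monotonicity of the difference of the potentials along the transport map. -/
lemma k_add_le (p : E) (t : ℝ) :
    D.k p t + c₀ * ‖D.r p t‖ ^ 2 ≤ D.k (D.P (D.X p t)) t := by
  have h1 := D.young p (D.X p t)
  have h2 := D.U_Y (D.P (D.X p t))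
  have h3 := D.le_u (D.P (D.X p t)) (D.X p t) t
  have h4 := D.u_X p t
  rw [D.Y_P] at h2
  simp only [k, r]
  linarith

/-- The difference of the potentials themselves. -/
def h (x : E) (t : ℝ) : ℝ := D.u x t - D.U x + D.G t

lemma h_X_le (hc₀ : 0 ≤ c₀) (p : E) (t : ℝ) : D.h (D.X p t) t ≤ -D.k p t := by
  have h1 := D.young p (D.X p t)
  have h4 := D.u_X p t
  have : 0 ≤ c₀ * ‖D.X p t - D.Y p‖ ^ 2 := by positivity
  simp only [k, h]
  linarith

lemma neg_k_le_h_Y (p : E) (t : ℝ) : -D.k p t ≤ D.h (D.Y p) t := by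
  have h1 := D.le_u p (D.Y p) t
  have h4 := D.U_Y p
  simp only [k, h]
  linarith

end LegendreFlow

end Flow

end PMA

namespace PMA

/-! ### Energy estimates -/

section Energy

variable {E : Type*} [NormedAddCommGroup E] [InnerProductSpace ℝ E] [FiniteDimensional ℝ E]
  [MeasurableSpace E] [BorelSpace E]

omit [InnerProductSpace ℝ E] [FiniteDimensional ℝ E] [MeasurableSpace E] [BorelSpace E] in
lemma Growth.comp {i : ℤ} {f : E → ℝ → ℝ} (hf : Growth i f) {φ : E → ℝ → E}
    (hφ : Continuous fun z : E × ℝ => φ z.1 z.2) {c : ℝ}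
    (h1 : ∀ p, ∀ t ∈ Icc (-1 : ℝ) 0, japSq (φ p t) ≤ c * japSq p)
    (h2 : ∀ p, ∀ t ∈ Icc (-1 : ℝ) 0, japSq p ≤ c * japSq (φ p t)) :
    Growth i fun p t => f (φ p t) t := by
  obtain ⟨C, hC, hb⟩ := hf.bound
  have hc : 0 ≤ c := by
    have := h1 0 0 (by simp)
    nlinarith [japSq_pos (φ 0 0), japSq_pos (0 : E)]
  refine ⟨hf.cont.comp (hφ.prodMk continuous_snd), C * c ^ i.natAbs, by positivity,
    fun p t ht => (hb _ t ht).trans ?_⟩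
  rw [mul_assoc]
  gcongr
  rcases i with m | m
  · simpa [mul_pow] using pow_le_pow_left₀ (japSq_pos _).le (h1 p t ht) m
  · rw [zpow_negSucc, zpow_negSucc, Int.natAbs_negSucc, ← div_eq_mul_inv,
      le_div_iff₀ (pow_pos (japSq_pos p) _), inv_mul_le_iff₀ (pow_pos (japSq_pos _) _), mul_comm,
      ← mul_pow]
    exact pow_le_pow_left₀ (japSq_pos _).le (h2 p t ht) _

variable (E) in
/-- The total mass of the weight. -/
def wtMass : ℝ := ∫ p : E, wt p

lemma wtMass_nonneg : 0 ≤ wtMass E := integral_nonneg fun p => (wt_pos p).le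

omit [FiniteDimensional ℝ E] [MeasurableSpace E] [BorelSpace E] in
lemma neg_wtExp_add_le {j : ℤ} (hj : j ≤ 6) :
    -(wtExp E : ℤ) + j ≤ -(Module.finrank ℝ E + 1 : ℤ) := by
  unfold wtExp; push_cast; linarith

omit [FiniteDimensional ℝ E] [MeasurableSpace E] [BorelSpace E] in
lemma growth_wt_mul {f : E → ℝ → ℝ} {j : ℤ} (hf : Growth j f) (hj : j ≤ 6) :
    Growth (-(Module.finrank ℝ E + 1 : ℤ)) fun p t => wt p * f p t :=
  (growth_wt.mul hf).mono (neg_wtExp_add_le hj)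

omit [InnerProductSpace ℝ E] [FiniteDimensional ℝ E] [MeasurableSpace E] [BorelSpace E] in
lemma Growth.sq {i : ℤ} {f : E → ℝ → ℝ} (hf : Growth i f) : Growth (i + i) fun p t => f p t ^ 2 := by
  simpa only [pow_two] using hf.mul hf

namespace LegendreFlow

variable {c₀ m₁ m₂ : ℝ} (D : LegendreFlow E c₀ m₁ m₂)

/-- Quantitative closeness of the two Legendre maps to the identity. -/
structure Near (δ : ℝ) : Prop where
  Y_near : ∀ p, ‖D.Y p - p‖ ≤ δ
  δ_le : δ ≤ 1 / 4
  X_near : ∀ p, ∀ t ∈ Icc (-1 : ℝ) 0, ‖D.X p t - p‖ ≤ 1 / 4 * (1 + ‖p‖)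

namespace Near

variable {D} {δ : ℝ} (hD : D.Near δ)
include hD

lemma δ_nonneg : 0 ≤ δ := (norm_nonneg _).trans (hD.Y_near 0)

lemma Y_near' (p : E) : ‖D.Y p - p‖ ≤ 1 / 4 * (1 + ‖p‖) := by
  have := hD.Y_near p
  have := hD.δ_le
  nlinarith [norm_nonneg p]

lemma P_near (x : E) : ‖D.P x - x‖ ≤ 1 / 4 * (1 + ‖x‖) := by
  have h := hD.Y_near (D.P x)
  rw [D.Y_P, norm_sub_rev] at h
  have := hD.δ_le
  nlinarith [norm_nonneg x]

lemma growth_comp_X {i : ℤ} {f : E → ℝ → ℝ} (hf : Growth i f) :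
    Growth i fun p t => f (D.X p t) t :=
  hf.comp D.cont_X (fun p t ht => japSq_le_four_mul (hD.X_near p t ht))
    (fun p t ht => japSq_le_four_mul' (hD.X_near p t ht))

lemma growth_comp_Y {i : ℤ} {f : E → ℝ → ℝ} (hf : Growth i f) :
    Growth i fun p t => f (D.Y p) t :=
  hf.comp (D.cont_Y.comp continuous_fst) (fun p _ _ => japSq_le_four_mul (hD.Y_near' p))
    (fun p _ _ => japSq_le_four_mul' (hD.Y_near' p))

lemma growth_comp_P {i : ℤ} {f : E → ℝ → ℝ} (hf : Growth i f) :
    Growth i fun p t => f (D.P p) t :=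
  hf.comp (D.cont_P.comp continuous_fst) (fun p _ _ => japSq_le_four_mul (hD.P_near p))
    (fun p _ _ => japSq_le_four_mul' (hD.P_near p))

omit hD in
lemma _root_.PMA.LegendreFlow.growth_w (D : LegendreFlow E c₀ m₁ m₂) : Growth 0 D.w := by
  refine ⟨D.cont_w, max |m₁| |m₂|, by positivity, fun p t _ => ?_⟩
  have := D.w_mem p t
  simpa using abs_le_max_abs_abs this.1 this.2

omit hD in
lemma _root_.PMA.LegendreFlow.growth_g (D : LegendreFlow E c₀ m₁ m₂) :
    Growth 0 fun (_ : E) t => D.g t := Growth.of_time D.cont_g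

lemma growth_ν : Growth 0 D.ν := hD.growth_comp_X D.growth_w

lemma r_le (p : E) {t : ℝ} (ht : t ∈ Icc (-1 : ℝ) 0) : ‖D.r p t‖ ≤ 1 / 2 * (1 + ‖p‖) := by
  have h1 := hD.X_near p t ht
  have h2 := hD.Y_near' p
  have h3 : D.r p t = (D.X p t - p) - (D.Y p - p) := by simp [r]
  rw [h3]
  exact (norm_sub_le _ _).trans (by linarith)

lemma growth_r : Growth 1 fun p t => ‖D.r p t‖ := by
  refine Growth.norm D.cont_r 1 fun p t ht => (hD.r_le p ht).trans ?_
  have := norm_le_japSq p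
  have := one_le_japSq p
  simp only [zpow_one, one_mul]
  linarith

omit hD [MeasurableSpace E] [BorelSpace E] in
lemma growth_of_gradient {f : E → ℝ → ℝ} (hf : Continuous fun z : E × ℝ => f z.1 z.2)
    {F : E → ℝ → E} (hF : ∀ p t, HasGradientAt (fun q => f q t) (F p t) p) {C : ℝ}
    (hb : ∀ p, ∀ t ∈ Icc (-1 : ℝ) 0, ‖F p t‖ ≤ C * (1 + ‖p‖)) : Growth 1 f := by
  have h0 : Growth 0 fun (_ : E) t => f 0 t :=
    Growth.of_time (hf.comp (Continuous.prodMk_right 0))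
  obtain ⟨A, hA, hA'⟩ := h0.bound
  have hC : 0 ≤ C := by simpa using (norm_nonneg _).trans (hb 0 0 (by simp))
  refine ⟨hf, A + 2 * C, by positivity, fun p t ht => ?_⟩
  have h1 : ‖f p t - f 0 t‖ ≤ C * (1 + ‖p‖) * ‖p - 0‖ := by
    refine (convex_closedBall (0 : E) ‖p‖).norm_image_sub_le_of_norm_hasFDerivWithin_le
      (f := fun q => f q t) (fun q _ => (hF q t).hasFDerivAt.hasFDerivWithinAt) (fun q hq => ?_)
      (by simp) (by simp)
    rw [LinearIsometryEquiv.norm_map]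
    refine (hb q t ht).trans ?_
    have : ‖q‖ ≤ ‖p‖ := by simpa using hq
    gcongr
  have h2 := hA' 0 t ht
  simp only [zpow_zero, mul_one] at h2
  have h3 : (1 + ‖p‖) * ‖p‖ ≤ 2 * japSq p := by
    unfold japSq; nlinarith [sq_nonneg (‖p‖ - 1)]
  rw [sub_zero, Real.norm_eq_abs] at h1
  have h4 : |f p t| ≤ |f p t - f 0 t| + |f 0 t| := by simpa using abs_add_le (f p t - f 0 t) (f 0 t)
  have h5 := one_le_japSq p
  rw [zpow_one]
  nlinarith

lemma growth_k : Growth 1 D.k :=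
  growth_of_gradient D.cont_k D.gradk fun p _ ht => hD.r_le p ht

lemma growth_V : Growth 1 fun p (_ : ℝ) => D.V p := by
  refine growth_of_gradient (D.cont_V.comp continuous_fst) (fun p _ => D.gradV p) (C := 2)
    fun p t _ => ?_
  have h1 := hD.Y_near' p
  have h2 : ‖D.Y p‖ ≤ ‖p‖ + ‖D.Y p - p‖ := by simpa using norm_add_le p (D.Y p - p)
  nlinarith [norm_nonneg p]

lemma growth_h : Growth 1 D.h := by
  have hu : Growth 1 D.u := by
    obtain ⟨C, hC⟩ := D.growth_u 1
    refine ⟨D.cont_u, |C|, abs_nonneg _, fun p t ht => (hC p t ht).trans ?_⟩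
    rw [zpow_one]
    have := japSq_pos p
    gcongr
    exact le_abs_self C
  have hi : Growth 1 fun x (_ : ℝ) => inner ℝ (D.P x) x := by
    refine ⟨?_, 2, by norm_num, fun p t _ => ?_⟩
    · exact ((D.cont_P.comp continuous_fst).inner continuous_fst)
    · have h1 := hD.P_near p
      have h2 : ‖D.P p‖ ≤ ‖p‖ + ‖D.P p - p‖ := by simpa using norm_add_le p (D.P p - p)
      refine (abs_real_inner_le_norm _ _).trans ?_
      rw [zpow_one]
      unfold japSq
      nlinarith [norm_nonneg p, sq_nonneg (‖p‖ - 1)]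
  have hU : Growth 1 fun x (_ : ℝ) => D.U x := by
    have h1 : ∀ x, D.U x = inner ℝ (D.P x) x - D.V (D.P x) := fun x => by
      simpa [D.Y_P] using D.U_Y (D.P x)
    simp only [h1]
    exact hi.sub (hD.growth_comp_P hD.growth_V)
  exact (hu.sub hU).add ((Growth.of_time D.cont_G).mono (by norm_num))

lemma wtX_le (p : E) {t : ℝ} (ht : t ∈ Icc (-1 : ℝ) 0) : wt (D.X p t) ≤ 4 ^ wtExp E * wt p :=
  wt_le_of_near (hD.X_near p t ht)

lemma le_wtX (p : E) {t : ℝ} (ht : t ∈ Icc (-1 : ℝ) 0) : wt p ≤ 4 ^ wtExp E * wt (D.X p t) :=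
  wt_ge_of_near (hD.X_near p t ht)

lemma wtY_le (p : E) : wt (D.Y p) ≤ 4 ^ wtExp E * wt p := wt_le_of_near (hD.Y_near' p)

lemma le_wtY (p : E) : wt p ≤ 4 ^ wtExp E * wt (D.Y p) := wt_ge_of_near (hD.Y_near' p)

lemma abs_wt_sub_le (p : E) {t : ℝ} (ht : t ∈ Icc (-1 : ℝ) 0) :
    |wt (D.X p t) - wt (D.Y p)| ≤ wtLip (wtExp E) * (wt p * ‖D.r p t‖) :=
  abs_wt_sub_wt_le (hD.X_near p t ht) (hD.Y_near' p)

lemma growth_wtX_mul {f : E → ℝ → ℝ} {j : ℤ} (hf : Growth j f) (hj : j ≤ 6) :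
    Growth (-(Module.finrank ℝ E + 1 : ℤ)) fun p t => wt (D.X p t) * f p t :=
  ((hD.growth_comp_X growth_wt).mul hf).mono (neg_wtExp_add_le hj)

lemma growth_wtY_mul {f : E → ℝ → ℝ} {j : ℤ} (hf : Growth j f) (hj : j ≤ 6) :
    Growth (-(Module.finrank ℝ E + 1 : ℤ)) fun p t => wt (D.Y p) * f p t :=
  ((hD.growth_comp_Y growth_wt).mul hf).mono (neg_wtExp_add_le hj)

/-- The energy dissipation inequality on a time slice. -/
lemma integral_wtY_mul_k_mul_le (hc₀ : 0 < c₀) (hm₁ : 0 < m₁) {c₁ : ℝ}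
    (hc₁ : 2 * c₁ * 4 ^ wtExp E = c₀ * m₁) {t : ℝ} (ht : t ∈ Icc (-1 : ℝ) 0) :
    ∫ p, wt (D.Y p) * (D.k p t * (D.ν p t - D.g t)) ≤
      (m₂ * wtLip (wtExp E)) ^ 2 / (4 * c₁) * (∫ p, wt p * D.k p t ^ 2)
        - c₁ * ∫ p, wt p * ‖D.r p t‖ ^ 2 := by
  have h4 : (0 : ℝ) < 4 ^ wtExp E := by positivity
  have hc₁' : 0 < c₁ := by
    have : 0 < c₀ * m₁ := by positivity
    by_contra hcon
    nlinarith
  have hkP : Growth 1 fun p t => D.k (D.P (D.X p t)) t :=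
    hD.growth_comp_X (hD.growth_comp_P hD.growth_k)
  have g1 := hD.growth_wtY_mul (hD.growth_k.mul hD.growth_ν) (by norm_num)
  have g2 := hD.growth_wtX_mul (hkP.mul hD.growth_ν) (by norm_num)
  have g3 := hD.growth_wtY_mul (hD.growth_k) (by norm_num)
  have g4 := growth_wt_mul hD.growth_k.sq (by norm_num)
  have g5 := growth_wt_mul hD.growth_r.sq (by norm_num)
  have e1 := D.transport' t (fun x => wt x * D.k (D.P x) t)
  simp only [D.P_Y] at e1
  have e2 : ∫ p, wt (D.Y p) * (D.k p t * (D.ν p t - D.g t)) =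
      (∫ p, wt (D.Y p) * (D.k p t * D.ν p t)) - D.g t * ∫ p, wt (D.Y p) * D.k p t := by
    rw [← integral_const_mul, ← integral_sub (g1.integrable le_rfl ht)
      ((g3.integrable le_rfl ht).const_mul _)]
    congr 1; ext p; ring
  have e3 : ∫ p, wt (D.X p t) * D.k (D.P (D.X p t)) t * D.ν p t =
      ∫ p, wt (D.X p t) * (D.k (D.P (D.X p t)) t * D.ν p t) := by
    congr 1; ext p; ring
  rw [e2, ← e1, e3, ← integral_const_mul, ← integral_const_mul,
    ← integral_sub (g1.integrable le_rfl ht) (g2.integrable le_rfl ht),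
    ← integral_sub ((g4.integrable le_rfl ht).const_mul _) ((g5.integrable le_rfl ht).const_mul _)]
  refine integral_mono ((g1.integrable le_rfl ht).sub (g2.integrable le_rfl ht))
    (((g4.integrable le_rfl ht).const_mul _).sub ((g5.integrable le_rfl ht).const_mul _))
    fun p => ?_
  have hk := D.k_add_le p t
  have hν := D.ν_mem p t
  have hL := hD.abs_wt_sub_le p ht
  have hX := hD.le_wtX p ht
  have hwX := wt_pos (D.X p t)
  have hwp := wt_pos p
  set L := wtLip (wtExp E)
  have hL0 : 0 ≤ L := wtLip_nonneg _
  set R := ‖D.r p t‖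
  have hR : 0 ≤ R := norm_nonneg _
  have hν0 : 0 < D.ν p t := hm₁.trans_le hν.1
  have a1 : wt (D.X p t) * D.ν p t * (D.k p t + c₀ * R ^ 2) ≤
      wt (D.X p t) * D.ν p t * D.k (D.P (D.X p t)) t := by gcongr
  have a2 : 2 * c₁ * wt p * R ^ 2 ≤ wt (D.X p t) * D.ν p t * (c₀ * R ^ 2) := by
    calc 2 * c₁ * wt p * R ^ 2 ≤ 2 * c₁ * (4 ^ wtExp E * wt (D.X p t)) * R ^ 2 := by gcongr
      _ = wt (D.X p t) * m₁ * (c₀ * R ^ 2) := by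
        linear_combination (wt (D.X p t) * R ^ 2) * hc₁
      _ ≤ _ := by gcongr; exact hν.1
  have a3 : (wt (D.Y p) - wt (D.X p t)) * D.k p t * D.ν p t ≤ (m₂ * L) * (wt p * R * |D.k p t|) := by
    calc _ ≤ |(wt (D.Y p) - wt (D.X p t)) * D.k p t * D.ν p t| := le_abs_self _
      _ = |wt (D.X p t) - wt (D.Y p)| * |D.k p t| * D.ν p t := by
        rw [abs_mul, abs_mul, abs_of_pos hν0, abs_sub_comm]
      _ ≤ (L * (wt p * R)) * |D.k p t| * m₂ := by
        gcongr
        exact hν.2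
      _ = _ := by ring
  have a4 : (m₂ * L) * (R * |D.k p t|) ≤ (m₂ * L) ^ 2 / (4 * c₁) * D.k p t ^ 2 + c₁ * R ^ 2 := by
    have h1 : (m₂ * L) ^ 2 / (4 * c₁) * D.k p t ^ 2 + c₁ * R ^ 2 - (m₂ * L) * (R * |D.k p t|)
        = ((m₂ * L) * |D.k p t| - 2 * c₁ * R) ^ 2 / (4 * c₁) := by
      rw [← sq_abs (D.k p t)]; field_simp; ring
    have h2 : 0 ≤ ((m₂ * L) * |D.k p t| - 2 * c₁ * R) ^ 2 / (4 * c₁) := by positivity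
    linarith
  have a5 := mul_le_mul_of_nonneg_left a4 hwp.le
  simp only
  linarith

end Near

/-- Caccioppoli inequality. -/
lemma exists_caccioppoli (hc₀ : 0 < c₀) (hm₁ : 0 < m₁) : ∃ C, 0 ≤ C ∧
    ∀ (D : LegendreFlow E c₀ m₁ m₂) (δ : ℝ), D.Near δ →
      (∀ t ∈ Icc (-(1 / 2) : ℝ) 0, ∫ p, wt p * D.k p t ^ 2 ≤ C * D.energy) ∧
      ∫ t in (-(1 / 2) : ℝ)..0, ∫ p, wt p * ‖D.r p t‖ ^ 2 ≤ C * D.energy := by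
  set Q : ℝ := 4 ^ wtExp E with hQ
  have hQ0 : 0 < Q := by positivity
  set c₁ : ℝ := c₀ * m₁ / (2 * Q) with hc₁
  have hc₁0 : 0 < c₁ := by positivity
  have hc₁' : 2 * c₁ * 4 ^ wtExp E = c₀ * m₁ := by rw [hc₁, ← hQ]; field_simp
  set C₁ : ℝ := (m₂ * wtLip (wtExp E)) ^ 2 / (4 * c₁)
  have hC₁ : 0 ≤ C₁ := by positivity
  set C₂ : ℝ := Q + 2 * C₁
  have hC₂ : 0 ≤ C₂ := by positivity
  refine ⟨2 * Q * C₂ + C₂ / c₁, by positivity, fun D δ hD => ?_⟩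
  have gk := growth_wt_mul hD.growth_k.sq (by norm_num)
  have gr := growth_wt_mul hD.growth_r.sq (by norm_num)
  have gYk := hD.growth_wtY_mul hD.growth_k.sq (by norm_num)
  have gνg : Growth 1 fun p t => D.k p t * (D.ν p t - D.g t) :=
    hD.growth_k.mul (hD.growth_ν.sub D.growth_g)
  have gYν := hD.growth_wtY_mul gνg (by norm_num)
  have gt : Growth 0 fun (_ : E) t => 1 + t := Growth.of_time (by fun_prop)
  have gF : Growth (-(Module.finrank ℝ E + 1 : ℤ))
      fun p t => (1 + t) * (wt (D.Y p) * D.k p t ^ 2) := by simpa using gt.mul gYk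
  have gF' : Growth (-(Module.finrank ℝ E + 1 : ℤ))
      fun p t => wt (D.Y p) * D.k p t ^ 2 +
        2 * ((1 + t) * (wt (D.Y p) * (D.k p t * (D.ν p t - D.g t)))) := by
    refine gYk.add (Growth.const_mul ?_ 2)
    simpa using gt.mul gYν
  set e : ℝ → ℝ := fun t => ∫ p, wt p * D.k p t ^ 2
  set ρ : ℝ → ℝ := fun t => ∫ p, wt p * ‖D.r p t‖ ^ 2
  have he0 : ∀ t, 0 ≤ e t := fun t =>
    integral_nonneg fun p => mul_nonneg (wt_pos p).le (sq_nonneg _)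
  have hρ0 : ∀ t, 0 ≤ ρ t := fun t =>
    integral_nonneg fun p => mul_nonneg (wt_pos p).le (sq_nonneg _)
  have hec : ContinuousOn e (Icc (-1) 0) := gk.continuousOn_integral le_rfl
  have hρc : ContinuousOn ρ (Icc (-1) 0) := gr.continuousOn_integral le_rfl
  have hE : D.energy = ∫ t in (-1 : ℝ)..0, e t := rfl
  have key : ∀ T ∈ Icc (-1 : ℝ) 0, (1 + T) * (∫ p, wt (D.Y p) * D.k p T ^ 2) +
      ∫ t in (-1 : ℝ)..T, 2 * c₁ * (1 + t) * ρ t ≤ C₂ * D.energy := by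
    intro T hT
    have hsub : uIcc (-1 : ℝ) T ⊆ Icc (-1) 0 := by
      rw [uIcc_of_le hT.1]; exact Icc_subset_Icc_right hT.2
    have i1 : IntervalIntegrable (fun t => C₂ * e t) volume (-1) T :=
      ((hec.mono hsub).intervalIntegrable).const_mul _
    have i2 : IntervalIntegrable (fun t => 2 * c₁ * (1 + t) * ρ t) volume (-1) T :=
      (ContinuousOn.mul (by fun_prop) (hρc.mono hsub)).intervalIntegrable
    have h1 := Growth.integral_sub_integral le_rfl gF gF' le_rfl hT.1 hT.2 (fun p t ht => by
      have h := D.deriv_k p (ht.2.trans_le hT.2)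
      have h1 : HasDerivAt (fun t : ℝ => 1 + t) 1 t := (hasDerivAt_id t).const_add 1
      have h2 := h1.mul ((h.pow 2).const_mul (wt (D.Y p)))
      refine h2.congr_deriv ?_
      simp only [Pi.pow_apply]
      ring)
    simp only [integral_const_mul] at h1
    have h0 : (1 + (-1 : ℝ)) = 0 := by norm_num
    rw [h0, zero_mul, sub_zero] at h1
    rw [h1]
    have h2 : (∫ t in (-1 : ℝ)..T, ∫ p, wt (D.Y p) * D.k p t ^ 2 +
        2 * ((1 + t) * (wt (D.Y p) * (D.k p t * (D.ν p t - D.g t))))) ≤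
        ∫ t in (-1 : ℝ)..T, (C₂ * e t - 2 * c₁ * (1 + t) * ρ t) := by
      refine intervalIntegral.integral_mono_on hT.1
        (gF'.intervalIntegrable le_rfl ⟨le_rfl, by norm_num⟩ hT) (i1.sub i2) fun t ht => ?_
      have ht' : t ∈ Icc (-1 : ℝ) 0 := ⟨ht.1, ht.2.trans hT.2⟩
      have h3 := hD.integral_wtY_mul_k_mul_le hc₀ hm₁ hc₁' ht'
      have h4 : ∫ p, wt (D.Y p) * D.k p t ^ 2 ≤ Q * e t := by
        rw [← integral_const_mul]
        refine integral_mono (gYk.integrable le_rfl ht')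
          ((gk.integrable le_rfl ht').const_mul _) fun p => ?_
        have := hD.wtY_le p
        simp only
        rw [← mul_assoc]
        gcongr
      rw [integral_add (gYk.integrable le_rfl ht')
        (((gYν.integrable le_rfl ht').const_mul _).const_mul _), integral_const_mul,
        integral_const_mul]
      have h5 : 0 ≤ 1 + t := by linarith [ht'.1]
      have h6 := mul_le_mul_of_nonneg_left h3 h5
      have h7 : (1 + t) * (C₁ * e t) ≤ 1 * (C₁ * e t) := by
        have := he0 t
        gcongr
        linarith [ht'.2]
      simp only [C₂]
      linarith
    have h3 : ∫ t in (-1 : ℝ)..T, C₂ * e t ≤ C₂ * D.energy := by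
      rw [intervalIntegral.integral_const_mul, hE]
      gcongr
      refine intervalIntegral.integral_mono_interval le_rfl hT.1 hT.2
        (Filter.Eventually.of_forall he0) ?_
      exact (gk.intervalIntegrable le_rfl (by norm_num) (by norm_num))
    rw [intervalIntegral.integral_sub i1 i2] at h2
    linarith
  have hE0 : 0 ≤ D.energy := by
    rw [hE]; exact intervalIntegral.integral_nonneg (by norm_num) fun t _ => he0 t
  constructor
  · intro T hT
    have hT' : T ∈ Icc (-1 : ℝ) 0 := ⟨by linarith [hT.1], hT.2⟩
    have h1 := key T hT'
    have h2 : 0 ≤ ∫ t in (-1 : ℝ)..T, 2 * c₁ * (1 + t) * ρ t :=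
      intervalIntegral.integral_nonneg hT'.1 fun t ht => by
        have := hρ0 t
        have : 0 ≤ 1 + t := by linarith [ht.1]
        positivity
    have h3 : e T ≤ Q * ∫ p, wt (D.Y p) * D.k p T ^ 2 := by
      rw [← integral_const_mul]
      refine integral_mono (gk.integrable le_rfl hT')
        ((gYk.integrable le_rfl hT').const_mul _) fun p => ?_
      have := hD.le_wtY p
      simp only
      rw [← mul_assoc]
      gcongr
    have h4 : 0 ≤ ∫ p, wt (D.Y p) * D.k p T ^ 2 :=
      integral_nonneg fun p => mul_nonneg (wt_pos _).le (sq_nonneg _)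
    have h5 : 1 / 2 * (∫ p, wt (D.Y p) * D.k p T ^ 2) ≤ C₂ * D.energy := by
      have : 1 / 2 * (∫ p, wt (D.Y p) * D.k p T ^ 2) ≤
        (1 + T) * (∫ p, wt (D.Y p) * D.k p T ^ 2) := by gcongr; linarith [hT.1]
      linarith
    have h6 : 0 ≤ C₂ / c₁ * D.energy := by positivity
    calc e T ≤ Q * (2 * (C₂ * D.energy)) := h3.trans (by gcongr; linarith)
      _ ≤ _ := by linarith
  · have h1 := key 0 (by norm_num)
    have h4 : 0 ≤ ∫ p, wt (D.Y p) * D.k p 0 ^ 2 :=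
      integral_nonneg fun p => mul_nonneg (wt_pos _).le (sq_nonneg _)
    have i2 : ∀ a ∈ Icc (-1 : ℝ) 0,
        IntervalIntegrable (fun t => 2 * c₁ * (1 + t) * ρ t) volume a 0 := fun a ha =>
      (ContinuousOn.mul (by fun_prop) (hρc.mono (by
        rw [uIcc_of_le ha.2]; exact Icc_subset_Icc_left ha.1))).intervalIntegrable
    have h2 : ∫ t in (-(1 / 2) : ℝ)..0, c₁ * ρ t ≤ ∫ t in (-1 : ℝ)..0, 2 * c₁ * (1 + t) * ρ t := by
      have h3 : ∫ t in (-(1 / 2) : ℝ)..0, c₁ * ρ t ≤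
          ∫ t in (-(1 / 2) : ℝ)..0, 2 * c₁ * (1 + t) * ρ t := by
        refine intervalIntegral.integral_mono_on (by norm_num)
          ((gr.intervalIntegrable le_rfl (by norm_num) (by norm_num)).const_mul _)
          (i2 _ (by norm_num)) fun t ht => ?_
        have := hρ0 t
        gcongr
        nlinarith [ht.1]
      refine h3.trans ?_
      refine intervalIntegral.integral_mono_interval (by norm_num) (by norm_num) le_rfl ?_
        (i2 _ (by norm_num))
      filter_upwards [ae_restrict_mem measurableSet_Ioc] with t ht
      have := hρ0 t
      have : 0 ≤ 1 + t := by linarith [ht.1]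
      simp only [Pi.zero_apply]
      positivity
    rw [intervalIntegral.integral_const_mul] at h2
    have h5 : 0 ≤ 2 * Q * C₂ * D.energy := by positivity
    have h6 : ∫ t in (-(1 / 2) : ℝ)..0, ρ t ≤ C₂ * D.energy / c₁ := by
      rw [le_div_iff₀ hc₁0]
      linarith
    calc _ ≤ C₂ * D.energy / c₁ := h6
      _ = C₂ / c₁ * D.energy := by ring
      _ ≤ _ := by linarith

end LegendreFlow

end Energy

end PMA

namespace PMA

section Variance

variable {E : Type*} [NormedAddCommGroup E] [InnerProductSpace ℝ E] [FiniteDimensional ℝ E]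
  [MeasurableSpace E] [BorelSpace E]

omit [InnerProductSpace ℝ E] [FiniteDimensional ℝ E] [MeasurableSpace E] [BorelSpace E] in
lemma Growth.abs {i : ℤ} {f : E → ℝ → ℝ} (hf : Growth i f) : Growth i fun p t => |f p t| :=
  Growth.of_le hf.cont.abs hf 1 fun p t _ => by simp

lemma integrable_wt : Integrable (wt : E → ℝ) := by
  simpa using (growth_wt_mul (Growth.of_time (E := E) (g := fun _ => 1) continuous_const)
    (by norm_num)).integrable le_rfl (t := 0) (by simp)

omit [FiniteDimensional ℝ E] [MeasurableSpace E] [BorelSpace E] in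
lemma wt_mul_abs_le (p : E) (x : ℝ) {μ : ℝ} (hμ : 0 < μ) :
    wt p * |x| ≤ 1 / 2 * (μ * wt p + μ⁻¹ * (wt p * x ^ 2)) := by
  have h : 1 / 2 * (μ * wt p + μ⁻¹ * (wt p * x ^ 2)) - wt p * |x|
      = wt p * (|x| - μ) ^ 2 / (2 * μ) := by
    rw [← sq_abs x]; field_simp; ring
  have := wt_pos p
  have : 0 ≤ wt p * (|x| - μ) ^ 2 / (2 * μ) := by positivity
  linarith

lemma Growth.integral_wt_mul_abs_le {f : E → ℝ → ℝ} {j : ℤ} (hf : Growth j f) (hj : j ≤ 3)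
    {μ : ℝ} (hμ : 0 < μ) {t : ℝ} (ht : t ∈ Icc (-1 : ℝ) 0) :
    ∫ p, wt p * |f p t| ≤ 1 / 2 * (μ * wtMass E + μ⁻¹ * ∫ p, wt p * f p t ^ 2) := by
  have g1 := (growth_wt_mul hf.abs (by linarith)).integrable le_rfl ht
  have g2 := (growth_wt_mul hf.sq (by linarith)).integrable le_rfl ht
  rw [wtMass, ← integral_const_mul, ← integral_const_mul, ← integral_add
    (integrable_wt.const_mul _) (g2.const_mul _), ← integral_const_mul]
  exact integral_mono g1 (((integrable_wt.const_mul _).add (g2.const_mul _)).const_mul _)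
    fun p => wt_mul_abs_le p _ hμ

namespace LegendreFlow

variable {c₀ m₁ m₂ : ℝ}

lemma Near.integral_wtX_mul_sq {D : LegendreFlow E c₀ m₁ m₂} {δ : ℝ} (hD : D.Near δ)
    {t : ℝ} (ht : t ∈ Icc (-1 : ℝ) 0) :
    ∫ p, wt (D.X p t) * (D.ν p t - D.g t) ^ 2 =
      D.g t * ((∫ p, wt (D.Y p) * (D.w (D.Y p) t - D.g t)) +
        ∫ p, D.g t * (wt (D.X p t) - wt (D.Y p))) := by
  have e1 := D.transport' t (fun x => wt x * D.w x t)
  have e2 := D.transport' t (fun x => wt x)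
  have g0 : Growth 0 fun (_ : E) (_ : ℝ) => (1 : ℝ) := Growth.of_time continuous_const
  have j1 := (hD.growth_wtX_mul (hD.growth_ν.mul hD.growth_ν) (by norm_num)).integrable le_rfl ht
  have j2 := (hD.growth_wtX_mul hD.growth_ν (by norm_num)).integrable le_rfl ht
  have j3 := (hD.growth_wtX_mul g0 (by norm_num)).integrable le_rfl ht
  have j4 := (hD.growth_wtY_mul (hD.growth_comp_Y D.growth_w) (by norm_num)).integrable le_rfl ht
  have j5 := (hD.growth_wtY_mul g0 (by norm_num)).integrable le_rfl ht
  simp only [mul_one] at j3 j5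
  have e3 : ∫ p, wt (D.X p t) * (D.ν p t - D.g t) ^ 2 =
      (∫ p, wt (D.X p t) * (D.ν p t * D.ν p t)) - 2 * D.g t * (∫ p, wt (D.X p t) * D.ν p t)
        + D.g t ^ 2 * ∫ p, wt (D.X p t) := by
    have j6 : Integrable fun p =>
        wt (D.X p t) * (D.ν p t * D.ν p t) - 2 * D.g t * (wt (D.X p t) * D.ν p t) :=
      j1.sub (j2.const_mul _)
    rw [← integral_const_mul, ← integral_const_mul, ← integral_sub j1 (j2.const_mul _),
      ← integral_add j6 (j3.const_mul _)]
    congr 1; ext p; ring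
  have e4 : ∫ p, wt (D.Y p) * (D.w (D.Y p) t - D.g t) =
      (∫ p, wt (D.Y p) * D.w (D.Y p) t) - D.g t * ∫ p, wt (D.Y p) := by
    rw [← integral_const_mul, ← integral_sub j4 (j5.const_mul _)]
    congr 1; ext p; ring
  have e5 : ∫ p, wt (D.X p t) * (D.ν p t * D.ν p t) =
      ∫ p, wt (D.X p t) * D.w (D.X p t) t * D.ν p t := by
    congr 1; ext p; simp only [ν]; ring
  rw [e3, e4, e5, e1, e2, integral_const_mul, integral_sub j3 j5]
  ring

/-- The mean square deviation of the time derivative is controlled linearly. -/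
lemma exists_variance (hc₀ : 0 < c₀) (hm₁ : 0 < m₁) : ∃ C, 0 ≤ C ∧
    ∀ (D : LegendreFlow E c₀ m₁ m₂) (δ : ℝ), D.Near δ → ∀ μ, 0 < μ → D.energy ≤ μ ^ 2 →
      ∫ t in (-(1 / 2) : ℝ)..0, ∫ p, wt p * (D.ν p t - D.g t) ^ 2 ≤ C * μ := by
  obtain ⟨C₁, hC₁, hcac⟩ := exists_caccioppoli (E := E) (m₂ := m₂) hc₀ hm₁
  set Q : ℝ := 4 ^ wtExp E with hQ
  have hQ0 : 0 < Q := by positivity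
  set W := wtMass E
  have hW : 0 ≤ W := wtMass_nonneg
  set L := wtLip (wtExp E)
  have hL : 0 ≤ L := wtLip_nonneg _
  set A : ℝ := 1 / 2 * (W + C₁)
  have hA : 0 ≤ A := by positivity
  refine ⟨Q * (|m₂| * (|m₂| / m₁ * Q * A + Q * A + |m₂| * L * A)), by positivity,
    fun D δ hD μ hμ hE => ?_⟩
  obtain ⟨hcac1, hcac2⟩ := hcac D δ hD
  have hm₂ : 0 < m₂ := hm₁.trans_le D.m₁_le_m₂
  rw [abs_of_pos hm₂]
  have hgpos : ∀ t, 0 < D.g t := fun t => hm₁.trans_le (D.g_mem t).1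
  have hhalf : ∀ {t : ℝ}, t ∈ Icc (-(1 / 2) : ℝ) 0 → t ∈ Icc (-1 : ℝ) 0 := fun ht =>
    ⟨by linarith [ht.1], ht.2⟩
  have hk1 : ∀ t ∈ Icc (-(1 / 2) : ℝ) 0, ∫ p, wt p * |D.k p t| ≤ A * μ := fun t ht => by
    refine (hD.growth_k.integral_wt_mul_abs_le (by norm_num) hμ (hhalf ht)).trans ?_
    have h1 : μ⁻¹ * ∫ p, wt p * D.k p t ^ 2 ≤ C₁ * μ := by
      rw [inv_mul_le_iff₀ hμ]
      calc _ ≤ C₁ * μ ^ 2 := (hcac1 t ht).trans (by gcongr)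
        _ = _ := by ring
    simp only [A]
    linarith
  have gr := growth_wt_mul hD.growth_r (by norm_num)
  have gr2 := growth_wt_mul hD.growth_r.sq (by norm_num)
  have hr1 : ∫ t in (-(1 / 2) : ℝ)..0, ∫ p, wt p * ‖D.r p t‖ ≤ A * μ := by
    calc ∫ t in (-(1 / 2) : ℝ)..0, ∫ p, wt p * ‖D.r p t‖
        ≤ ∫ t in (-(1 / 2) : ℝ)..0, 1 / 2 * (μ * W + μ⁻¹ * ∫ p, wt p * ‖D.r p t‖ ^ 2) := by
          refine intervalIntegral.integral_mono_on (by norm_num)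
            (gr.intervalIntegrable le_rfl (by norm_num) (by norm_num)) ?_ fun t ht => ?_
          · exact (intervalIntegrable_const.add ((gr2.intervalIntegrable le_rfl (by norm_num)
              (by norm_num)).const_mul _)).const_mul _
          · have := hD.growth_r.integral_wt_mul_abs_le (by norm_num) hμ (hhalf ht)
            simpa only [abs_norm] using this
      _ = 1 / 2 * (1 / 2 * (μ * W) + μ⁻¹ * ∫ t in (-(1 / 2) : ℝ)..0, ∫ p, wt p * ‖D.r p t‖ ^ 2) := by
          rw [intervalIntegral.integral_const_mul, intervalIntegral.integral_add
            intervalIntegrable_const ((gr2.intervalIntegrable le_rfl (by norm_num)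
              (by norm_num)).const_mul _), intervalIntegral.integral_const_mul,
            intervalIntegral.integral_const, smul_eq_mul]
          norm_num
          ring
      _ ≤ A * μ := by
          have h1 : μ⁻¹ * ∫ t in (-(1 / 2) : ℝ)..0, ∫ p, wt p * ‖D.r p t‖ ^ 2 ≤ C₁ * μ := by
            rw [inv_mul_le_iff₀ hμ]
            calc _ ≤ C₁ * μ ^ 2 := hcac2.trans (by gcongr)
              _ = _ := by ring
          have : 0 ≤ μ * W := by positivity
          simp only [A]
          linarith
  have gν := growth_wt_mul (hD.growth_ν.sub D.growth_g).sq (by norm_num)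
  have gXν := hD.growth_wtX_mul (hD.growth_ν.sub D.growth_g).sq (by norm_num)
  have g0 : Growth 0 fun (_ : E) (_ : ℝ) => (1 : ℝ) := Growth.of_time continuous_const
  have gYw := hD.growth_wtY_mul ((hD.growth_comp_Y D.growth_w).sub D.growth_g) (by norm_num)
  have gd : Growth (-(Module.finrank ℝ E + 1 : ℤ)) fun p t =>
      D.g t * (wt (D.X p t) - wt (D.Y p)) := by
    have := D.growth_g.mul ((hD.growth_wtX_mul g0 (by norm_num)).sub
      (hD.growth_wtY_mul g0 (by norm_num)))
    simpa using this
  have gYh := hD.growth_wtY_mul (hD.growth_comp_Y hD.growth_h) (by norm_num)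
  have gXh := hD.growth_wtX_mul ((hD.growth_comp_X hD.growth_h).mul hD.growth_ν) (by norm_num)
  have gka := growth_wt_mul hD.growth_k.abs (by norm_num)
  have hftc : (∫ p, wt (D.Y p) * D.h (D.Y p) 0) - ∫ p, wt (D.Y p) * D.h (D.Y p) (-(1 / 2)) =
      -∫ t in (-(1 / 2) : ℝ)..0, ∫ p, wt (D.Y p) * (D.w (D.Y p) t - D.g t) := by
    rw [← intervalIntegral.integral_neg]
    simp only [← integral_neg]
    refine Growth.integral_sub_integral le_rfl gYh gYw.neg (by norm_num) (by norm_num) le_rfl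
      fun p t ht => ?_
    have h1 := (((D.deriv_u (D.Y p) t ht.2).sub_const (D.U (D.Y p))).add
      (D.deriv_G t ht.2)).const_mul (wt (D.Y p))
    refine h1.congr_deriv ?_
    ring
  have hb1 : -∫ p, wt (D.Y p) * D.h (D.Y p) 0 ≤ Q * A * μ := by
    have h0 : (0 : ℝ) ∈ Icc (-1 : ℝ) 0 := by simp
    rw [← integral_neg]
    calc ∫ p, -(wt (D.Y p) * D.h (D.Y p) 0) ≤ ∫ p, Q * (wt p * |D.k p 0|) := by
          refine integral_mono (gYh.integrable le_rfl h0).neg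
            ((gka.integrable le_rfl h0).const_mul _) fun p => ?_
          have h1 := D.neg_k_le_h_Y p 0
          have h2 := le_abs_self (D.k p 0)
          have h3 := wt_pos (D.Y p)
          calc -(wt (D.Y p) * D.h (D.Y p) 0) = wt (D.Y p) * (-D.h (D.Y p) 0) := by ring
            _ ≤ wt (D.Y p) * |D.k p 0| := by gcongr; linarith
            _ ≤ (Q * wt p) * |D.k p 0| := by gcongr; exact hD.wtY_le p
            _ = _ := by ring
      _ = Q * ∫ p, wt p * |D.k p 0| := integral_const_mul _ _
      _ ≤ Q * (A * μ) := by gcongr; exact hk1 0 (by norm_num)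
      _ = _ := by ring
  have hb2 : ∫ p, wt (D.Y p) * D.h (D.Y p) (-(1 / 2)) ≤ m₂ / m₁ * Q * A * μ := by
    set s : ℝ := -(1 / 2) with hs
    have hs0 : s ∈ Icc (-1 : ℝ) 0 := by norm_num [hs]
    have h1 := D.transport' s (fun x => wt x * D.h x s)
    have h2 : D.g s * ∫ p, wt (D.Y p) * D.h (D.Y p) s ≤ m₂ * Q * A * μ := by
      rw [← h1]
      calc ∫ p, wt (D.X p s) * D.h (D.X p s) s * D.ν p s ≤ ∫ p, m₂ * Q * (wt p * |D.k p s|) := by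
            refine integral_mono ?_ ((gka.integrable le_rfl hs0).const_mul _) fun p => ?_
            · have := gXh.integrable le_rfl hs0
              simpa only [mul_assoc] using this
            have h1 := D.h_X_le hc₀.le p s
            have h2 := neg_abs_le (D.k p s)
            have h3 := wt_pos (D.X p s)
            have h4 := D.ν_mem p s
            have h5 : 0 < D.ν p s := hm₁.trans_le h4.1
            calc wt (D.X p s) * D.h (D.X p s) s * D.ν p s
                ≤ wt (D.X p s) * |D.k p s| * D.ν p s := by gcongr; linarith
              _ ≤ (Q * wt p) * |D.k p s| * m₂ := by
                  have := wt_pos p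
                  gcongr
                  · exact hD.wtX_le p hs0
                  · exact h4.2
              _ = _ := by ring
        _ = m₂ * Q * ∫ p, wt p * |D.k p s| := integral_const_mul _ _
        _ ≤ m₂ * Q * (A * μ) := by gcongr; exact hk1 s (by norm_num [hs])
        _ = _ := by ring
    rcases le_or_gt (∫ p, wt (D.Y p) * D.h (D.Y p) s) 0 with h0 | h0
    · exact h0.trans (by positivity)
    · have h3 : m₁ * ∫ p, wt (D.Y p) * D.h (D.Y p) s ≤ m₂ * Q * A * μ :=
        le_trans (by gcongr; exact (D.g_mem s).1) h2
      calc ∫ p, wt (D.Y p) * D.h (D.Y p) s ≤ m₂ * Q * A * μ / m₁ := by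
            rw [le_div_iff₀ hm₁]; linarith
        _ = _ := by ring
  have hb3 : ∫ t in (-(1 / 2) : ℝ)..0, ∫ p, D.g t * (wt (D.X p t) - wt (D.Y p)) ≤
      m₂ * L * A * μ := by
    calc _ ≤ ∫ t in (-(1 / 2) : ℝ)..0, ∫ p, m₂ * L * (wt p * ‖D.r p t‖) := by
          refine Growth.interval_mono le_rfl gd (gr.const_mul _) (by norm_num) (by norm_num) le_rfl
            fun p t ht => ?_
          calc D.g t * (wt (D.X p t) - wt (D.Y p)) ≤ D.g t * |wt (D.X p t) - wt (D.Y p)| := by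
                have := hgpos t
                gcongr
                exact le_abs_self _
            _ ≤ m₂ * (L * (wt p * ‖D.r p t‖)) := by
                gcongr
                · exact (D.g_mem t).2
                · exact hD.abs_wt_sub_le p (hhalf ht)
            _ = _ := by ring
      _ = m₂ * L * ∫ t in (-(1 / 2) : ℝ)..0, ∫ p, wt p * ‖D.r p t‖ := by
          simp only [integral_const_mul, intervalIntegral.integral_const_mul]
      _ ≤ m₂ * L * (A * μ) := by gcongr
      _ = _ := by ring
  have iYw := gYw.intervalIntegrable le_rfl (a := -(1 / 2)) (b := 0) (by norm_num) (by norm_num)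
  have igd := gd.intervalIntegrable le_rfl (a := -(1 / 2)) (b := 0) (by norm_num) (by norm_num)
  have hslice : ∀ t ∈ Icc (-(1 / 2) : ℝ) 0, ∫ p, wt p * (D.ν p t - D.g t) ^ 2 ≤
      Q * (m₂ * ((∫ p, wt (D.Y p) * (D.w (D.Y p) t - D.g t)) +
        ∫ p, D.g t * (wt (D.X p t) - wt (D.Y p)))) := by
    intro t ht
    have h1 := hD.integral_wtX_mul_sq (hhalf ht)
    set B := (∫ p, wt (D.Y p) * (D.w (D.Y p) t - D.g t)) +
        ∫ p, D.g t * (wt (D.X p t) - wt (D.Y p))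
    have h2 : 0 ≤ ∫ p, wt (D.X p t) * (D.ν p t - D.g t) ^ 2 :=
      integral_nonneg fun p => mul_nonneg (wt_pos _).le (sq_nonneg _)
    have hB : 0 ≤ B := by
      rw [h1] at h2
      exact nonneg_of_mul_nonneg_right h2 (hgpos t)
    calc ∫ p, wt p * (D.ν p t - D.g t) ^ 2
        ≤ ∫ p, Q * (wt (D.X p t) * (D.ν p t - D.g t) ^ 2) := by
          refine integral_mono (gν.integrable le_rfl (hhalf ht))
            ((gXν.integrable le_rfl (hhalf ht)).const_mul _) fun p => ?_
          have := hD.le_wtX p (hhalf ht)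
          simp only
          rw [← mul_assoc]
          gcongr
      _ = Q * (D.g t * B) := by rw [integral_const_mul, h1]
      _ ≤ Q * (m₂ * B) := by gcongr; exact (D.g_mem t).2
  have hfin := intervalIntegral.integral_mono_on (by norm_num)
    (gν.intervalIntegrable le_rfl (a := -(1 / 2)) (b := 0) (by norm_num) (by norm_num))
    (((iYw.add igd).const_mul _).const_mul _) hslice
  rw [intervalIntegral.integral_const_mul, intervalIntegral.integral_const_mul,
    intervalIntegral.integral_add iYw igd] at hfin
  have hb : (∫ t in (-(1 / 2) : ℝ)..0, ∫ p, wt (D.Y p) * (D.w (D.Y p) t - D.g t)) +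
      ∫ t in (-(1 / 2) : ℝ)..0, ∫ p, D.g t * (wt (D.X p t) - wt (D.Y p)) ≤
      (m₂ / m₁ * Q * A + Q * A + m₂ * L * A) * μ := by linarith
  have hb' := mul_le_mul_of_nonneg_left (mul_le_mul_of_nonneg_left hb hm₂.le) hQ0.le
  linarith

end LegendreFlow

end Variance

end PMA

namespace PMA

/-! ### The heat kernel -/

section Heat

variable {E : Type*} [NormedAddCommGroup E] [InnerProductSpace ℝ E]

/-- The heat kernel at time `s`. -/
def heat (s : ℝ) (z : E) : ℝ :=
  Real.exp (-(Module.finrank ℝ E / 2 * Real.log (4 * Real.pi * s)) - ‖z‖ ^ 2 / (4 * s))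

/-- The gradient of the heat kernel. -/
def heatGrad (s : ℝ) (z : E) : E := -(heat s z / (2 * s)) • z

/-- The Laplacian (and time derivative) of the heat kernel. -/
def heatLap (s : ℝ) (z : E) : ℝ :=
  heat s z * (‖z‖ ^ 2 / (4 * s ^ 2) - Module.finrank ℝ E / (2 * s))

lemma heat_pos (s : ℝ) (z : E) : 0 < heat s z := Real.exp_pos _

lemma hasFDerivAt_heat (s : ℝ) (z : E) : HasFDerivAt (heat s) (innerSL ℝ (heatGrad s z)) z := by
  have h1 : HasFDerivAt (fun z : E => ‖z‖ ^ 2) (2 • innerSL ℝ z) z :=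
    (hasStrictFDerivAt_norm_sq z).hasFDerivAt
  have h2 := ((h1.mul_const (4 * s)⁻¹).const_sub
    (-(Module.finrank ℝ E / 2 * Real.log (4 * Real.pi * s)))).exp
  refine (h2.congr_fderiv ?_)
  ext y
  simp [heatGrad, heat, div_eq_mul_inv]
  ring

lemma hasFDerivAt_heatGrad (s : ℝ) (z : E) : HasFDerivAt (heatGrad s)
    (-(heat s z / (2 * s)) • ContinuousLinearMap.id ℝ E
      + (-(2 * s)⁻¹ • innerSL ℝ (heatGrad s z)).smulRight z) z := by
  have h := (((hasFDerivAt_heat s z).mul_const (2 * s)⁻¹).neg).smul (hasFDerivAt_id z)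
  refine (h.congr_fderiv ?_).congr_of_eventuallyEq (Filter.Eventually.of_forall fun q => ?_)
  · ext y
    simp [div_eq_mul_inv]
  · simp [heatGrad, div_eq_mul_inv]

lemma hasFDerivAt_heatLap (s : ℝ) (z : E) : HasFDerivAt (heatLap s)
    (heat s z • (2 / (4 * s ^ 2)) • innerSL ℝ z
      + (‖z‖ ^ 2 / (4 * s ^ 2) - Module.finrank ℝ E / (2 * s)) • innerSL ℝ (heatGrad s z)) z := by
  have h1 : HasFDerivAt (fun z : E => ‖z‖ ^ 2) (2 • innerSL ℝ z) z :=
    (hasStrictFDerivAt_norm_sq z).hasFDerivAt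
  have h := (hasFDerivAt_heat s z).mul
    ((h1.mul_const (4 * s ^ 2)⁻¹).sub_const (Module.finrank ℝ E / (2 * s)))
  refine (h.congr_fderiv ?_).congr_of_eventuallyEq (Filter.Eventually.of_forall fun q => ?_)
  · ext y
    simp [div_eq_mul_inv]
    left
    ring
  · simp [heatLap, div_eq_mul_inv]

lemma hasDerivAt_heat {s : ℝ} (hs : 0 < s) (z : E) :
    HasDerivAt (fun s => heat s z) (heatLap s z) s := by
  have hpi := Real.pi_pos
  have h1 : HasDerivAt (fun s : ℝ => 4 * Real.pi * s) (4 * Real.pi) s := by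
    simpa using (hasDerivAt_id s).const_mul (4 * Real.pi)
  have h2 := ((h1.log (by positivity)).const_mul (Module.finrank ℝ E / 2 : ℝ)).neg
  have h3 : HasDerivAt (fun s : ℝ => 4 * s) 4 s := by simpa using (hasDerivAt_id s).const_mul 4
  have h4 := (hasDerivAt_const s (‖z‖ ^ 2)).div h3 (by positivity)
  refine (h2.sub h4).exp.congr_deriv ?_
  simp only [heatLap, heat, Pi.neg_apply, Pi.sub_apply, Pi.div_apply]
  congr 1
  field_simp
  ring

lemma continuousOn_heat : ContinuousOn (fun y : ℝ × E => heat y.1 y.2) {y | 0 < y.1} := by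
  have hpi := Real.pi_pos
  unfold heat
  refine Real.continuous_exp.comp_continuousOn (ContinuousOn.sub (ContinuousOn.neg
    (ContinuousOn.mul continuousOn_const (ContinuousOn.log (by fun_prop) ?_)))
    (ContinuousOn.div (by fun_prop) (by fun_prop) ?_)) <;> intro y hy <;>
  · have hy : 0 < y.1 := hy
    positivity

lemma continuousOn_heatGrad : ContinuousOn (fun y : ℝ × E => heatGrad y.1 y.2) {y | 0 < y.1} := by
  unfold heatGrad
  refine ContinuousOn.smul (ContinuousOn.neg (continuousOn_heat.div (by fun_prop) ?_)) (by fun_prop)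
  intro y hy
  have hy : 0 < y.1 := hy
  positivity

lemma continuousOn_heatLap : ContinuousOn (fun y : ℝ × E => heatLap y.1 y.2) {y | 0 < y.1} := by
  unfold heatLap
  refine continuousOn_heat.mul (ContinuousOn.sub (ContinuousOn.div (by fun_prop) (by fun_prop) ?_)
    (ContinuousOn.div (by fun_prop) (by fun_prop) ?_)) <;> intro y hy <;>
  · have hy : 0 < y.1 := hy
    positivity

/-- Rapid decay of the heat kernel, uniformly for bounded times. -/
lemma exists_heat_le_wt {σ : ℝ} (hσ : 0 < σ) (S : ℝ) (N : ℕ) : ∃ C, 0 ≤ C ∧ ∀ s ∈ Icc σ S,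
    ∀ z : E, japSq z ^ N * heat s z ≤ C * wt z := by
  set m := wtExp E + N with hm
  set M := max 1 (4 * S) with hM
  have hM1 : 1 ≤ M := le_max_left _ _
  have hpi := Real.pi_pos
  refine ⟨Real.exp (-(Module.finrank ℝ E / 2 * Real.log (4 * Real.pi * σ))) * (M ^ m * m.factorial
    * Real.exp 1), by positivity, fun s hs z => ?_⟩
  have hs0 : 0 < s := hσ.trans_le hs.1
  have hJ := japSq_pos z
  have hpre : heat s z ≤ Real.exp (-(Module.finrank ℝ E / 2 * Real.log (4 * Real.pi * σ))) *
      Real.exp (-(‖z‖ ^ 2 / M)) := by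
    rw [heat, sub_eq_add_neg, Real.exp_add]
    have : 4 * s ≤ M := (by linarith [hs.2] : 4 * s ≤ 4 * S).trans (le_max_right _ _)
    have h2 := hs.1
    gcongr
  have hpow : (japSq z / M) ^ m / m.factorial ≤ Real.exp (japSq z / M) :=
    Real.pow_div_factorial_le_exp _ (by positivity) _
  have hexp : Real.exp (japSq z / M) ≤ Real.exp 1 * Real.exp (‖z‖ ^ 2 / M) := by
    rw [← Real.exp_add]
    apply Real.exp_le_exp.2
    have : 1 / M ≤ 1 := by rw [div_le_one (by positivity)]; exact hM1
    rw [japSq, add_div]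
    linarith
  have h3 : japSq z ^ m ≤ M ^ m * m.factorial * Real.exp 1 * Real.exp (‖z‖ ^ 2 / M) := by
    have := hpow.trans hexp
    rw [div_pow, div_div, div_le_iff₀ (by positivity)] at this
    linarith
  have h4 : japSq z ^ m * Real.exp (-(‖z‖ ^ 2 / M)) ≤ M ^ m * m.factorial * Real.exp 1 := by
    rw [Real.exp_neg, ← div_eq_mul_inv, div_le_iff₀ (Real.exp_pos _)]
    exact h3
  rw [wt, ← div_eq_mul_inv, le_div_iff₀ (by positivity)]
  calc japSq z ^ N * heat s z * japSq z ^ wtExp E = japSq z ^ m * heat s z := by rw [hm]; ring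
    _ ≤ japSq z ^ m * (Real.exp (-(Module.finrank ℝ E / 2 * Real.log (4 * Real.pi * σ))) *
      Real.exp (-(‖z‖ ^ 2 / M))) := by gcongr
    _ = Real.exp (-(Module.finrank ℝ E / 2 * Real.log (4 * Real.pi * σ))) *
      (japSq z ^ m * Real.exp (-(‖z‖ ^ 2 / M))) := by ring
    _ ≤ _ := by gcongr

/-- Weighted bounds for the heat kernel and its derivatives, uniformly for times in `[σ, S]`. -/
lemma exists_heat_bounds {σ : ℝ} (hσ : 0 < σ) (S : ℝ) : ∃ C, 0 ≤ C ∧ ∀ s ∈ Icc σ S, ∀ z : E,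
    heat s z ≤ C * wt z ∧ ‖heatGrad s z‖ ≤ C * wt z ∧ |heatLap s z| ≤ C * wt z ∧
    ‖fderiv ℝ (heatGrad s) z‖ ≤ C * wt z ∧ ‖fderiv ℝ (heatLap s) z‖ ≤ C * wt z := by
  obtain ⟨C, hC, hb⟩ := exists_heat_le_wt (E := E) hσ S 2
  set d : ℝ := (Module.finrank ℝ E : ℝ) with hd
  have hd0 : 0 ≤ d := by positivity
  set k := (2 * σ)⁻¹ with hk
  have hk0 : 0 < k := by positivity
  set L := 1 + k + k ^ 2 + d * k + 2 * k ^ 2 + (k ^ 2 + d * k) * k with hL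
  refine ⟨L * C, by positivity, fun s hs z => ?_⟩
  have hs0 : 0 < s := hσ.trans_le hs.1
  set l := (2 * s)⁻¹ with hl
  have hl0 : 0 < l := by positivity
  have hlk : l ≤ k := by rw [hl, hk]; have := hs.1; gcongr
  have hJ1 := one_le_japSq z
  have hJ := japSq_pos z
  have hΓ := heat_pos s z
  have hzJ := norm_le_japSq z
  have hz2 : ‖z‖ ^ 2 ≤ japSq z := by unfold japSq; linarith
  have hz0 := norm_nonneg z
  have key : ∀ a, a ≤ L * (japSq z ^ 2 * heat s z) → a ≤ L * C * wt z := fun a ha => by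
    calc a ≤ L * (japSq z ^ 2 * heat s z) := ha
      _ ≤ L * (C * wt z) := by have := hb s hs z; gcongr
      _ = _ := by ring
  have hG : ‖heatGrad s z‖ ≤ k * (japSq z * heat s z) := by
    rw [heatGrad, norm_smul, norm_neg, Real.norm_of_nonneg (by positivity), div_eq_mul_inv]
    calc heat s z * l * ‖z‖ ≤ heat s z * k * japSq z := by gcongr
      _ = _ := by ring
  have hc : |‖z‖ ^ 2 / (4 * s ^ 2) - d / (2 * s)| ≤ (k ^ 2 + d * k) * japSq z := by
    have e1 : ‖z‖ ^ 2 / (4 * s ^ 2) = ‖z‖ ^ 2 * l ^ 2 := by rw [hl]; field_simp; norm_num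
    rw [e1, div_eq_mul_inv, ← hl]
    calc |‖z‖ ^ 2 * l ^ 2 - d * l| ≤ |‖z‖ ^ 2 * l ^ 2| + |d * l| := abs_sub _ _
      _ = ‖z‖ ^ 2 * l ^ 2 + d * l * 1 := by
          rw [abs_of_nonneg (by positivity), abs_of_nonneg (by positivity), mul_one]
      _ ≤ japSq z * k ^ 2 + d * k * japSq z := by gcongr
      _ = _ := by ring
  have hJ2 : japSq z ≤ japSq z ^ 2 := by nlinarith
  have hJ3 : 1 ≤ japSq z ^ 2 := by nlinarith
  have hpos : 0 < japSq z ^ 2 * heat s z := by positivity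
  have hΓJ : heat s z ≤ japSq z ^ 2 * heat s z := le_mul_of_one_le_left hΓ.le hJ3
  have hΓJ' : japSq z * heat s z ≤ japSq z ^ 2 * heat s z := by gcongr
  have hLk : k ≤ L ∧ 1 ≤ L ∧ k ^ 2 + d * k ≤ L ∧ k + k ^ 2 ≤ L ∧
      2 * k ^ 2 + (k ^ 2 + d * k) * k ≤ L := by
    have h1 : 0 ≤ k ^ 2 := by positivity
    have h2 : 0 ≤ d * k := by positivity
    have h3 : 0 ≤ (k ^ 2 + d * k) * k := by positivity
    refine ⟨?_, ?_, ?_, ?_, ?_⟩ <;> rw [hL] <;> linarith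
  refine ⟨key _ ?_, key _ ?_, key _ ?_, key _ ?_, key _ ?_⟩
  · exact hΓJ.trans (le_mul_of_one_le_left hpos.le hLk.2.1)
  · exact hG.trans (mul_le_mul hLk.1 hΓJ' (by positivity) (by positivity))
  · rw [heatLap, abs_mul, abs_of_pos hΓ]
    calc heat s z * |‖z‖ ^ 2 / (4 * s ^ 2) - d / (2 * s)|
        ≤ heat s z * ((k ^ 2 + d * k) * japSq z) := by gcongr
      _ = (k ^ 2 + d * k) * (japSq z * heat s z) := by ring
      _ ≤ _ := mul_le_mul hLk.2.2.1 hΓJ' (by positivity) (by positivity)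
  · rw [(hasFDerivAt_heatGrad s z).fderiv]
    refine (norm_add_le _ _).trans ?_
    have h1 : ‖-(heat s z / (2 * s)) • ContinuousLinearMap.id ℝ E‖ ≤ k * heat s z := by
      rw [norm_smul, norm_neg, Real.norm_of_nonneg (by positivity), div_eq_mul_inv, ← hl]
      calc heat s z * l * ‖ContinuousLinearMap.id ℝ E‖ ≤ heat s z * k * 1 := by
            gcongr; exact ContinuousLinearMap.norm_id_le
        _ = _ := by ring
    have h2 : ‖(-(2 * s)⁻¹ • innerSL ℝ (heatGrad s z)).smulRight z‖
        ≤ k ^ 2 * (japSq z ^ 2 * heat s z) := by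
      rw [ContinuousLinearMap.norm_smulRight_apply, norm_smul, norm_neg, ← hl,
        Real.norm_of_nonneg hl0.le, innerSL_apply_norm]
      calc l * ‖heatGrad s z‖ * ‖z‖ ≤ k * (k * (japSq z * heat s z)) * japSq z := by gcongr
        _ = _ := by ring
    calc _ ≤ k * (japSq z ^ 2 * heat s z) + k ^ 2 * (japSq z ^ 2 * heat s z) :=
          add_le_add (h1.trans (by gcongr)) h2
      _ = (k + k ^ 2) * (japSq z ^ 2 * heat s z) := by ring
      _ ≤ _ := by gcongr; exact hLk.2.2.2.1
  · rw [(hasFDerivAt_heatLap s z).fderiv]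
    refine (norm_add_le _ _).trans ?_
    have h1 : ‖heat s z • (2 / (4 * s ^ 2)) • innerSL ℝ z‖
        ≤ 2 * k ^ 2 * (japSq z ^ 2 * heat s z) := by
      rw [norm_smul, norm_smul, Real.norm_of_nonneg hΓ.le, Real.norm_of_nonneg (by positivity),
        innerSL_apply_norm]
      have e1 : 2 / (4 * s ^ 2) = 2 * l ^ 2 := by rw [hl]; field_simp; norm_num
      rw [e1]
      calc heat s z * (2 * l ^ 2 * ‖z‖) ≤ heat s z * (2 * k ^ 2 * japSq z ^ 2) := by
            gcongr; exact hzJ.trans hJ2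
        _ = _ := by ring
    have h2 : ‖(‖z‖ ^ 2 / (4 * s ^ 2) - d / (2 * s)) • innerSL ℝ (heatGrad s z)‖
        ≤ (k ^ 2 + d * k) * k * (japSq z ^ 2 * heat s z) := by
      rw [norm_smul, innerSL_apply_norm, Real.norm_eq_abs]
      calc _ ≤ (k ^ 2 + d * k) * japSq z * (k * (japSq z * heat s z)) := by gcongr
        _ = _ := by ring
    calc _ ≤ 2 * k ^ 2 * (japSq z ^ 2 * heat s z) + (k ^ 2 + d * k) * k * (japSq z ^ 2 * heat s z) :=
          add_le_add h1 h2
      _ = (2 * k ^ 2 + (k ^ 2 + d * k) * k) * (japSq z ^ 2 * heat s z) := by ring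
      _ ≤ _ := by gcongr; exact hLk.2.2.2.2

/-- Increments of the heat kernel and its derivatives on a convex set, uniformly for times in
`[σ, S]`, in terms of an upper bound `M` for the weight. -/
lemma exists_heat_increments {σ : ℝ} (hσ : 0 < σ) (S : ℝ) : ∃ C, 0 ≤ C ∧
    ∀ s ∈ Icc σ S, ∀ (K : Set E) (M : ℝ), Convex ℝ K → (∀ z ∈ K, wt z ≤ M) → ∀ z ∈ K, ∀ z' ∈ K,
    heat s z ≤ C * M ∧ ‖heatGrad s z‖ ≤ C * M ∧ |heatLap s z| ≤ C * M ∧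
    |heat s z - heat s z'| ≤ C * M * ‖z - z'‖ ∧
    ‖heatGrad s z - heatGrad s z'‖ ≤ C * M * ‖z - z'‖ ∧
    |heatLap s z - heatLap s z'| ≤ C * M * ‖z - z'‖ ∧
    (∀ z₀ ∈ K, |heat s z - heat s z' - inner ℝ (heatGrad s z₀) (z - z')|
      ≤ C * M * (‖z - z₀‖ + ‖z' - z₀‖) * ‖z - z'‖) ∧
    (∀ s' ∈ Icc σ S, |heat s z - heat s' z| ≤ C * M * |s - s'|) := by
  obtain ⟨C, hC, hb⟩ := exists_heat_bounds (E := E) hσ S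
  refine ⟨C, hC, fun s hs K M hK hM z hz z' hz' => ?_⟩
  have hb' : ∀ y ∈ K, C * wt y ≤ C * M := fun y hy => by have := hM y hy; gcongr
  have hN : ∀ y ∈ K, ∀ y' ∈ K, ‖heatGrad s y - heatGrad s y'‖ ≤ C * M * ‖y - y'‖ :=
    fun y hy y' hy' => hK.norm_image_sub_le_of_norm_hasFDerivWithin_le
      (fun x _ => (hasFDerivAt_heatGrad s x).differentiableAt.hasFDerivAt.hasFDerivWithinAt)
      (fun x hx => ((hb s hs x).2.2.2.1).trans (hb' x hx)) hy' hy
  refine ⟨(hb s hs z).1.trans (hb' z hz), (hb s hs z).2.1.trans (hb' z hz),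
    (hb s hs z).2.2.1.trans (hb' z hz), ?_, hN z hz z' hz', ?_, fun z₀ hz₀ => ?_,
    fun s' hs' => ?_⟩
  · exact hK.norm_image_sub_le_of_norm_hasFDerivWithin_le
      (fun x _ => (hasFDerivAt_heat s x).hasFDerivWithinAt)
      (fun x hx => by rw [innerSL_apply_norm]; exact ((hb s hs x).2.1).trans (hb' x hx)) hz' hz
  · exact hK.norm_image_sub_le_of_norm_hasFDerivWithin_le
      (fun x _ => (hasFDerivAt_heatLap s x).differentiableAt.hasFDerivAt.hasFDerivWithinAt)
      (fun x hx => ((hb s hs x).2.2.2.2).trans (hb' x hx)) hz' hz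
  · have hM0 : 0 ≤ C * M := (norm_nonneg _).trans ((hb s hs z).2.1.trans (hb' z hz))
    have hseg : segment ℝ z z' ⊆ K := hK.segment_subset hz hz'
    have h := (convex_segment z z').norm_image_sub_le_of_norm_hasFDerivWithin_le
      (f := fun y => heat s y - innerSL ℝ (heatGrad s z₀) y)
      (f' := fun y => innerSL ℝ (heatGrad s y) - innerSL ℝ (heatGrad s z₀))
      (C := C * M * (‖z - z₀‖ + ‖z' - z₀‖))
      (fun x _ => ((hasFDerivAt_heat s x).sub
        (innerSL ℝ (heatGrad s z₀)).hasFDerivAt).hasFDerivWithinAt)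
      (fun x hx => by
        rw [← map_sub, innerSL_apply_norm]
        refine (hN x (hseg hx) z₀ hz₀).trans ?_
        gcongr
        have hc : ConvexOn ℝ univ (fun y : E => ‖y - z₀‖) := by
          have := (convexOn_univ_norm (E := E)).translate_left (-z₀)
          simpa [sub_eq_add_neg, add_comm, Function.comp_def] using this
        have := hc.le_on_segment (mem_univ z) (mem_univ z') hx
        exact this.trans (max_le_add_of_nonneg (norm_nonneg _) (norm_nonneg _)))
      (right_mem_segment ℝ z z') (left_mem_segment ℝ z z')
    convert h using 1
    rw [Real.norm_eq_abs]
    simp only [inner_sub_right, innerSL_apply_apply]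
    congr 1
    ring
  · exact (convex_Icc σ S).norm_image_sub_le_of_norm_hasDerivWithin_le
      (f := fun s => heat s z)
      (fun x hx => (hasDerivAt_heat (hσ.trans_le hx.1) z).hasDerivWithinAt)
      (fun x hx => ((hb x hx z).2.2.1).trans (hb' z hz)) hs' hs

variable [FiniteDimensional ℝ E] [MeasurableSpace E] [BorelSpace E]

lemma integral_heat {s : ℝ} (hs : 0 < s) : ∫ z : E, heat s z = 1 := by
  have hpi := Real.pi_pos
  have h := GaussianFourier.integral_rexp_neg_mul_sq_norm (V := E) (b := 1 / (4 * s)) (by positivity)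
  have e : ∀ z : E, heat s z = Real.exp (-(Module.finrank ℝ E / 2 * Real.log (4 * Real.pi * s))) *
      Real.exp (-(1 / (4 * s)) * ‖z‖ ^ 2) := fun z => by
    rw [heat, ← Real.exp_add]; congr 1; ring
  simp_rw [e]
  rw [integral_const_mul, h, Real.rpow_def_of_pos (by positivity), ← Real.exp_add, Real.exp_eq_one_iff]
  rw [div_div_eq_mul_div, div_one, ← mul_assoc, mul_comm Real.pi 4]
  ring

end Heat

end PMA

namespace PMA

/-! ### Duality with the heat kernel -/

section Duality

variable {E : Type*} [NormedAddCommGroup E] [InnerProductSpace ℝ E]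

lemma wt_sub_le (x p : E) : wt (x - p) ≤ (2 * japSq x) ^ wtExp E * wt p := by
  refine wt_le_mul_of_japSq_le ?_
  have := japSq_sub_le x (x - p)
  simpa using this

lemma wt_le_of_mem_closedBall {x p z : E} (hx : ‖x‖ ≤ 1)
    (hz : z ∈ Metric.closedBall (x - p) (1 / 4 * (1 + ‖p‖))) : wt z ≤ 16 ^ wtExp E * wt p := by
  refine wt_le_mul_of_japSq_le ?_
  rw [mem_closedBall_iff_norm] at hz
  have h1 : japSq p ≤ 4 * japSq (x - z) := by
    refine japSq_le_four_mul' ?_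
    rw [← norm_neg]
    have : -(x - z - p) = z - (x - p) := by abel
    rwa [this]
  have h2 := japSq_sub_le x z
  have h3 : japSq x ≤ 2 := by unfold japSq; nlinarith [norm_nonneg x]
  have := japSq_pos z
  nlinarith

variable [FiniteDimensional ℝ E] [MeasurableSpace E] [BorelSpace E]

lemma Growth.integrable_of_abs_le {h : E → ℝ → ℝ} {j : ℤ} (hh : Growth j h) (hj : j ≤ 6) {t : ℝ}
    (ht : t ∈ Icc (-1 : ℝ) 0) {f : E → ℝ} (hf : Continuous f) (C : ℝ)
    (hb : ∀ p, |f p| ≤ C * (wt p * |h p t|)) : Integrable f :=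
  (((growth_wt_mul hh.abs hj).integrable le_rfl ht).const_mul C).mono' hf.aestronglyMeasurable
    (Filter.Eventually.of_forall hb)

omit [MeasurableSpace E] [BorelSpace E] [FiniteDimensional ℝ E] in
lemma continuous_heat {s : ℝ} : Continuous (heat s : E → ℝ) :=
  continuous_iff_continuousAt.2 fun z => (hasFDerivAt_heat s z).continuousAt

omit [MeasurableSpace E] [BorelSpace E] [FiniteDimensional ℝ E] in
lemma continuous_heatGrad {s : ℝ} : Continuous (heatGrad s : E → E) :=
  continuous_iff_continuousAt.2 fun z => (hasFDerivAt_heatGrad s z).continuousAt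

omit [MeasurableSpace E] [BorelSpace E] [FiniteDimensional ℝ E] in
lemma sum_inner_fderiv_heatGrad {ι : Type*} [Fintype ι] (b : OrthonormalBasis ι ℝ E) {s : ℝ}
    (hs : 0 < s) (z : E) :
    ∑ i, inner ℝ (fderiv ℝ (heatGrad s) z (b i)) (b i) = heatLap s z := by
  have h1 : ∀ i, inner ℝ (fderiv ℝ (heatGrad s) z (b i)) (b i) =
      -(heat s z / (2 * s)) - (2 * s)⁻¹ * (inner ℝ (heatGrad s z) (b i) * inner ℝ (b i) z) := by
    intro i
    rw [(hasFDerivAt_heatGrad s z).fderiv]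
    have hbi : inner ℝ (b i) (b i) = (1 : ℝ) := by
      rw [real_inner_self_eq_norm_sq, b.norm_eq_one]; norm_num
    simp only [add_apply, smul_apply,
      ContinuousLinearMap.id_apply, ContinuousLinearMap.smulRight_apply, innerSL_apply_apply,
      inner_add_left, inner_smul_left, RCLike.conj_to_real, hbi, smul_eq_mul,
      real_inner_comm z (b i)]
    ring
  simp_rw [h1]
  rw [Finset.sum_sub_distrib, ← Finset.mul_sum, b.sum_inner_mul_inner]
  simp only [Finset.sum_const, Finset.card_univ, nsmul_eq_mul]
  rw [← Module.finrank_eq_card_basis b.toBasis, heatGrad, heatLap, inner_smul_left,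
    real_inner_self_eq_norm_sq]
  simp only [RCLike.conj_to_real]
  field_simp
  ring

namespace LegendreFlow

variable {c₀ m₁ m₂ : ℝ}

lemma Near.integral_inner_heatGrad {D : LegendreFlow E c₀ m₁ m₂} {δ : ℝ} (hD : D.Near δ)
    {t : ℝ} (ht : t ∈ Icc (-1 : ℝ) 0) {s : ℝ} (hs : 0 < s) (x : E) :
    ∫ p, inner ℝ (heatGrad s (x - p)) (D.r p t) = ∫ p, heatLap s (x - p) * D.k p t := by
  obtain ⟨C, hC, hb⟩ := exists_heat_bounds (E := E) hs s
  have hb := hb s ⟨le_rfl, le_rfl⟩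
  set L := (2 * japSq x) ^ wtExp E with hL
  have hwt : ∀ p, C * wt (x - p) ≤ C * L * wt p := fun p => by
    rw [mul_assoc]; have := wt_sub_le x p; gcongr
  let b := stdOrthonormalBasis ℝ E
  have hcr : Continuous fun p => D.r p t := D.cont_r.comp (by fun_prop : Continuous fun p => (p, t))
  have hck : Continuous fun p => D.k p t := D.cont_k.comp (by fun_prop : Continuous fun p => (p, t))
  have hsub : ∀ p : E, HasFDerivAt (fun p => x - p) (-ContinuousLinearMap.id ℝ E) p := fun p =>
    (hasFDerivAt_id p).const_sub x
  have hfd : ∀ i p, HasFDerivAt (fun p => inner ℝ (heatGrad s (x - p)) (b i))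
      (-((innerSL ℝ (b i)).comp (fderiv ℝ (heatGrad s) (x - p)))) p := fun i p => by
    have h1 := (innerSL ℝ (b i)).hasFDerivAt.comp p
      (((hasFDerivAt_heatGrad s (x - p)).differentiableAt.hasFDerivAt).comp p (hsub p))
    refine (h1.congr_fderiv ?_).congr_of_eventuallyEq (Filter.Eventually.of_forall fun q => ?_)
    · ext y; simp
    · simp [real_inner_comm]
  have hkd : ∀ p, HasFDerivAt (fun q => D.k q t) (innerSL ℝ (D.r p t)) p := fun p =>
    (D.gradk p t).hasFDerivAt
  have hN : ∀ i p, |inner ℝ (heatGrad s (x - p)) (b i)| ≤ C * L * wt p := fun i p => by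
    refine (abs_real_inner_le_norm _ _).trans ?_
    rw [b.norm_eq_one, mul_one]
    exact (hb _).2.1.trans (hwt p)
  have hDN : ∀ i p, |inner ℝ (fderiv ℝ (heatGrad s) (x - p) (b i)) (b i)| ≤ C * L * wt p :=
    fun i p => by
    refine (abs_real_inner_le_norm _ _).trans ?_
    rw [b.norm_eq_one, mul_one]
    refine (ContinuousLinearMap.le_opNorm _ _).trans ?_
    rw [b.norm_eq_one, mul_one]
    exact (hb _).2.2.2.1.trans (hwt p)
  have hcN : Continuous fun p => heatGrad s (x - p) := continuous_heatGrad.comp (by fun_prop)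
  have hcDN : ∀ i, Continuous fun p => inner ℝ (fderiv ℝ (heatGrad s) (x - p) (b i)) (b i) := by
    intro i
    have h0 : Continuous fun p : E => heat s (x - p) := continuous_heat.comp (by fun_prop)
    have : (fun p => inner ℝ (fderiv ℝ (heatGrad s) (x - p) (b i)) (b i)) = fun p =>
        inner ℝ (-(heat s (x - p) / (2 * s)) • b i +
          (-(2 * s)⁻¹ * inner ℝ (heatGrad s (x - p)) (b i)) • (x - p)) (b i) := by
      funext p
      rw [(hasFDerivAt_heatGrad s (x - p)).fderiv]
      simp
    rw [this]
    fun_prop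
  have i1 : ∀ i, Integrable fun p => inner ℝ (heatGrad s (x - p)) (b i) * inner ℝ (D.r p t) (b i) :=
    fun i => hD.growth_r.integrable_of_abs_le (by norm_num) ht (by fun_prop) (C * L) fun p => by
      rw [abs_mul, ← mul_assoc, abs_norm]
      refine mul_le_mul (hN i p) ?_ (abs_nonneg _) ((abs_nonneg _).trans (hN i p))
      simpa [b.norm_eq_one] using abs_real_inner_le_norm (D.r p t) (b i)
  have i2 : ∀ i, Integrable fun p =>
      inner ℝ (fderiv ℝ (heatGrad s) (x - p) (b i)) (b i) * D.k p t :=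
    fun i => hD.growth_k.integrable_of_abs_le (by norm_num) ht ((hcDN i).mul hck) (C * L)
      fun p => by
      rw [abs_mul, ← mul_assoc]
      exact mul_le_mul_of_nonneg_right (hDN i p) (abs_nonneg _)
  have i3 : ∀ i, Integrable fun p => inner ℝ (heatGrad s (x - p)) (b i) * D.k p t :=
    fun i => hD.growth_k.integrable_of_abs_le (by norm_num) ht (by fun_prop) (C * L) fun p => by
      rw [abs_mul, ← mul_assoc]
      exact mul_le_mul_of_nonneg_right (hN i p) (abs_nonneg _)
  have key : ∀ i, ∫ p, inner ℝ (heatGrad s (x - p)) (b i) * inner ℝ (D.r p t) (b i) =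
      ∫ p, inner ℝ (fderiv ℝ (heatGrad s) (x - p) (b i)) (b i) * D.k p t := fun i => by
    have e1 : ∀ p, fderiv ℝ (fun p => inner ℝ (heatGrad s (x - p)) (b i)) p (b i) =
        -inner ℝ (fderiv ℝ (heatGrad s) (x - p) (b i)) (b i) := fun p => by
      rw [(hfd i p).fderiv]; simp [real_inner_comm]
    have e2 : ∀ p, fderiv ℝ (fun q => D.k q t) p (b i) = inner ℝ (D.r p t) (b i) := fun p => by
      rw [(hkd p).fderiv]; simp
    have h := integral_mul_fderiv_eq_neg_fderiv_mul_of_integrable (μ := volume)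
      (f := fun p => inner ℝ (heatGrad s (x - p)) (b i)) (g := fun q => D.k q t) (v := b i)
      (by simp_rw [e1, neg_mul]; exact (i2 i).neg) (by simp_rw [e2]; exact i1 i) (i3 i)
      (fun p _ => (hfd i p).differentiableAt) (fun p _ => (hkd p).differentiableAt)
    simp_rw [e1, e2, neg_mul, integral_neg, neg_neg] at h
    exact h
  calc ∫ p, inner ℝ (heatGrad s (x - p)) (D.r p t)
      = ∫ p, ∑ i, inner ℝ (heatGrad s (x - p)) (b i) * inner ℝ (D.r p t) (b i) := by
        congr 1; funext p
        rw [← b.sum_inner_mul_inner]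
        simp_rw [real_inner_comm (D.r p t)]
    _ = ∑ i, ∫ p, inner ℝ (fderiv ℝ (heatGrad s) (x - p) (b i)) (b i) * D.k p t := by
        rw [integral_finsetSum _ fun i _ => i1 i]
        exact Finset.sum_congr rfl fun i _ => key i
    _ = ∫ p, heatLap s (x - p) * D.k p t := by
        rw [← integral_finsetSum _ fun i _ => i2 i]
        congr 1; funext p
        rw [← Finset.sum_mul, sum_inner_fderiv_heatGrad b hs]

variable (D : LegendreFlow E c₀ m₁ m₂)

lemma G_sub_mem {t t' : ℝ} (h : t ≤ t') (h' : t' ≤ 0) :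
    D.G t' - D.G t ∈ Icc (m₁ * (t' - t)) (m₂ * (t' - t)) := by
  have hd : ∀ x ∈ interior (Icc t t'), HasDerivAt D.G (D.g x) x := fun x hx => by
    rw [interior_Icc] at hx
    exact D.deriv_G x (hx.2.trans_le h')
  have h1 : DifferentiableOn ℝ D.G (interior (Icc t t')) := fun x hx =>
    (hd x hx).differentiableAt.differentiableWithinAt
  constructor
  · exact (convex_Icc t t').mul_sub_le_image_sub_of_le_deriv D.cont_G.continuousOn h1
      (fun x hx => by rw [(hd x hx).deriv]; exact (D.g_mem x).1) t (left_mem_Icc.2 h) t'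
      (right_mem_Icc.2 h) h
  · exact (convex_Icc t t').image_sub_le_mul_sub_of_deriv_le D.cont_G.continuousOn h1
      (fun x hx => by rw [(hd x hx).deriv]; exact (D.g_mem x).2) t (left_mem_Icc.2 h) t'
      (right_mem_Icc.2 h) h

end LegendreFlow

end Duality

end PMA

namespace PMA

section Duality

variable {E : Type*} [NormedAddCommGroup E] [InnerProductSpace ℝ E] [FiniteDimensional ℝ E]
  [MeasurableSpace E] [BorelSpace E]

namespace LegendreFlow

variable {c₀ m₁ m₂ : ℝ}

set_option maxHeartbeats 1000000 in
/-- Testing the evolution of `k` against a backward heat kernel in the clock `G`. -/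
lemma exists_duality (hc₀ : 0 < c₀) (hm₁ : 0 < m₁) {a : ℝ} (ha : 0 < a) : ∃ C, 0 ≤ C ∧
    ∀ (D : LegendreFlow E c₀ m₁ m₂) (δ : ℝ), D.Near δ → ∀ μ, 0 < μ → D.energy ≤ μ ^ 2 →
    ∀ x : E, ‖x‖ ≤ 1 → ∀ t₂ ∈ Icc (-(1 / 4) : ℝ) 0,
      |(∫ p, heat (a ^ 2) (x - D.Y p) * D.k p t₂)
        - ∫ p, heat (a ^ 2 + (D.G t₂ - D.G (-(1 / 2)))) (x - D.Y p) * D.k p (-(1 / 2))|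
      ≤ C * ((δ + √μ + μ) * μ) := by
  obtain ⟨C₁, hC₁, hcac⟩ := exists_caccioppoli (E := E) (m₂ := m₂) hc₀ hm₁
  obtain ⟨C₂, hC₂, hvar⟩ := exists_variance (E := E) (m₂ := m₂) hc₀ hm₁
  have ha2 : 0 < a ^ 2 := by positivity
  obtain ⟨Ci, hCi, hinc⟩ := exists_heat_increments (E := E) ha2 (a ^ 2 + m₂)
  set B := Ci * 16 ^ wtExp E with hB
  have hB0 : 0 ≤ B := by positivity
  set W := wtMass E with hW
  have hW0 : 0 ≤ W := wtMass_nonneg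
  set m := 1 + |m₂| with hm
  have hm0 : 0 < m := by positivity
  refine ⟨2 * m * B * (W + 2 * C₁ + C₂), by positivity,
    fun D δ hD μ hμ hE x hx t₂ ht₂ => ?_⟩
  have hm₂ : 0 < m₂ := hm₁.trans_le D.m₁_le_m₂
  obtain ⟨hcac1, hcac2⟩ := hcac D δ hD
  have hvar := hvar D δ hD μ hμ hE
  have hδ0 := hD.δ_nonneg
  set s : ℝ → ℝ := fun t => a ^ 2 + max 0 (D.G t₂ - D.G t) with hs
  have hsc : Continuous s := by have := D.cont_G; fun_prop
  have hspos : ∀ t, 0 < s t := fun t => by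
    have : 0 ≤ max 0 (D.G t₂ - D.G t) := le_max_left _ _
    simp only [hs]; positivity
  have hsmem : ∀ t ∈ Icc (-1 : ℝ) 0, s t ∈ Icc (a ^ 2) (a ^ 2 + m₂) := fun t ht => by
    refine ⟨le_add_of_nonneg_right (le_max_left _ _), ?_⟩
    simp only [hs]
    gcongr
    refine max_le hm₂.le ?_
    rcases le_total t t₂ with h | h
    · refine (D.G_sub_mem h ht₂.2).2.trans ?_
      have : t₂ - t ≤ 1 := by linarith [ht.1, ht₂.2]
      nlinarith
    · have := (D.G_sub_mem h ht.2).1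
      have h2 : 0 ≤ m₁ * (t - t₂) := mul_nonneg hm₁.le (by linarith)
      linarith
  have hseq : ∀ t ≤ t₂, s t = a ^ 2 + (D.G t₂ - D.G t) := fun t ht => by
    have := (D.G_sub_mem ht ht₂.2).1
    have h2 : 0 ≤ m₁ * (t₂ - t) := mul_nonneg hm₁.le (by linarith)
    simp only [hs]
    rw [max_eq_right (by linarith)]
  -- kernel estimates at the three relevant points
  have hKp : ∀ p : E, x - p ∈ Metric.closedBall (x - p) (1 / 4 * (1 + ‖p‖)) := fun p =>
    Metric.mem_closedBall_self (by positivity)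
  have hKY : ∀ p : E, x - D.Y p ∈ Metric.closedBall (x - p) (1 / 4 * (1 + ‖p‖)) := fun p => by
    rw [mem_closedBall_iff_norm, ← norm_neg]
    have : -(x - D.Y p - (x - p)) = D.Y p - p := by abel
    rw [this]; exact hD.Y_near' p
  have hKX : ∀ p : E, ∀ t ∈ Icc (-1 : ℝ) 0,
      x - D.X p t ∈ Metric.closedBall (x - p) (1 / 4 * (1 + ‖p‖)) := fun p t ht => by
    rw [mem_closedBall_iff_norm, ← norm_neg]
    have : -(x - D.X p t - (x - p)) = D.X p t - p := by abel
    rw [this]; exact hD.X_near p t ht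
  have hker := fun (p : E) (t : ℝ) (ht : t ∈ Icc (-1 : ℝ) 0) => hinc (s t) (hsmem t ht)
    (Metric.closedBall (x - p) (1 / 4 * (1 + ‖p‖))) (16 ^ wtExp E * wt p)
    (convex_closedBall _ _) (fun z hz => wt_le_of_mem_closedBall hx hz)
  simp only [← mul_assoc, ← hB] at hker
  have hwt0 : ∀ p : E, 0 < wt p := wt_pos
  have gw : Growth (-(wtExp E : ℤ)) fun (p : E) (_ : ℝ) => wt p := growth_wt
  -- growth of the kernel functions
  have hcX := D.cont_X
  have hcY := D.cont_Y
  have gΓY : Growth (-(wtExp E : ℤ)) fun p t => heat (s t) (x - D.Y p) := by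
    refine Growth.of_le ?_ gw B fun p t ht => ?_
    · exact continuousOn_heat.comp_continuous (f := fun z : E × ℝ => (s z.2, x - D.Y z.1))
        (by fun_prop) fun z => hspos _
    · rw [abs_of_pos (heat_pos _ _), abs_of_pos (hwt0 p)]
      exact (hker p t ht _ (hKY p) _ (hKY p)).1
  have gΓX : Growth (-(wtExp E : ℤ)) fun p t => heat (s t) (x - D.X p t) := by
    refine Growth.of_le ?_ gw B fun p t ht => ?_
    · exact continuousOn_heat.comp_continuous (f := fun z : E × ℝ => (s z.2, x - D.X z.1 z.2))
        (by fun_prop) fun z => hspos _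
    · rw [abs_of_pos (heat_pos _ _), abs_of_pos (hwt0 p)]
      exact (hker p t ht _ (hKX p t ht) _ (hKY p)).1
  have gHY : Growth (-(wtExp E : ℤ)) fun p t => heatLap (s t) (x - D.Y p) := by
    refine Growth.of_le ?_ gw B fun p t ht => ?_
    · exact continuousOn_heatLap.comp_continuous (f := fun z : E × ℝ => (s z.2, x - D.Y z.1))
        (by fun_prop) fun z => hspos _
    · rw [abs_of_pos (hwt0 p)]
      exact (hker p t ht _ (hKY p) _ (hKY p)).2.2.1
  have gHp : Growth (-(wtExp E : ℤ)) fun p t => heatLap (s t) (x - p) := by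
    refine Growth.of_le ?_ gw B fun p t ht => ?_
    · exact continuousOn_heatLap.comp_continuous (f := fun z : E × ℝ => (s z.2, x - z.1))
        (by fun_prop) fun z => hspos _
    · rw [abs_of_pos (hwt0 p)]
      exact (hker p t ht _ (hKp p) _ (hKp p)).2.2.1
  have gNr : Growth (-(wtExp E : ℤ) + 1) fun p t => inner ℝ (heatGrad (s t) (x - p)) (D.r p t) := by
    refine Growth.of_le ?_ (gw.mul hD.growth_r) B fun p t ht => ?_
    · exact (continuousOn_heatGrad.comp_continuous (f := fun z : E × ℝ => (s z.2, x - z.1))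
        (by fun_prop) fun z => hspos _).inner D.cont_r
    · rw [abs_of_nonneg (mul_nonneg (hwt0 p).le (norm_nonneg _)), ← mul_assoc]
      refine (abs_real_inner_le_norm _ _).trans ?_
      gcongr
      exact (hker p t ht _ (hKp p) _ (hKp p)).2.1
  have gk := hD.growth_k
  have gν := hD.growth_ν
  have gg := D.growth_g
  have hexp : ∀ j : ℤ, j ≤ 6 → -(wtExp E : ℤ) + j ≤ -(Module.finrank ℝ E + 1 : ℤ) := fun j hj =>
    neg_wtExp_add_le hj
  have hexp0 : -(wtExp E : ℤ) ≤ -(Module.finrank ℝ E + 1 : ℤ) := by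
    simpa using hexp 0 (by norm_num)
  -- the derivative of the pairing
  set f' : E → ℝ → ℝ := fun p t =>
    -(D.g t * (heatLap (s t) (x - D.Y p) * D.k p t))
      + heat (s t) (x - D.Y p) * (D.ν p t - D.g t) with hf'
  have gF : Growth (-(Module.finrank ℝ E + 1 : ℤ)) fun p t => heat (s t) (x - D.Y p) * D.k p t :=
    (gΓY.mul gk).mono (hexp 1 (by norm_num))
  have gHk : Growth (-(Module.finrank ℝ E + 1 : ℤ)) fun p t =>
      D.g t * (heatLap (s t) (x - D.Y p) * D.k p t) :=
    (gg.mul (gHY.mul gk)).mono (by rw [zero_add]; exact hexp 1 (by norm_num))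
  have gHpk : Growth (-(Module.finrank ℝ E + 1 : ℤ)) fun p t =>
      heatLap (s t) (x - p) * D.k p t := (gHp.mul gk).mono (hexp 1 (by norm_num))
  have gNr' : Growth (-(Module.finrank ℝ E + 1 : ℤ)) fun p t =>
      inner ℝ (heatGrad (s t) (x - p)) (D.r p t) := gNr.mono (hexp 1 (by norm_num))
  have gΓXν : Growth (-(Module.finrank ℝ E + 1 : ℤ)) fun p t =>
      heat (s t) (x - D.X p t) * D.ν p t := (gΓX.mul gν).mono (hexp 0 (by norm_num))
  have gΓY' := gΓY.mono hexp0
  have gF' : Growth (-(Module.finrank ℝ E + 1 : ℤ)) f' :=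
    gHk.neg.add ((gΓY.mul (gν.sub gg)).mono (hexp 0 (by norm_num)))
  have hFTC := Growth.integral_sub_integral le_rfl gF gF' (a := -(1 / 2)) (b := t₂) (by norm_num)
    (by linarith [ht₂.1]) ht₂.2 (fun p t ht => by
      have ht0 : t < 0 := ht.2.trans_le ht₂.2
      have h1 : HasDerivAt s (-D.g t) t := by
        have h2 : HasDerivAt (fun t => a ^ 2 + (D.G t₂ - D.G t)) (-D.g t) t :=
          ((D.deriv_G t ht0).const_sub _).const_add _
        refine h2.congr_of_eventuallyEq ?_
        filter_upwards [Iio_mem_nhds ht.2] with y hy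
        exact hseq y (le_of_lt hy)
      have h3 := (hasDerivAt_heat (hspos t) (x - D.Y p)).comp t h1
      refine (h3.mul (D.deriv_k p ht0)).congr_deriv ?_
      simp only [hf', Function.comp]
      ring)
  have hst₂ : s t₂ = a ^ 2 := by rw [hseq t₂ le_rfl]; ring
  rw [hst₂, hseq (-(1 / 2)) (by linarith [ht₂.1])] at hFTC
  rw [hFTC]
  -- cancellation on slices
  set Φ : E → ℝ → ℝ := fun p t =>
    f' p t - (heat (s t) (x - D.X p t) * D.ν p t - D.g t * heat (s t) (x - D.Y p))
      - D.g t * (inner ℝ (heatGrad (s t) (x - p)) (D.r p t) - heatLap (s t) (x - p) * D.k p t)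
    with hΦ
  have gΦ : Growth (-(Module.finrank ℝ E + 1 : ℤ)) Φ :=
    (gF'.sub (gΓXν.sub ((gg.mul gΓY').mono (by simp)))).sub
      ((gg.mul (gNr'.sub gHpk)).mono (by simp))
  have hslice : ∀ t ∈ Icc (-1 : ℝ) 0, ∫ p, f' p t = ∫ p, Φ p t := fun t ht => by
    have j1 := gF'.integrable le_rfl ht
    have j2 := gΓXν.integrable le_rfl ht
    have j3 := (gΓY'.integrable le_rfl ht).const_mul (D.g t)
    have j4 := gNr'.integrable le_rfl ht
    have j5 := gHpk.integrable le_rfl ht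
    have j23 : Integrable fun p =>
      heat (s t) (x - D.X p t) * D.ν p t - D.g t * heat (s t) (x - D.Y p) := j2.sub j3
    have j45 : Integrable fun p => D.g t * (inner ℝ (heatGrad (s t) (x - p)) (D.r p t)
      - heatLap (s t) (x - p) * D.k p t) := (j4.sub j5).const_mul _
    have j123 : Integrable fun p => f' p t -
      (heat (s t) (x - D.X p t) * D.ν p t - D.g t * heat (s t) (x - D.Y p)) := j1.sub j23
    simp only [hΦ]
    rw [integral_sub j123 j45, integral_sub j1 j23, integral_sub j2 j3, integral_const_mul,
      integral_const_mul, integral_sub j4 j5, hD.integral_inner_heatGrad ht (hspos t),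
      D.transport' t (fun y => heat (s t) (x - y))]
    ring
  -- pointwise bound of the remainder
  set θ := √μ with hθ
  have hθ0 : 0 < θ := Real.sqrt_pos.2 hμ
  have hθ2 : θ ^ 2 = μ := Real.sq_sqrt hμ.le
  set κ := δ / μ + 1 + 1 / θ with hκ
  have hκ0 : 0 < κ := by positivity
  set Ψ : E → ℝ → ℝ := fun p t => 2 * m * B * (wt p * (δ * μ) + κ * (wt p * ‖D.r p t‖ ^ 2)
    + θ * (wt p * (D.ν p t - D.g t) ^ 2) + δ / μ * (wt p * D.k p t ^ 2)) with hΨ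
  have gone : Growth 0 fun (_ : E) (_ : ℝ) => δ * μ := Growth.of_time continuous_const
  have g1 := growth_wt_mul gone (by norm_num)
  have g2 := growth_wt_mul hD.growth_r.sq (by norm_num)
  have g3 := growth_wt_mul (gν.sub gg).sq (by norm_num)
  have g4 := growth_wt_mul gk.sq (by norm_num)
  have gΨ : Growth (-(Module.finrank ℝ E + 1 : ℤ)) Ψ :=
    (((g1.add (g2.const_mul κ)).add (g3.const_mul θ)).add (g4.const_mul (δ / μ))).const_mul _
  have hyoung : ∀ b c l : ℝ, 0 < l → b * c ≤ l * b ^ 2 + c ^ 2 / l := fun b c l hl => by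
    have h1 : 0 ≤ (l * b - c) ^ 2 / l := by positivity
    have h2 : (l * b - c) ^ 2 / l = l * b ^ 2 + c ^ 2 / l - 2 * (b * c) := by field_simp; ring
    have h3 : 0 ≤ l * b ^ 2 + c ^ 2 / l := by positivity
    linarith
  have hpt : ∀ p, ∀ t ∈ Icc (-1 : ℝ) 0, |Φ p t| ≤ Ψ p t := fun p t ht => by
    have hk := hker p t ht _ (hKY p)
    set N := heatGrad (s t) (x - p)
    set ρ := ‖D.r p t‖ with hρ
    have hρ0 : 0 ≤ ρ := norm_nonneg _
    set y := |D.ν p t - D.g t| with hy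
    have hy0 : 0 ≤ y := abs_nonneg _
    have hw := hwt0 p
    have eΦ : Φ p t = (heat (s t) (x - D.Y p) - heat (s t) (x - D.X p t)
        - inner ℝ N ((x - D.Y p) - (x - D.X p t))) * D.ν p t
        + inner ℝ N (D.r p t) * (D.ν p t - D.g t)
        - D.g t * (heatLap (s t) (x - D.Y p) - heatLap (s t) (x - p)) * D.k p t := by
      have : (x - D.Y p) - (x - D.X p t) = D.r p t := by rw [r]; abel
      rw [this]
      simp only [hΦ, hf', N]
      ring
    have er : ‖(x - D.Y p) - (x - D.X p t)‖ = ρ := by rw [hρ, r]; congr 1; abel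
    have eY : ‖(x - D.Y p) - (x - p)‖ ≤ δ := by
      rw [← norm_neg]
      have : -(x - D.Y p - (x - p)) = D.Y p - p := by abel
      rw [this]; exact hD.Y_near p
    have eX : ‖(x - D.X p t) - (x - p)‖ ≤ δ + ρ := by
      have : (x - D.X p t) - (x - p) = ((x - D.Y p) - (x - p)) - ((x - D.Y p) - (x - D.X p t)) := by
        abel
      rw [this]
      exact (norm_sub_le _ _).trans (add_le_add eY er.le)
    have hνm : |D.ν p t| ≤ m := by
      have := D.ν_mem p t
      rw [abs_of_pos (hm₁.trans_le this.1), hm]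
      exact this.2.trans ((le_abs_self _).trans (by linarith))
    have hgm : |D.g t| ≤ m := by
      have := D.g_mem t
      rw [abs_of_pos (hm₁.trans_le this.1), hm]
      exact this.2.trans ((le_abs_self _).trans (by linarith))
    have hm1 : 1 ≤ m := by rw [hm]; linarith [abs_nonneg m₂]
    have b1 : |(heat (s t) (x - D.Y p) - heat (s t) (x - D.X p t)
        - inner ℝ N ((x - D.Y p) - (x - D.X p t))) * D.ν p t|
        ≤ m * B * wt p * ((2 * δ + ρ) * ρ) := by
      rw [abs_mul]
      have h1 := (hk _ (hKX p t ht)).2.2.2.2.2.2.1 _ (hKp p)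
      rw [er] at h1
      have h2 : B * wt p * (‖x - D.Y p - (x - p)‖ + ‖x - D.X p t - (x - p)‖) * ρ
          ≤ B * wt p * (2 * δ + ρ) * ρ :=
        mul_le_mul_of_nonneg_right (mul_le_mul_of_nonneg_left (by linarith) (by positivity)) hρ0
      calc _ ≤ (B * wt p * (2 * δ + ρ) * ρ) * m :=
            mul_le_mul (h1.trans h2) hνm (abs_nonneg _) (by positivity)
        _ = _ := by ring
    have b2 : |inner ℝ N (D.r p t) * (D.ν p t - D.g t)| ≤ m * B * wt p * (ρ * y) := by
      rw [abs_mul]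
      have h1 : |inner ℝ N (D.r p t)| ≤ B * wt p * ρ := by
        refine (abs_real_inner_le_norm _ _).trans ?_
        gcongr
        exact (hker p t ht _ (hKp p) _ (hKp p)).2.1
      calc _ ≤ B * wt p * ρ * y := mul_le_mul_of_nonneg_right h1 hy0
        _ = 1 * (B * wt p * (ρ * y)) := by ring
        _ ≤ m * (B * wt p * (ρ * y)) := by gcongr
        _ = _ := by ring
    have b3 : |D.g t * (heatLap (s t) (x - D.Y p) - heatLap (s t) (x - p)) * D.k p t|
        ≤ m * B * wt p * (δ * |D.k p t|) := by
      rw [abs_mul, abs_mul]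
      have h1 := (hk _ (hKp p)).2.2.2.2.2.1
      calc _ ≤ m * (B * wt p * δ) * |D.k p t| := by
            have h2 : B * wt p * ‖x - D.Y p - (x - p)‖ ≤ B * wt p * δ := by gcongr
            exact mul_le_mul_of_nonneg_right (mul_le_mul hgm (h1.trans h2) (abs_nonneg _) hm0.le)
              (abs_nonneg _)
        _ = _ := by ring
    have y1 : δ * ρ ≤ δ * (μ / 4 + ρ ^ 2 / μ) := by
      gcongr
      have h1 : 0 ≤ (μ / 2 - ρ) ^ 2 / μ := by positivity
      have h2 : (μ / 2 - ρ) ^ 2 / μ = μ / 4 + ρ ^ 2 / μ - ρ := by field_simp; ring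
      linarith
    have y2 : δ * |D.k p t| ≤ δ * (μ / 4 + D.k p t ^ 2 / μ) := by
      gcongr
      rw [← sq_abs (D.k p t)]
      have h1 : 0 ≤ (μ / 2 - |D.k p t|) ^ 2 / μ := by positivity
      have h2 : (μ / 2 - |D.k p t|) ^ 2 / μ = μ / 4 + |D.k p t| ^ 2 / μ - |D.k p t| := by
        field_simp; ring
      linarith
    have y3 : ρ * y ≤ ρ ^ 2 / θ + θ * y ^ 2 := by
      have := hyoung y ρ θ hθ0
      linarith
    have htot : |Φ p t| ≤ m * B * wt p * ((2 * δ + ρ) * ρ + ρ * y + δ * |D.k p t|) := by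
      rw [eΦ]
      refine (abs_sub _ _).trans ((add_le_add ((abs_add_le _ _).trans (add_le_add b1 b2)) b3).trans ?_)
      apply le_of_eq; ring
    refine htot.trans ?_
    have hy2 : y ^ 2 = (D.ν p t - D.g t) ^ 2 := sq_abs _
    have hin : (2 * δ + ρ) * ρ + ρ * y + δ * |D.k p t| ≤ 2 * (δ * μ + κ * ρ ^ 2
        + θ * (D.ν p t - D.g t) ^ 2 + δ / μ * D.k p t ^ 2) := by
      rw [← hy2, hκ]
      have e1 : δ * (μ / 4 + ρ ^ 2 / μ) = δ * μ / 4 + δ / μ * ρ ^ 2 := by ring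
      have e2 : δ * (μ / 4 + D.k p t ^ 2 / μ) = δ * μ / 4 + δ / μ * D.k p t ^ 2 := by ring
      have e3 : ρ ^ 2 / θ = 1 / θ * ρ ^ 2 := by ring
      rw [e1] at y1; rw [e2] at y2; rw [e3] at y3
      have n1 : 0 ≤ δ * μ := by positivity
      have n2 : 0 ≤ δ / μ * ρ ^ 2 := by positivity
      have n3 : 0 ≤ δ / μ * D.k p t ^ 2 := by positivity
      have n4 : 0 ≤ 1 / θ * ρ ^ 2 := by positivity
      have n5 : 0 ≤ θ * y ^ 2 := by positivity
      have n6 : 0 ≤ ρ ^ 2 := by positivity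
      nlinarith
    calc m * B * wt p * ((2 * δ + ρ) * ρ + ρ * y + δ * |D.k p t|)
        ≤ m * B * wt p * (2 * (δ * μ + κ * ρ ^ 2
        + θ * (D.ν p t - D.g t) ^ 2 + δ / μ * D.k p t ^ 2)) := by gcongr
      _ = _ := by simp only [hΨ]; ring
  have ha' : (-(1 / 2) : ℝ) ∈ Icc (-1 : ℝ) 0 := by norm_num
  have h0' : (0 : ℝ) ∈ Icc (-1 : ℝ) 0 := by norm_num
  have ht₂' : t₂ ∈ Icc (-1 : ℝ) 0 := ⟨by linarith [ht₂.1], ht₂.2⟩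
  have hle : -(1 / 2) ≤ t₂ := by linarith [ht₂.1]
  have hΨ0 : ∀ p, ∀ t ∈ Icc (-1 : ℝ) 0, 0 ≤ Ψ p t := fun p t ht => (abs_nonneg _).trans (hpt p t ht)
  have hstep1 : |∫ t in (-(1 / 2))..t₂, ∫ p, f' p t| ≤ ∫ t in (-(1 / 2))..t₂, ∫ p, Ψ p t := by
    refine (intervalIntegral.abs_integral_le_integral_abs hle).trans ?_
    refine intervalIntegral.integral_mono_on hle (gF'.intervalIntegrable le_rfl ha' ht₂').abs
      (gΨ.intervalIntegrable le_rfl ha' ht₂') fun t ht => ?_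
    have ht1 : t ∈ Icc (-1 : ℝ) 0 := ⟨by linarith [ht.1], ht.2.trans ht₂.2⟩
    rw [hslice t ht1]
    refine (abs_integral_le_integral_abs).trans ?_
    exact integral_mono (gΦ.integrable le_rfl ht1).abs (gΨ.integrable le_rfl ht1)
      fun p => hpt p t ht1
  have hstep2 : ∫ t in (-(1 / 2))..t₂, ∫ p, Ψ p t ≤ ∫ t in (-(1 / 2) : ℝ)..0, ∫ p, Ψ p t := by
    refine intervalIntegral.integral_mono_interval le_rfl hle ht₂.2 ?_
      (gΨ.intervalIntegrable le_rfl ha' h0')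
    filter_upwards [ae_restrict_mem measurableSet_Ioc] with t ht
    exact integral_nonneg fun p => hΨ0 p t ⟨by linarith [ht.1], ht.2⟩
  refine (hstep1.trans hstep2).trans ?_
  have hcomp : ∫ t in (-(1 / 2) : ℝ)..0, ∫ p, Ψ p t = 2 * m * B * (W * (δ * μ) / 2
      + κ * (∫ t in (-(1 / 2) : ℝ)..0, ∫ p, wt p * ‖D.r p t‖ ^ 2)
      + θ * (∫ t in (-(1 / 2) : ℝ)..0, ∫ p, wt p * (D.ν p t - D.g t) ^ 2)
      + δ / μ * ∫ t in (-(1 / 2) : ℝ)..0, ∫ p, wt p * D.k p t ^ 2) := by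
    have i2 := g2.intervalIntegrable le_rfl ha' h0'
    have i3 := g3.intervalIntegrable le_rfl ha' h0'
    have i4 := g4.intervalIntegrable le_rfl ha' h0'
    have e : ∀ t ∈ uIcc (-(1 / 2) : ℝ) 0, ∫ p, Ψ p t = 2 * m * B * (W * (δ * μ)
      + κ * (∫ p, wt p * ‖D.r p t‖ ^ 2) + θ * (∫ p, wt p * (D.ν p t - D.g t) ^ 2)
      + δ / μ * ∫ p, wt p * D.k p t ^ 2) := fun t ht => by
      rw [uIcc_of_le (by norm_num)] at ht
      have ht1 : t ∈ Icc (-1 : ℝ) 0 := ⟨by linarith [ht.1], ht.2⟩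
      have k1 := g1.integrable le_rfl ht1
      have k2 := (g2.integrable le_rfl ht1).const_mul κ
      have k3 := (g3.integrable le_rfl ht1).const_mul θ
      have k4 := (g4.integrable le_rfl ht1).const_mul (δ / μ)
      have k12 : Integrable fun p => wt p * (δ * μ) + κ * (wt p * ‖D.r p t‖ ^ 2) := k1.add k2
      have k123 : Integrable fun p => wt p * (δ * μ) + κ * (wt p * ‖D.r p t‖ ^ 2)
        + θ * (wt p * (D.ν p t - D.g t) ^ 2) := k12.add k3
      simp only [hΨ]
      rw [integral_const_mul, integral_add k123 k4, integral_add k12 k3, integral_add k1 k2,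
        integral_mul_const, integral_const_mul, integral_const_mul, integral_const_mul, ← wtMass]
    rw [intervalIntegral.integral_congr e, intervalIntegral.integral_const_mul,
      intervalIntegral.integral_add ((intervalIntegrable_const.add (i2.const_mul κ)).add
        (i3.const_mul θ)) (i4.const_mul _),
      intervalIntegral.integral_add (intervalIntegrable_const.add (i2.const_mul κ)) (i3.const_mul θ),
      intervalIntegral.integral_add intervalIntegrable_const (i2.const_mul κ)]
    simp only [intervalIntegral.integral_const, intervalIntegral.integral_const_mul, smul_eq_mul]
    ring
  rw [hcomp]
  have hk2 : ∫ t in (-(1 / 2) : ℝ)..0, ∫ p, wt p * D.k p t ^ 2 ≤ C₁ * μ ^ 2 := by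
    calc ∫ t in (-(1 / 2) : ℝ)..0, ∫ p, wt p * D.k p t ^ 2
        ≤ ∫ t in (-(1 / 2) : ℝ)..0, C₁ * μ ^ 2 :=
          intervalIntegral.integral_mono_on (by norm_num) (g4.intervalIntegrable le_rfl ha' h0')
            intervalIntegrable_const fun t ht => (hcac1 t ht).trans (by gcongr)
      _ = C₁ * μ ^ 2 / 2 := by
          rw [intervalIntegral.integral_const, smul_eq_mul]; ring
      _ ≤ _ := by have : 0 ≤ C₁ * μ ^ 2 := by positivity
                  linarith
  have hr2 := hcac2.trans (mul_le_mul_of_nonneg_left hE hC₁)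
  have hfin : W * (δ * μ) / 2
      + κ * (∫ t in (-(1 / 2) : ℝ)..0, ∫ p, wt p * ‖D.r p t‖ ^ 2)
      + θ * (∫ t in (-(1 / 2) : ℝ)..0, ∫ p, wt p * (D.ν p t - D.g t) ^ 2)
      + δ / μ * (∫ t in (-(1 / 2) : ℝ)..0, ∫ p, wt p * D.k p t ^ 2)
      ≤ W * (δ * μ) + κ * (C₁ * μ ^ 2) + θ * (C₂ * μ) + δ / μ * (C₁ * μ ^ 2) := by
    have : 0 ≤ W * (δ * μ) := by positivity
    gcongr
    linarith
  have hκμ : κ * μ ^ 2 = (δ + μ + θ) * μ := by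
    rw [hκ, ← hθ2]; field_simp
  calc _ ≤ 2 * m * B * (W * (δ * μ) + κ * (C₁ * μ ^ 2) + θ * (C₂ * μ) + δ / μ * (C₁ * μ ^ 2)) := by
        gcongr
    _ = 2 * m * B * (W * δ + C₁ * (δ + μ + θ) + C₂ * θ + C₁ * δ) * μ := by
        have e1 : δ / μ * (C₁ * μ ^ 2) = C₁ * δ * μ := by field_simp
        have e2 : κ * (C₁ * μ ^ 2) = C₁ * ((δ + μ + θ) * μ) := by rw [← hκμ]; ring
        rw [e1, e2]; ring
    _ ≤ 2 * m * B * ((W + 2 * C₁ + C₂) * (δ + θ + μ)) * μ := by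
        gcongr
        have : 0 ≤ W * θ := by positivity
        have : 0 ≤ W * μ := by positivity
        have : 0 ≤ C₁ * θ := by positivity
        have : 0 ≤ C₁ * μ := by positivity
        have : 0 ≤ C₂ * δ := by positivity
        have : 0 ≤ C₂ * μ := by positivity
        nlinarith
    _ = _ := by ring

end LegendreFlow

end Duality

end PMA

namespace PMA

section Approx

variable {E : Type*} [NormedAddCommGroup E] [InnerProductSpace ℝ E] [FiniteDimensional ℝ E]
  [MeasurableSpace E] [BorelSpace E]

namespace LegendreFlow

variable {c₀ m₁ m₂ : ℝ}

lemma exists_integral_wt_mul_abs_k_le (hc₀ : 0 < c₀) (hm₁ : 0 < m₁) : ∃ C, 0 ≤ C ∧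
    ∀ (D : LegendreFlow E c₀ m₁ m₂) (δ : ℝ), D.Near δ → ∀ μ, 0 < μ → D.energy ≤ μ ^ 2 →
      ∀ t ∈ Icc (-(1 / 2) : ℝ) 0, ∫ p, wt p * |D.k p t| ≤ C * μ := by
  obtain ⟨C₁, hC₁, hcac⟩ := exists_caccioppoli (E := E) (m₂ := m₂) hc₀ hm₁
  have hW : 0 ≤ wtMass E := wtMass_nonneg
  refine ⟨wtMass E + C₁, by positivity, fun D δ hD μ hμ hE t ht => ?_⟩
  have h1 := (hcac D δ hD).1 t ht
  have h2 := hD.growth_k.integral_wt_mul_abs_le (by norm_num) hμ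
    (t := t) ⟨by linarith [ht.1], ht.2⟩
  refine h2.trans ?_
  have h3 : μ⁻¹ * ∫ p, wt p * D.k p t ^ 2 ≤ C₁ * μ := by
    rw [inv_mul_le_iff₀ hμ]
    exact h1.trans ((mul_le_mul_of_nonneg_left hE hC₁).trans (le_of_eq (by ring)))
  have : 0 ≤ C₁ * μ := by positivity
  have : 0 ≤ wtMass E * μ := by positivity
  linarith

/-- Comparison of integrals against `k` with kernels that differ by a multiple of the weight. -/
lemma Near.abs_integral_sub_le {D : LegendreFlow E c₀ m₁ m₂} {δ : ℝ} (hD : D.Near δ) {t : ℝ}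
    (ht : t ∈ Icc (-1 : ℝ) 0) {φ ψ : E → ℝ} (hφ : Continuous φ) (hψ : Continuous ψ) {A B : ℝ}
    (hA : ∀ p, |φ p| ≤ A * wt p) (hA' : ∀ p, |ψ p| ≤ A * wt p)
    (hB : ∀ p, |φ p - ψ p| ≤ B * wt p) :
    |(∫ p, φ p * D.k p t) - ∫ p, ψ p * D.k p t| ≤ B * ∫ p, wt p * |D.k p t| := by
  have hck : Continuous fun p => D.k p t := D.cont_k.comp (by fun_prop : Continuous fun p => (p, t))
  have i1 : Integrable fun p => φ p * D.k p t :=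
    hD.growth_k.integrable_of_abs_le (by norm_num) ht (by fun_prop) A fun p => by
      rw [abs_mul, ← mul_assoc]; exact mul_le_mul_of_nonneg_right (hA p) (abs_nonneg _)
  have i2 : Integrable fun p => ψ p * D.k p t :=
    hD.growth_k.integrable_of_abs_le (by norm_num) ht (by fun_prop) A fun p => by
      rw [abs_mul, ← mul_assoc]; exact mul_le_mul_of_nonneg_right (hA' p) (abs_nonneg _)
  have i3 := (growth_wt_mul hD.growth_k.abs (by norm_num)).integrable le_rfl ht
  rw [← integral_sub i1 i2, ← integral_const_mul]
  refine abs_integral_le_integral_abs.trans (integral_mono (i1.sub i2).abs (i3.const_mul B) ?_)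
  intro p
  simp only [← sub_mul, abs_mul, ← mul_assoc]
  exact mul_le_mul_of_nonneg_right (hB p) (abs_nonneg _)

omit [FiniteDimensional ℝ E] [MeasurableSpace E] [BorelSpace E] in
lemma wt_le_of_mem_closedBall_neg {y p z : E} (hy : ‖y - p‖ ≤ 1 / 4 * (1 + ‖p‖))
    (hz : z ∈ Metric.closedBall (-y) 1) : wt z ≤ 16 ^ wtExp E * wt p := by
  refine wt_le_mul_of_japSq_le ?_
  have h1 := japSq_le_four_mul' hy
  rw [mem_closedBall_iff_norm] at hz
  have h2 : japSq y ≤ 2 * japSq (z - -y) * japSq z := by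
    have := japSq_sub_le (z - -y) z
    simpa using this
  have h3 : japSq (z - -y) ≤ 2 := by unfold japSq; nlinarith [norm_nonneg (z - -y)]
  have := japSq_pos z
  nlinarith

set_option maxHeartbeats 1000000 in
/-- The mollification of `k` at scale `a` is nearly affine in space and constant in time. -/
lemma exists_affine_approx (hc₀ : 0 < c₀) (hm₁ : 0 < m₁) (hm₂ : 0 < m₂) : ∃ C, 0 ≤ C ∧
    ∀ a ∈ Ioc (0 : ℝ) 1, ∃ C', 0 ≤ C' ∧
    ∀ (D : LegendreFlow E c₀ m₁ m₂) (δ : ℝ), D.Near δ → ∀ μ, 0 < μ → D.energy ≤ μ ^ 2 →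
    ∃ (l₀ : ℝ) (l₁ : E), |l₀| ≤ C * μ ∧ ‖l₁‖ ≤ C * μ ∧
    ∀ x : E, ‖x‖ ≤ 1 → ∀ t ∈ Icc (-(1 / 4) : ℝ) 0,
      |(∫ p, heat (a ^ 2) (x - p) * D.k p t) - (l₀ + inner ℝ l₁ x)|
      ≤ C * (‖x‖ ^ 2 + |t|) * μ + C' * ((δ + √μ + μ) * μ) := by
  obtain ⟨C₁, hC₁, hL1⟩ := exists_integral_wt_mul_abs_k_le (E := E) (m₂ := m₂) hc₀ hm₁
  have hσ : 0 < m₁ / 4 := by positivity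
  obtain ⟨Ci, hCi, hinc⟩ := exists_heat_increments (E := E) hσ (1 + m₂)
  set B := Ci * 16 ^ wtExp E with hB
  have hB0 : 0 ≤ B := by positivity
  refine ⟨B * C₁ * (1 + m₂), by positivity, fun a ha => ?_⟩
  obtain ⟨C₂, hC₂, hdual⟩ := exists_duality (E := E) (m₂ := m₂) hc₀ hm₁ ha.1
  have ha2 : 0 < a ^ 2 := by have := ha.1; positivity
  have ha21 : a ^ 2 ≤ 1 := pow_le_one₀ ha.1.le ha.2
  obtain ⟨Ca, hCa, hinca⟩ := exists_heat_increments (E := E) ha2 (a ^ 2)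
  set Ba := Ca * 16 ^ wtExp E with hBa
  have hBa0 : 0 ≤ Ba := by positivity
  refine ⟨C₂ + Ba * C₁, by positivity, fun D δ hD μ hμ hE => ?_⟩
  have hdual := hdual D δ hD μ hμ hE
  have hL1 := hL1 D δ hD μ hμ hE
  have hδ0 := hD.δ_nonneg
  have hcY := D.cont_Y
  have hh : (-(1 / 2) : ℝ) ∈ Icc (-1 : ℝ) 0 := by norm_num
  have hhh : (-(1 / 2) : ℝ) ∈ Icc (-(1 / 2) : ℝ) 0 := by norm_num
  set S : ℝ → ℝ := fun t => a ^ 2 + (D.G t - D.G (-(1 / 2))) with hS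
  have hSmem : ∀ t ∈ Icc (-(1 / 4) : ℝ) 0, S t ∈ Icc (m₁ / 4) (1 + m₂) := fun t ht => by
    have := D.G_sub_mem (t := -(1 / 2)) (t' := t) (by linarith [ht.1]) ht.2
    obtain ⟨h1, h2⟩ := this
    have h3 := ht.1
    have h4 := ht.2
    constructor <;> simp only [hS]
    · nlinarith
    · nlinarith
  have h0 : (0 : ℝ) ∈ Icc (-(1 / 4) : ℝ) 0 := by norm_num
  have hker := fun (p : E) (t : ℝ) (ht : t ∈ Icc (-(1 / 4) : ℝ) 0) => hinc (S t) (hSmem t ht)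
    (Metric.closedBall (-D.Y p) 1) (16 ^ wtExp E * wt p)
    (convex_closedBall _ _) (fun z hz => wt_le_of_mem_closedBall_neg (hD.Y_near' p) hz)
  simp only [← mul_assoc, ← hB] at hker
  have hK0 : ∀ p, -D.Y p ∈ Metric.closedBall (-D.Y p) 1 := fun p =>
    Metric.mem_closedBall_self (by norm_num)
  have hKx : ∀ x : E, ‖x‖ ≤ 1 → ∀ p, x - D.Y p ∈ Metric.closedBall (-D.Y p) 1 := fun x hx p => by
    rw [mem_closedBall_iff_norm]; simpa using hx
  have hck : Continuous fun p => D.k p (-(1 / 2)) :=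
    D.cont_k.comp (by fun_prop : Continuous fun p : E => (p, (-(1 / 2) : ℝ)))
  have hi := (growth_wt_mul hD.growth_k.abs (by norm_num)).integrable le_rfl hh
  have hcN : Continuous fun p => heatGrad (S 0) (-D.Y p) := continuous_heatGrad.comp (by fun_prop)
  have hi1 : Integrable fun p => D.k p (-(1 / 2)) • heatGrad (S 0) (-D.Y p) := by
    refine (hi.const_mul B).mono' (by fun_prop) (Filter.Eventually.of_forall fun p => ?_)
    rw [norm_smul, Real.norm_eq_abs, mul_comm, ← mul_assoc]
    exact mul_le_mul_of_nonneg_right (hker p 0 h0 _ (hK0 p) _ (hK0 p)).2.1 (abs_nonneg _)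
  have hcG : ∀ s : ℝ, ∀ x : E, Continuous fun p => heat s (x - D.Y p) := fun s x =>
    continuous_heat.comp (by fun_prop)
  have hBμ : B * (C₁ * μ) ≤ B * C₁ * (1 + m₂) * μ := by
    have : 0 ≤ B * C₁ * μ * m₂ := by positivity
    nlinarith
  refine ⟨∫ p, heat (S 0) (0 - D.Y p) * D.k p (-(1 / 2)),
    ∫ p, D.k p (-(1 / 2)) • heatGrad (S 0) (-D.Y p), ?_, ?_, fun x hx t ht => ?_⟩
  · have := hD.abs_integral_sub_le hh (hcG (S 0) 0) (continuous_const (y := (0 : ℝ)))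
      (A := B) (B := B)
      (fun p => by
        rw [abs_of_pos (heat_pos _ _), zero_sub]; exact (hker p 0 h0 _ (hK0 p) _ (hK0 p)).1)
      (fun p => by rw [abs_zero]; have := wt_pos p; positivity)
      (fun p => by
        rw [sub_zero, abs_of_pos (heat_pos _ _), zero_sub]
        exact (hker p 0 h0 _ (hK0 p) _ (hK0 p)).1)
    simp only [zero_mul, integral_zero, sub_zero] at this
    exact (this.trans (mul_le_mul_of_nonneg_left (hL1 _ hhh) hB0)).trans hBμ
  · calc ‖∫ p, D.k p (-(1 / 2)) • heatGrad (S 0) (-D.Y p)‖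
        ≤ ∫ p, B * (wt p * |D.k p (-(1 / 2))|) :=
          norm_integral_le_of_norm_le (hi.const_mul B) (Filter.Eventually.of_forall fun p => by
            rw [norm_smul, Real.norm_eq_abs, mul_comm, ← mul_assoc]
            exact mul_le_mul_of_nonneg_right (hker p 0 h0 _ (hK0 p) _ (hK0 p)).2.1 (abs_nonneg _))
      _ ≤ B * (C₁ * μ) := by
          rw [integral_const_mul]; exact mul_le_mul_of_nonneg_left (hL1 _ hhh) hB0
      _ ≤ _ := hBμ
  · have ht1 : t ∈ Icc (-1 : ℝ) 0 := ⟨by linarith [ht.1], ht.2⟩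
    have ht2 : t ∈ Icc (-(1 / 2) : ℝ) 0 := ⟨by linarith [ht.1], ht.2⟩
    have hkera := fun (p : E) => hinca (a ^ 2) ⟨le_rfl, le_rfl⟩
      (Metric.closedBall (x - p) (1 / 4 * (1 + ‖p‖))) (16 ^ wtExp E * wt p)
      (convex_closedBall _ _) (fun z hz => wt_le_of_mem_closedBall hx hz)
    simp only [← mul_assoc, ← hBa] at hkera
    have hKp : ∀ p : E, x - p ∈ Metric.closedBall (x - p) (1 / 4 * (1 + ‖p‖)) := fun p =>
      Metric.mem_closedBall_self (by positivity)
    have hYx : ∀ p, x - p - (x - D.Y p) = D.Y p - p := fun p => by abel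
    have hKY : ∀ p : E, x - D.Y p ∈ Metric.closedBall (x - p) (1 / 4 * (1 + ‖p‖)) := fun p => by
      rw [mem_closedBall_iff_norm, norm_sub_rev, hYx]; exact hD.Y_near' p
    have d1 : |(∫ p, heat (a ^ 2) (x - p) * D.k p t) - ∫ p, heat (a ^ 2) (x - D.Y p) * D.k p t|
        ≤ Ba * δ * (C₁ * μ) := by
      refine (hD.abs_integral_sub_le (φ := fun p => heat (a ^ 2) (x - p)) ht1
        (continuous_heat.comp (by fun_prop)) (hcG _ x) (A := Ba) (B := Ba * δ)
        (fun p => by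
          rw [abs_of_pos (heat_pos _ _)]; exact (hkera p _ (hKp p) _ (hKp p)).1)
        (fun p => by
          rw [abs_of_pos (heat_pos _ _)]; exact (hkera p _ (hKY p) _ (hKp p)).1)
        (fun p => by
          refine ((hkera p _ (hKp p) _ (hKY p)).2.2.2.1).trans ?_
          rw [hYx, mul_right_comm]
          have := hD.Y_near p
          have := wt_pos p
          gcongr)).trans ?_
      exact mul_le_mul_of_nonneg_left (hL1 t ht2) (by positivity)
    have d2 := hdual x hx t ht
    have d3 : |(∫ p, heat (S t) (x - D.Y p) * D.k p (-(1 / 2)))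
        - ∫ p, (heat (S 0) (0 - D.Y p) + inner ℝ (heatGrad (S 0) (-D.Y p)) x)
          * D.k p (-(1 / 2))| ≤ B * (m₂ * |t| + ‖x‖ ^ 2) * (C₁ * μ) := by
      have hSt : |S t - S 0| ≤ m₂ * |t| := by
        have := D.G_sub_mem ht.2 le_rfl
        have h1 : S t - S 0 = -(D.G 0 - D.G t) := by simp only [hS]; ring
        rw [h1, abs_neg, abs_of_nonneg (le_trans (mul_nonneg hm₁.le (by linarith [ht.2])) this.1),
          abs_of_nonpos ht.2]
        simpa using this.2
      refine (hD.abs_integral_sub_le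
        (ψ := fun p => heat (S 0) (0 - D.Y p) + inner ℝ (heatGrad (S 0) (-D.Y p)) x)
        hh (hcG _ x) ((hcG _ 0).add (hcN.inner continuous_const)) (A := 2 * B) (B := B * (m₂ * |t| + ‖x‖ ^ 2)) (fun p => ?_) (fun p => ?_)
        (fun p => ?_)).trans ?_
      · rw [abs_of_pos (heat_pos _ _)]
        have h1 := (hker p t ht _ (hKx x hx p) _ (hK0 p)).1
        have : 0 ≤ B * wt p := (heat_pos _ _).le.trans h1
        linarith
      · refine (abs_add_le _ _).trans ?_
        have h1 := (hker p 0 h0 _ (hK0 p) _ (hK0 p)).1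
        have h2 := (hker p 0 h0 _ (hK0 p) _ (hK0 p)).2.1
        have h3 : |inner ℝ (heatGrad (S 0) (-D.Y p)) x| ≤ B * wt p * 1 :=
          (abs_real_inner_le_norm _ _).trans (mul_le_mul h2 hx (norm_nonneg _)
            ((norm_nonneg _).trans h2))
        rw [zero_sub, abs_of_pos (heat_pos _ _)]
        linarith
      · have h1 := (hker p t ht _ (hKx x hx p) _ (hK0 p)).2.2.2.2.2.2.2 (S 0) (hSmem 0 h0)
        have h2 := (hker p 0 h0 _ (hKx x hx p) _ (hK0 p)).2.2.2.2.2.2.1 _ (hK0 p)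
        have e1 : x - D.Y p - -D.Y p = x := by abel
        rw [e1, sub_self, norm_zero, add_zero] at h2
        have e2 : heat (S t) (x - D.Y p)
            - (heat (S 0) (0 - D.Y p) + inner ℝ (heatGrad (S 0) (-D.Y p)) x)
            = (heat (S t) (x - D.Y p) - heat (S 0) (x - D.Y p)) + (heat (S 0) (x - D.Y p)
              - heat (S 0) (-D.Y p) - inner ℝ (heatGrad (S 0) (-D.Y p)) x) := by
          rw [zero_sub]; ring
        rw [e2]
        have hw := wt_pos p
        calc _ ≤ B * wt p * (m₂ * |t|) + B * wt p * ‖x‖ * ‖x‖ :=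
              (abs_add_le _ _).trans (add_le_add (h1.trans (by gcongr)) h2)
          _ = _ := by ring
      · exact mul_le_mul_of_nonneg_left (hL1 _ hhh) (by positivity)
    have e3 : ∫ p, (heat (S 0) (0 - D.Y p) + inner ℝ (heatGrad (S 0) (-D.Y p)) x)
          * D.k p (-(1 / 2)) = (∫ p, heat (S 0) (0 - D.Y p) * D.k p (-(1 / 2)))
          + inner ℝ (∫ p, D.k p (-(1 / 2)) • heatGrad (S 0) (-D.Y p)) x := by
      have i1 : Integrable fun p => heat (S 0) (0 - D.Y p) * D.k p (-(1 / 2)) :=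
        hD.growth_k.integrable_of_abs_le (by norm_num) hh ((hcG _ 0).mul hck) B fun p => by
          rw [abs_mul, ← mul_assoc, abs_of_pos (heat_pos _ _), zero_sub]
          exact mul_le_mul_of_nonneg_right (hker p 0 h0 _ (hK0 p) _ (hK0 p)).1 (abs_nonneg _)
      have i2 : Integrable fun p => inner ℝ x (D.k p (-(1 / 2)) • heatGrad (S 0) (-D.Y p)) :=
        hi1.const_inner x
      rw [real_inner_comm, ← integral_inner hi1, ← integral_add i1 i2]
      congr 1; funext p
      rw [inner_smul_right, real_inner_comm]
      ring
    rw [e3] at d3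
    have tri : ∀ y₁ y₂ y₃ y₄ e₁ e₂ e₃ : ℝ, |y₁ - y₂| ≤ e₁ → |y₂ - y₃| ≤ e₂ → |y₃ - y₄| ≤ e₃ →
        |y₁ - y₄| ≤ e₁ + e₂ + e₃ := by
      intro y₁ y₂ y₃ y₄ e₁ e₂ e₃ h1 h2 h3
      have h4 := abs_sub_le y₁ y₂ y₄
      have h5 := abs_sub_le y₂ y₃ y₄
      linarith
    refine (tri _ _ _ _ _ _ _ d1 d2 d3).trans ?_
    have hθ := Real.sqrt_nonneg μ
    have q1 : Ba * δ * (C₁ * μ) ≤ Ba * C₁ * ((δ + √μ + μ) * μ) := by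
      have : Ba * C₁ * ((δ + √μ + μ) * μ) = Ba * δ * (C₁ * μ) + Ba * C₁ * ((√μ + μ) * μ) := by ring
      have : 0 ≤ Ba * C₁ * ((√μ + μ) * μ) := by positivity
      linarith
    have q2 : B * (m₂ * |t| + ‖x‖ ^ 2) * (C₁ * μ)
        ≤ B * C₁ * (1 + m₂) * (‖x‖ ^ 2 + |t|) * μ := by
      have e : B * C₁ * (1 + m₂) * (‖x‖ ^ 2 + |t|) * μ = B * (m₂ * |t| + ‖x‖ ^ 2) * (C₁ * μ)
        + B * C₁ * μ * (|t| + m₂ * ‖x‖ ^ 2) := by ring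
      have : 0 ≤ B * C₁ * μ * (|t| + m₂ * ‖x‖ ^ 2) := by positivity
      linarith
    linarith

end LegendreFlow

end Approx

end PMA

namespace PMA

/-! ### Mollification by the heat kernel -/

lemma sq_integral_mul_le {α : Type*} [MeasurableSpace α] {μ : Measure α} {ρ φ : α → ℝ}
    (hρ : ∀ x, 0 ≤ ρ x) (hρ1 : ∫ x, ρ x ∂μ = 1) (h1 : Integrable ρ μ)
    (h2 : Integrable (fun x => ρ x * φ x) μ) (h3 : Integrable (fun x => ρ x * φ x ^ 2) μ) :
    (∫ x, ρ x * φ x ∂μ) ^ 2 ≤ ∫ x, ρ x * φ x ^ 2 ∂μ := by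
  set m := ∫ x, ρ x * φ x ∂μ with hm
  have h4 : 0 ≤ ∫ x, ρ x * (φ x - m) ^ 2 ∂μ :=
    integral_nonneg fun x => mul_nonneg (hρ x) (sq_nonneg _)
  have e : ∀ x, ρ x * (φ x - m) ^ 2 = (ρ x * φ x ^ 2 - 2 * m * (ρ x * φ x)) + m ^ 2 * ρ x :=
    fun x => by ring
  simp_rw [e] at h4
  have h5 : Integrable (fun x => ρ x * φ x ^ 2 - 2 * m * (ρ x * φ x)) μ := h3.sub (h2.const_mul _)
  rw [integral_add h5 (h1.const_mul _), integral_sub h3 (h2.const_mul _), integral_const_mul,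
    integral_const_mul, hρ1, ← hm] at h4
  nlinarith

section

variable {E : Type*} [NormedAddCommGroup E] [InnerProductSpace ℝ E] [FiniteDimensional ℝ E]
  [MeasurableSpace E] [BorelSpace E]

omit [MeasurableSpace E] [BorelSpace E] in
lemma sq_sub_le_integral_gradient {f : E → ℝ} {g : E → E} (hg : Continuous g)
    (hfg : ∀ p, HasGradientAt f (g p) p) (x z : E) :
    (f x - f (x - z)) ^ 2 ≤ ‖z‖ ^ 2 * ∫ s in (-1 : ℝ)..0, ‖g (x + s • z)‖ ^ 2 := by
  have hd : ∀ s : ℝ, HasDerivAt (fun s : ℝ => f (x + s • z)) (inner ℝ (g (x + s • z)) z) s :=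
    fun s => by
      have h1 : HasDerivAt (fun s : ℝ => x + s • z) z s := by
        simpa using ((hasDerivAt_id s).smul_const z).const_add x
      have h2 := (hfg (x + s • z)).hasFDerivAt.comp_hasDerivAt s h1
      exact h2.congr_deriv (by simp)
  have hc : Continuous fun s : ℝ => inner ℝ (g (x + s • z)) z := by fun_prop
  have h1 : f x - f (x - z) = ∫ s in (-1 : ℝ)..0, 1 * inner ℝ (g (x + s • z)) z := by
    simp only [one_mul]
    rw [intervalIntegral.integral_eq_sub_of_hasDerivAt (fun s _ => hd s) (hc.intervalIntegrable _ _)]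
    simp [sub_eq_add_neg]
  have hi : ∀ φ : ℝ → ℝ, Continuous φ → Integrable φ (volume.restrict (Ioc (-1 : ℝ) 0)) :=
    fun φ hφ => (hφ.integrableOn_Icc (a := -1) (b := 0)).mono_set Ioc_subset_Icc_self
  have h2 := sq_integral_mul_le (μ := volume.restrict (Ioc (-1 : ℝ) 0)) (ρ := fun _ => 1)
    (φ := fun s => inner ℝ (g (x + s • z)) z) (fun _ => zero_le_one) (by simp)
    (hi _ continuous_const) (hi _ (by fun_prop)) (hi _ (by fun_prop))
  rw [h1, intervalIntegral.integral_of_le (by norm_num), intervalIntegral.integral_of_le (by norm_num),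
    ← integral_const_mul]
  refine h2.trans (integral_mono (hi _ (by fun_prop)) (hi _ (by fun_prop)) fun s => ?_)
  have := sq_le_sq' (neg_le_of_abs_le (abs_real_inner_le_norm (g (x + s • z)) z))
    (le_of_abs_le (abs_real_inner_le_norm (g (x + s • z)) z))
  simp only [one_mul]
  linarith [mul_pow ‖g (x + s • z)‖ ‖z‖ 2]

lemma japSq_smul_le {s : ℝ} (hs : |s| ≤ 1) (z : E) : japSq (s • z) ≤ japSq z := by
  unfold japSq
  rw [norm_smul, Real.norm_eq_abs]
  have := mul_le_mul_of_nonneg_right hs (norm_nonneg z)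
  gcongr
  linarith

lemma integral_wt_mul_sq_sub_le {f : E → ℝ} {g : E → E} (hg : Continuous g)
    (hfg : ∀ p, HasGradientAt f (g p) p) (hf1 : Growth 1 fun p (_ : ℝ) => f p)
    (hg1 : Growth 1 fun p (_ : ℝ) => ‖g p‖) (z : E) :
    ∫ x, wt x * (f x - f (x - z)) ^ 2 ≤
      ‖z‖ ^ 2 * (2 * japSq z) ^ wtExp E * ∫ x, wt x * ‖g x‖ ^ 2 := by
  have h0 : (0 : ℝ) ∈ Icc (-1 : ℝ) 0 := by norm_num
  have hJ := japSq_pos z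
  have habs : ∀ s ∈ Icc (-1 : ℝ) 0, |s| ≤ 1 := fun s hs => abs_le.2 ⟨hs.1, by linarith [hs.2]⟩
  have hgs : Growth 1 fun p (s : ℝ) => ‖g (p + s • z)‖ := by
    refine hg1.comp (φ := fun p s => p + s • z) (by fun_prop) (c := 2 * japSq z)
      (fun p s hs => ?_) (fun p s hs => ?_)
    · have h1 := japSq_add_le p (s • z)
      have h2 := japSq_smul_le (habs s hs) z
      have h3 := japSq_pos p
      nlinarith
    · have h1 := japSq_sub_le (p + s • z) (s • z)
      rw [add_sub_cancel_right] at h1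
      have h2 := japSq_smul_le (habs s hs) z
      have h3 := japSq_pos (p + s • z)
      nlinarith
  have hfz : Growth 1 fun p (_ : ℝ) => f (p - z) := by
    refine hf1.comp (φ := fun p _ => p - z) (by fun_prop) (c := 2 * japSq z)
      (fun p s hs => ?_) (fun p s hs => ?_)
    · linarith [japSq_sub_le p z]
    · have h1 := japSq_add_le (p - z) z
      rw [sub_add_cancel] at h1
      linarith
  have G1 := growth_wt_mul (hgs.sq.const_mul (‖z‖ ^ 2)) (by norm_num)
  have G2 := growth_wt_mul hg1.sq (by norm_num)
  calc ∫ x, wt x * (f x - f (x - z)) ^ 2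
      ≤ ∫ x, ∫ s in (-1 : ℝ)..0, wt x * (‖z‖ ^ 2 * ‖g (x + s • z)‖ ^ 2) := by
        refine integral_mono ((growth_wt_mul (hf1.sub hfz).sq (by norm_num)).integrable le_rfl h0)
          ?_ fun x => ?_
        · have := (G1.integrable_prod le_rfl (a := -1) (b := 0) le_rfl le_rfl).integral_prod_left
          simpa only [intervalIntegral.integral_of_le (show (-1 : ℝ) ≤ 0 by norm_num)] using this
        · simp only [intervalIntegral.integral_const_mul]
          exact mul_le_mul_of_nonneg_left (sq_sub_le_integral_gradient hg hfg x z) (wt_pos x).le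
    _ = ∫ s in (-1 : ℝ)..0, ∫ x, wt x * (‖z‖ ^ 2 * ‖g (x + s • z)‖ ^ 2) :=
        G1.integral_interval_swap le_rfl le_rfl (by norm_num) le_rfl
    _ ≤ ∫ s in (-1 : ℝ)..0, ‖z‖ ^ 2 * (2 * japSq z) ^ wtExp E * ∫ x, wt x * ‖g x‖ ^ 2 := by
        refine intervalIntegral.integral_mono_on (by norm_num)
          (G1.intervalIntegrable le_rfl (by norm_num) h0) (by simp) fun s hs => ?_
        rw [← integral_sub_right_eq_self _ (s • z), ← integral_const_mul]
        have hi := (G2.integrable le_rfl h0).const_mul (‖z‖ ^ 2 * (2 * japSq z) ^ wtExp E)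
        have hle : ∀ x, wt (x - s • z) * (‖z‖ ^ 2 * ‖g (x - s • z + s • z)‖ ^ 2) ≤
            ‖z‖ ^ 2 * (2 * japSq z) ^ wtExp E * (wt x * ‖g x‖ ^ 2) := fun x => by
          rw [sub_add_cancel]
          have h1 : wt (x - s • z) ≤ (2 * japSq z) ^ wtExp E * wt x := by
            rw [show wt (x - s • z) = wt (s • z - x) by simp only [wt, japSq, norm_sub_rev]]
            refine (wt_sub_le _ _).trans ?_
            have := wt_pos x
            have := japSq_pos (s • z)
            have := japSq_smul_le (habs s hs) z
            gcongr
          calc _ ≤ (2 * japSq z) ^ wtExp E * wt x * (‖z‖ ^ 2 * ‖g x‖ ^ 2) := by gcongr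
            _ = _ := by ring
        have hwc := continuous_wt (E := E)
        refine integral_mono (hi.mono' (by fun_prop) (Filter.Eventually.of_forall fun x => ?_)) hi hle
        rw [Real.norm_of_nonneg (mul_nonneg (wt_pos _).le (by positivity))]
        exact hle x
    _ = _ := by simp

lemma heat_smul {a : ℝ} (ha : 0 < a) (y : E) :
    heat (a ^ 2) (a • y) = (a ^ Module.finrank ℝ E)⁻¹ * heat 1 y := by
  have hpi := Real.pi_pos
  rw [heat, heat, norm_smul, Real.norm_of_nonneg ha.le, Real.log_mul (by positivity) (by positivity),
    Real.log_pow, ← Real.exp_log (inv_pos.2 (pow_pos ha _)), ← Real.exp_add, Real.log_inv,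
    Real.log_pow]
  congr 1
  field_simp
  push_cast
  ring

lemma integral_heat_mul_eq {a : ℝ} (ha : 0 < a) (f : E → ℝ) (x : E) :
    ∫ p, heat (a ^ 2) (x - p) * f p = ∫ y, heat 1 y * f (x - a • y) := by
  rw [← integral_sub_left_eq_self _ volume x]
  simp only [sub_sub_cancel]
  have h := Measure.integral_comp_smul (volume : Measure E)
    (fun p => heat (a ^ 2) p * f (x - p)) a
  simp only [heat_smul ha, mul_assoc, integral_const_mul, smul_eq_mul] at h
  rw [abs_of_pos (by positivity)] at h
  exact (mul_left_cancel₀ (by positivity) h).symm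

lemma exists_mollify_le : ∃ C, 0 ≤ C ∧ ∀ (f : E → ℝ) (g : E → E), Continuous g →
    (∀ p, HasGradientAt f (g p) p) → (Growth 1 fun p (_ : ℝ) => f p) →
    (Growth 1 fun p (_ : ℝ) => ‖g p‖) → ∀ a ∈ Ioc (0 : ℝ) 1,
    Integrable (fun x => wt x * (f x - ∫ p, heat (a ^ 2) (x - p) * f p) ^ 2) ∧
    ∫ x, wt x * (f x - ∫ p, heat (a ^ 2) (x - p) * f p) ^ 2 ≤
      C * a ^ 2 * ∫ x, wt x * ‖g x‖ ^ 2 := by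
  obtain ⟨C, hC, hb⟩ := exists_heat_le_wt (E := E) one_pos 1 (wtExp E + 2)
  have hb' := fun z => hb 1 ⟨le_rfl, le_rfl⟩ z
  have h0 : (0 : ℝ) ∈ Icc (-1 : ℝ) 0 := by norm_num
  have hwt : Integrable (wt : E → ℝ) := integrable_wt
  have hpow : ∀ N ≤ wtExp E + 2, ∀ z : E, japSq z ^ N * heat 1 z ≤ C * wt z := fun N hN z =>
    (mul_le_mul_of_nonneg_right (pow_le_pow_right₀ (one_le_japSq z) hN) (heat_pos _ _).le).trans
      (hb' z)
  have hcJ := continuous_japSq (E := E)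
  have hcH : Continuous fun y : E => heat 1 y := continuous_heat
  have hcw := continuous_wt (E := E)
  have hJi : ∀ N ≤ wtExp E + 2, Integrable fun z : E => japSq z ^ N * heat 1 z := fun N hN =>
    (hwt.const_mul C).mono' (by fun_prop) (Filter.Eventually.of_forall fun z => by
      rw [Real.norm_of_nonneg (mul_nonneg (pow_pos (japSq_pos z) _).le (heat_pos _ _).le)]
      exact hpow N hN z)
  refine ⟨2 ^ wtExp E * (C * wtMass E), by have := wtMass_nonneg (E := E); positivity,
    fun f g hg hfg hf1 hg1 a ha => ?_⟩
  have hfc : Continuous f := hf1.cont.comp (by fun_prop : Continuous fun x : E => (x, (0 : ℝ)))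
  obtain ⟨A, hA, hfA⟩ := hf1.bound
  have hfA' : ∀ p, |f p| ≤ A * japSq p := fun p => by simpa using hfA p 0 h0
  have ha1 : |a| ≤ 1 := by rw [abs_of_pos ha.1]; exact ha.2
  set I := ∫ x, wt x * ‖g x‖ ^ 2 with hI
  have hI0 : 0 ≤ I := integral_nonneg fun x => mul_nonneg (wt_pos x).le (by positivity)
  have hdiff : ∀ x y, |f x - f (x - a • y)| ≤ 3 * A * japSq x * japSq y := fun x y => by
    have h1 := hfA' x
    have h2 := hfA' (x - a • y)
    have h3 := japSq_sub_le x (a • y)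
    have h4 := japSq_smul_le ha1 y
    have h5 := one_le_japSq y
    have h6 := japSq_pos x
    calc |f x - f (x - a • y)| ≤ |f x| + |f (x - a • y)| := abs_sub _ _
      _ ≤ A * (japSq x * japSq y) + A * (2 * japSq x * japSq y) := by
        refine add_le_add (h1.trans (mul_le_mul_of_nonneg_left (by nlinarith) hA)) (h2.trans
          (mul_le_mul_of_nonneg_left (h3.trans (by gcongr)) hA))
      _ = _ := by ring
  have hdiff2 : ∀ x y, (f x - f (x - a • y)) ^ 2 ≤ 9 * A ^ 2 * japSq x ^ 2 * japSq y ^ 2 :=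
    fun x y => by
      have := pow_le_pow_left₀ (abs_nonneg _) (hdiff x y) 2
      rw [sq_abs] at this
      linarith
  have i0 : Integrable fun y : E => heat 1 y := by simpa using hJi 0 (by lia)
  have i1 : ∀ x, Integrable fun y => heat 1 y * (f x - f (x - a • y)) := fun x =>
    ((hJi 1 (by lia)).const_mul (3 * A * japSq x)).mono' (by fun_prop)
      (Filter.Eventually.of_forall fun y => by
        rw [norm_mul, Real.norm_of_nonneg (heat_pos _ _).le, Real.norm_eq_abs]
        have := mul_le_mul_of_nonneg_left (hdiff x y) (heat_pos 1 y).le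
        linarith)
  have i2 : ∀ x, Integrable fun y => heat 1 y * (f x - f (x - a • y)) ^ 2 := fun x =>
    ((hJi 2 (by lia)).const_mul (9 * A ^ 2 * japSq x ^ 2)).mono' (by fun_prop)
      (Filter.Eventually.of_forall fun y => by
        rw [norm_mul, Real.norm_of_nonneg (heat_pos _ _).le, Real.norm_of_nonneg (sq_nonneg _)]
        have := mul_le_mul_of_nonneg_left (hdiff2 x y) (heat_pos 1 y).le
        linarith)
  have iw : Integrable fun x : E => wt x * japSq x ^ 2 := by
    have := (growth_wt_mul (E := E) (Growth.japSq_zpow 2) (by norm_num)).integrable le_rfl h0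
    exact_mod_cast this
  have i3 : Integrable (fun z : E × E => wt z.1 * (heat 1 z.2 * (f z.1 - f (z.1 - a • z.2)) ^ 2))
      (volume.prod volume) := by
    refine ((iw.const_mul (9 * A ^ 2)).mul_prod (hJi 2 (by lia))).mono'
      (Continuous.aestronglyMeasurable (by fun_prop)) (Filter.Eventually.of_forall fun z => ?_)
    have hw := wt_pos z.1
    have hh := heat_pos 1 z.2
    rw [Real.norm_of_nonneg (by positivity)]
    have := mul_le_mul_of_nonneg_left (mul_le_mul_of_nonneg_left (hdiff2 z.1 z.2) hh.le) hw.le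
    linarith
  have e1 : ∀ x, f x - ∫ p, heat (a ^ 2) (x - p) * f p
      = ∫ y, heat 1 y * (f x - f (x - a • y)) := fun x => by
    rw [integral_heat_mul_eq ha.1]
    have i4 : Integrable fun y => heat 1 y * f (x - a • y) := by
      have := (i0.mul_const (f x)).sub (i1 x)
      refine this.congr (Filter.Eventually.of_forall fun y => ?_)
      simp only [Pi.sub_apply]; ring
    have e2 : ∀ y, heat 1 y * (f x - f (x - a • y)) = heat 1 y * f x - heat 1 y * f (x - a • y) :=
      fun y => by ring
    simp_rw [e2]
    rw [integral_sub (i0.mul_const _) i4, integral_mul_const, integral_heat one_pos, one_mul]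
  have hle : ∀ x, wt x * (f x - ∫ p, heat (a ^ 2) (x - p) * f p) ^ 2 ≤
      ∫ y, wt x * (heat 1 y * (f x - f (x - a • y)) ^ 2) := fun x => by
    rw [e1, integral_const_mul]
    exact mul_le_mul_of_nonneg_left (sq_integral_mul_le (fun y => (heat_pos 1 y).le)
      (integral_heat one_pos) i0 (i1 x) (i2 x)) (wt_pos x).le
  constructor
  · refine i3.integral_prod_left.mono' ?_ (Filter.Eventually.of_forall fun x => ?_)
    · simp_rw [e1]
      have : Continuous fun z : E × E => heat 1 z.2 * (f z.1 - f (z.1 - a • z.2)) := by fun_prop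
      have h2 := this.stronglyMeasurable.integral_prod_right' (ν := (volume : Measure E))
      exact (hcw.stronglyMeasurable.mul (h2.pow 2)).aestronglyMeasurable
    · rw [Real.norm_of_nonneg (mul_nonneg (wt_pos x).le (sq_nonneg _))]
      exact hle x
  calc ∫ x, wt x * (f x - ∫ p, heat (a ^ 2) (x - p) * f p) ^ 2
      ≤ ∫ x, ∫ y, wt x * (heat 1 y * (f x - f (x - a • y)) ^ 2) :=
        integral_mono_of_nonneg (Filter.Eventually.of_forall fun x =>
          mul_nonneg (wt_pos x).le (sq_nonneg _)) i3.integral_prod_left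
          (Filter.Eventually.of_forall hle)
    _ = ∫ y, ∫ x, wt x * (heat 1 y * (f x - f (x - a • y)) ^ 2) := integral_integral_swap i3
    _ = ∫ y, heat 1 y * ∫ x, wt x * (f x - f (x - a • y)) ^ 2 := by
        simp_rw [← integral_const_mul]
        congr 1; funext y; congr 1; funext x; ring
    _ ≤ ∫ y, (a ^ 2 * I * 2 ^ wtExp E * C) * wt y := by
        refine integral_mono_of_nonneg (Filter.Eventually.of_forall fun y =>
          mul_nonneg (heat_pos 1 y).le (integral_nonneg fun x =>
            mul_nonneg (wt_pos x).le (sq_nonneg _))) (hwt.const_mul _)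
          (Filter.Eventually.of_forall fun y => ?_)
        have h1 := integral_wt_mul_sq_sub_le hg hfg hf1 hg1 (a • y)
        have h2 : ‖a • y‖ ^ 2 ≤ a ^ 2 * japSq y := by
          rw [norm_smul, mul_pow, Real.norm_eq_abs, sq_abs]
          unfold japSq; nlinarith [sq_nonneg a]
        have h3 := japSq_smul_le ha1 y
        have h4 := heat_pos 1 y
        have h5 := japSq_pos y
        have h6 := japSq_pos (a • y)
        have h7 := hpow (wtExp E + 1) (by lia) y
        calc heat 1 y * ∫ x, wt x * (f x - f (x - a • y)) ^ 2
            ≤ heat 1 y * ((a ^ 2 * japSq y) * (2 * japSq y) ^ wtExp E * I) := by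
              refine mul_le_mul_of_nonneg_left (h1.trans ?_) h4.le
              gcongr
          _ = (a ^ 2 * I * 2 ^ wtExp E) * (japSq y ^ (wtExp E + 1) * heat 1 y) := by
              rw [mul_pow]; ring
          _ ≤ (a ^ 2 * I * 2 ^ wtExp E) * (C * wt y) := by gcongr
          _ = _ := by ring
    _ = _ := by rw [integral_const_mul, wtMass]; ring

end

end PMA

namespace PMA

/-! ### One step of the improvement of flatness -/

section

variable {E : Type*} [NormedAddCommGroup E] [InnerProductSpace ℝ E] [FiniteDimensional ℝ E]
  [MeasurableSpace E] [BorelSpace E]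

variable (E) in
/-- The second moment of the weight. -/
def wtMoment : ℝ := ∫ p : E, wt p * japSq p ^ 2

lemma wtMoment_nonneg : 0 ≤ wtMoment E :=
  integral_nonneg fun p => mul_nonneg (wt_pos p).le (sq_nonneg _)

lemma integrable_wt_mul_japSq_sq : Integrable fun x : E => wt x * japSq x ^ 2 := by
  have := (growth_wt_mul (E := E) (Growth.japSq_zpow 2) (by norm_num)).integrable le_rfl
    (t := 0) (by norm_num)
  exact_mod_cast this

omit [FiniteDimensional ℝ E] [MeasurableSpace E] [BorelSpace E] in
lemma wt_smul_le {K : ℝ} (hK : 1 ≤ K) (p : E) : wt (K • p) ≤ wt p := by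
  have h : japSq p ≤ 1 * japSq (K • p) := by
    unfold japSq
    rw [norm_smul, Real.norm_of_nonneg (by linarith)]
    have := norm_nonneg p
    have : ‖p‖ ≤ K * ‖p‖ := by nlinarith
    have := pow_le_pow_left₀ (norm_nonneg p) this 2
    linarith
  simpa using wt_le_mul_of_japSq_le h

omit [FiniteDimensional ℝ E] [MeasurableSpace E] [BorelSpace E] in
lemma wt_smul_le_of_far {K : ℝ} (hK : 1 ≤ K) {p : E} (hp : 1 ≤ K * ‖p‖ ^ 2) :
    wt (K • p) ≤ (2 / K) ^ wtExp E * wt p := by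
  refine wt_le_mul_of_japSq_le ?_
  have hK0 : 0 < K := by linarith
  rw [div_mul_eq_mul_div, le_div_iff₀ hK0]
  unfold japSq
  rw [norm_smul, Real.norm_of_nonneg hK0.le, mul_pow]
  nlinarith [sq_nonneg ‖p‖]

set_option maxHeartbeats 1000000 in
lemma integral_wt_mul_sq_smul_le {κ k m d₁ : E → ℝ} {K L η e l₀ : ℝ} {l₁ : E} (hK : 1 ≤ K)
    (hκ : ∀ p, |κ p - (k p - (l₀ + inner ℝ l₁ p)) - d₁ p| ≤ e)
    (hl₀ : |l₀| ≤ L) (hl₁ : ‖l₁‖ ≤ L)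
    (hm : ∀ p, ‖p‖ ≤ 1 → |m p - (l₀ + inner ℝ l₁ p)| ≤ L * (‖p‖ ^ 2 + (K⁻¹) ^ 2) + η)
    (i1 : Integrable fun p => wt p * (k p - m p) ^ 2) (i2 : Integrable fun p => wt p * k p ^ 2)
    (i3 : Integrable fun p => wt p * d₁ p ^ 2) :
    ∫ p, wt p * κ (K⁻¹ • p) ^ 2 ≤ K ^ Module.finrank ℝ E * (4 * (∫ p, wt p * (k p - m p) ^ 2)
      + 4 * (∫ p, wt p * d₁ p ^ 2) + (2 / K) ^ wtExp E * (4 * (∫ p, wt p * k p ^ 2)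
        + 8 * L ^ 2 * wtMoment E))
      + 8 * L ^ 2 * (K⁻¹) ^ 4 * wtMoment E + (8 * η ^ 2 + 4 * e ^ 2) * wtMass E := by
  have hK0 : 0 < K := by linarith
  have i4 := integrable_wt_mul_japSq_sq (E := E)
  have i5 : Integrable (wt : E → ℝ) := integrable_wt
  set Φ : E → ℝ := fun p => 4 * (wt p * (k p - m p) ^ 2) + 4 * (wt p * d₁ p ^ 2)
    + (2 / K) ^ wtExp E * (4 * (wt p * k p ^ 2) + 8 * L ^ 2 * (wt p * japSq p ^ 2)) with hΦ
  set Ψ : E → ℝ := fun p => 8 * L ^ 2 * (K⁻¹) ^ 4 * (wt p * japSq p ^ 2)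
    + (8 * η ^ 2 + 4 * e ^ 2) * wt p with hΨ
  have j1 : Integrable fun p => 4 * (wt p * (k p - m p) ^ 2) + 4 * (wt p * d₁ p ^ 2) :=
    (i1.const_mul _).add (i3.const_mul _)
  have j2 : Integrable fun p => 4 * (wt p * k p ^ 2) + 8 * L ^ 2 * (wt p * japSq p ^ 2) :=
    (i2.const_mul _).add (i4.const_mul _)
  have iΦ : Integrable Φ := j1.add (j2.const_mul _)
  have iΨ : Integrable Ψ := (i4.const_mul _).add (i5.const_mul _)
  have eΦ : ∫ p, Φ p = 4 * (∫ p, wt p * (k p - m p) ^ 2)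
      + 4 * (∫ p, wt p * d₁ p ^ 2) + (2 / K) ^ wtExp E * (4 * (∫ p, wt p * k p ^ 2)
        + 8 * L ^ 2 * wtMoment E) := by
    rw [hΦ, integral_add j1 (j2.const_mul _), integral_add (i1.const_mul _) (i3.const_mul _),
      integral_const_mul ((2 / K) ^ wtExp E), integral_add (i2.const_mul _) (i4.const_mul _)]
    simp only [integral_const_mul, wtMoment]
  have eΨ : ∫ p, Ψ p = 8 * L ^ 2 * (K⁻¹) ^ 4 * wtMoment E + (8 * η ^ 2 + 4 * e ^ 2) * wtMass E := by
    rw [hΨ, integral_add (i4.const_mul _) (i5.const_mul _)]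
    simp only [integral_const_mul, wtMoment, wtMass]
  have eΦ' : ∫ p, Φ (K⁻¹ • p) = K ^ Module.finrank ℝ E * ∫ p, Φ p := by
    rw [Measure.integral_comp_smul, inv_pow, inv_inv, abs_of_pos (by positivity), smul_eq_mul]
  have iΦ' : Integrable fun p => Φ (K⁻¹ • p) := iΦ.comp_smul (by positivity)
  rw [add_assoc, ← eΦ, ← eΨ, ← eΦ', ← integral_add iΦ' iΨ]
  refine integral_mono_of_nonneg (Filter.Eventually.of_forall fun p =>
    mul_nonneg (wt_pos p).le (sq_nonneg _)) (iΦ'.add iΨ) (Filter.Eventually.of_forall fun p => ?_)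
  obtain ⟨p', rfl⟩ : ∃ p', p = K • p' := ⟨K⁻¹ • p, by rw [smul_inv_smul₀ hK0.ne']⟩
  simp only [inv_smul_smul₀ hK0.ne', hΦ, hΨ]
  have hw := wt_pos (K • p')
  have hw' := wt_pos p'
  have hww := wt_smul_le hK p'
  have hJ := japSq_pos p'
  have hJ1 := one_le_japSq p'
  set l := l₀ + inner ℝ l₁ p' with hl
  set A := k p' - l with hA
  set B := d₁ p' with hB
  set F := κ p' - A - B with hF
  have h1 : κ p' ^ 2 ≤ 2 * A ^ 2 + 4 * B ^ 2 + 4 * F ^ 2 := by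
    have : κ p' = A + (B + F) := by rw [hF]; ring
    rw [this]
    linarith [add_sq_le (a := A) (b := B + F), add_sq_le (a := B) (b := F)]
  have h2 : F ^ 2 ≤ e ^ 2 := sq_le_sq' (neg_le_of_abs_le (hκ p')) (le_of_abs_le (hκ p'))
  have hfar : (0 : ℝ) < (2 / K) ^ wtExp E := by positivity
  have h3 : 2 * (wt (K • p') * A ^ 2) ≤ 4 * (wt p' * (k p' - m p') ^ 2)
      + (2 / K) ^ wtExp E * (4 * (wt p' * k p' ^ 2) + 8 * L ^ 2 * (wt p' * japSq p' ^ 2))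
      + (8 * L ^ 2 * (K⁻¹) ^ 4 * (wt (K • p') * japSq (K • p') ^ 2) + 8 * η ^ 2 * wt (K • p')) := by
    by_cases hp : 1 ≤ K * ‖p'‖ ^ 2
    · have hw2 := wt_smul_le_of_far hK hp
      have hlb : l ^ 2 ≤ 2 * L ^ 2 * japSq p' := by
        have h4 : |l| ≤ L * (1 + ‖p'‖) := by
          calc |l| ≤ |l₀| + |inner ℝ l₁ p'| := abs_add_le _ _
            _ ≤ L + L * ‖p'‖ := add_le_add hl₀ ((abs_real_inner_le_norm _ _).trans (by gcongr))
            _ = _ := by ring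
        have h5 := pow_le_pow_left₀ (abs_nonneg _) h4 2
        rw [sq_abs] at h5
        refine h5.trans ?_
        have : (1 + ‖p'‖) ^ 2 ≤ 2 * japSq p' := by
          unfold japSq; nlinarith [sq_nonneg (‖p'‖ - 1)]
        calc (L * (1 + ‖p'‖)) ^ 2 = L ^ 2 * (1 + ‖p'‖) ^ 2 := by ring
          _ ≤ L ^ 2 * (2 * japSq p') := by gcongr
          _ = _ := by ring
      have hA2 : A ^ 2 ≤ 2 * k p' ^ 2 + 4 * L ^ 2 * japSq p' ^ 2 := by
        have h6 : A ^ 2 ≤ 2 * k p' ^ 2 + 2 * l ^ 2 := by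
          rw [hA, sub_eq_add_neg]; linarith [add_sq_le (a := k p') (b := -l), neg_sq l]
        have h7 : L ^ 2 * japSq p' ≤ L ^ 2 * japSq p' ^ 2 := by
          have : japSq p' ≤ japSq p' ^ 2 := le_self_pow₀ hJ1 two_ne_zero
          gcongr
        linarith
      have h8 : wt (K • p') * A ^ 2 ≤ (2 / K) ^ wtExp E * wt p'
          * (2 * k p' ^ 2 + 4 * L ^ 2 * japSq p' ^ 2) := by
        gcongr
      have h9 : 0 ≤ 4 * (wt p' * (k p' - m p') ^ 2) := by positivity
      have h10 : 0 ≤ 8 * L ^ 2 * (K⁻¹) ^ 4 * (wt (K • p') * japSq (K • p') ^ 2)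
        + 8 * η ^ 2 * wt (K • p') := by positivity
      linarith
    · have hp1 : ‖p'‖ ≤ 1 := by
        by_contra hcon
        push Not at hcon
        exact hp (one_le_mul_of_one_le_of_one_le hK (one_le_pow₀ hcon.le))
      have h4 := hm p' hp1
      have h5 : ‖p'‖ ^ 2 + (K⁻¹) ^ 2 = (K⁻¹) ^ 2 * japSq (K • p') := by
        unfold japSq
        rw [norm_smul, Real.norm_of_nonneg hK0.le]
        field_simp
        ring
      rw [h5] at h4
      have h6 := pow_le_pow_left₀ (abs_nonneg _) h4 2
      rw [sq_abs] at h6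
      have h7 : A ^ 2 ≤ 2 * (k p' - m p') ^ 2 + 4 * (L ^ 2 * (K⁻¹) ^ 4 * japSq (K • p') ^ 2)
          + 4 * η ^ 2 := by
        have : A = (k p' - m p') + (m p' - l) := by rw [hA]; ring
        rw [this]
        linarith [add_sq_le (a := k p' - m p') (b := m p' - l),
          add_sq_le (a := L * ((K⁻¹) ^ 2 * japSq (K • p'))) (b := η)]
      have h8 : wt (K • p') * A ^ 2 ≤ wt (K • p') * (2 * (k p' - m p') ^ 2
          + 4 * (L ^ 2 * (K⁻¹) ^ 4 * japSq (K • p') ^ 2) + 4 * η ^ 2) := by gcongr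
      have h9 : wt (K • p') * (k p' - m p') ^ 2 ≤ wt p' * (k p' - m p') ^ 2 := by gcongr
      have h10 : 0 ≤ (2 / K) ^ wtExp E * (4 * (wt p' * k p' ^ 2)
        + 8 * L ^ 2 * (wt p' * japSq p' ^ 2)) := by positivity
      linarith
  have h11 : wt (K • p') * κ p' ^ 2 ≤ wt (K • p') * (2 * A ^ 2 + 4 * B ^ 2 + 4 * F ^ 2) := by gcongr
  have h12 : wt (K • p') * B ^ 2 ≤ wt p' * B ^ 2 := by gcongr
  have h13 : wt (K • p') * F ^ 2 ≤ wt (K • p') * e ^ 2 := by gcongr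
  linarith

end

namespace LegendreFlow

variable {E : Type*} [NormedAddCommGroup E] [InnerProductSpace ℝ E] [FiniteDimensional ℝ E]
  [MeasurableSpace E] [BorelSpace E] {c₀ m₁ m₂ : ℝ}

lemma Near.abs_V_add_sub_le {D : LegendreFlow E c₀ m₁ m₂} {δ : ℝ} (hD : D.Near δ) (p c : E) :
    |D.V (p + c) - D.V p - inner ℝ c p| ≤ ‖c‖ * (δ + ‖c‖) := by
  have h1 : ∀ q ∈ Metric.closedBall p ‖c‖, HasFDerivWithinAt (fun q => D.V q - inner ℝ p q)
      (innerSL ℝ (D.Y q - p)) (Metric.closedBall p ‖c‖) q := fun q _ => by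
    have h2 := (D.gradV q).hasFDerivAt
    have h3 := (innerSL ℝ p).hasFDerivAt (x := q)
    rw [map_sub]
    exact (h2.sub h3).hasFDerivWithinAt
  have h2 := Convex.norm_image_sub_le_of_norm_hasFDerivWithin_le (C := δ + ‖c‖) h1
    (fun q hq => ?_) (convex_closedBall _ _) (x := p) (y := p + c)
    (Metric.mem_closedBall_self (norm_nonneg _)) (by simp)
  · simp only [add_sub_cancel_left, inner_add_right, Real.norm_eq_abs] at h2
    rw [real_inner_comm]
    refine le_trans (le_of_eq ?_) (h2.trans_eq (mul_comm _ _))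
    congr 1; ring
  · rw [innerSL_apply_norm]
    rw [mem_closedBall_iff_norm] at hq
    calc ‖D.Y q - p‖ = ‖(D.Y q - q) + (q - p)‖ := by congr 1; abel
      _ ≤ δ + ‖c‖ := (norm_add_le _ _).trans (add_le_add (hD.Y_near q) hq)

set_option maxHeartbeats 1000000 in
/-- Improvement of flatness at a fixed smaller scale. -/
theorem exists_one_step (hc₀ : 0 < c₀) (hm₁ : 0 < m₁) (hm₂ : 0 < m₂) {β : ℝ} (hβ : 0 < β) :
    ∃ K : ℝ, ∃ hK : 2 ≤ K, ∃ y₀ : ℝ, 0 < y₀ ∧ ∀ (D : LegendreFlow E c₀ m₁ m₂) (δ : ℝ), D.Near δ →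
      δ ≤ y₀ → ∀ μ, 0 < μ → μ ≤ y₀ → D.energy ≤ μ ^ 2 → ∃ (c : E) (d : ℝ),
        (D.rescale K⁻¹ (by positivity) c d).energy ≤ 1 / 4 * K ^ (2 * β) * μ ^ 2 := by
  obtain ⟨C, hC, haff⟩ := exists_affine_approx (E := E) hc₀ hm₁ hm₂
  obtain ⟨Cc, hCc, hcac⟩ := exists_caccioppoli (E := E) (m₂ := m₂) hc₀ hm₁
  obtain ⟨Cm, hCm, hmol⟩ := exists_mollify_le (E := E)
  set d : ℕ := Module.finrank ℝ E with hd
  set W := wtMass E with hW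
  set M := wtMoment E with hM
  have hW0 : 0 ≤ W := wtMass_nonneg
  have hM0 : 0 ≤ M := wtMoment_nonneg
  set q := wtExp E with hq
  have hqd : d + 4 ≤ q := by rw [hq, wtExp, ← hd]; lia
  clear_value d q W M
  set H := 8 * C ^ 2 * M + 2 ^ q * (4 * Cc + 8 * C ^ 2 * M) with hH
  obtain ⟨K, hK2, hKH⟩ : ∃ K : ℝ, 2 ≤ K ∧ 16 * H ≤ K ^ (2 * β) := by
    have := (tendsto_rpow_atTop (y := 2 * β) (by positivity)).eventually_ge_atTop (16 * H)
    obtain ⟨K, h1, h2⟩ := (this.and (Filter.eventually_ge_atTop 2)).exists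
    exact ⟨K, h2, h1⟩
  have hK0 : 0 < K := by linarith
  have hKβ : 1 ≤ K ^ (2 * β) := Real.one_le_rpow (by linarith) (by positivity)
  obtain ⟨a, ha, haK⟩ : ∃ a ∈ Ioc (0 : ℝ) 1, K ^ (d + 6) * Cc * (4 * Cm * a ^ 2) ≤ 1 / 16 := by
    have hc : Filter.Tendsto (fun a : ℝ => K ^ (d + 6) * Cc * (4 * Cm * a ^ 2))
        (nhdsWithin 0 (Ioi 0)) (nhds (K ^ (d + 6) * Cc * (4 * Cm * 0 ^ 2))) :=
      ((by fun_prop : Continuous fun a : ℝ => K ^ (d + 6) * Cc * (4 * Cm * a ^ 2)).tendsto 0).mono_left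
        nhdsWithin_le_nhds
    have h1 := hc.eventually_le_const (u := 1 / 16) (by norm_num)
    obtain ⟨a, h2, h3⟩ := (h1.and (Ioc_mem_nhdsGT (zero_lt_one' ℝ))).exists
    exact ⟨a, h3, h2⟩
  obtain ⟨C', hC', haffa⟩ := haff a ha
  set F : ℝ → ℝ → ℝ := fun x y => K ^ 4 * (8 * (C' * (x + √y + y)) ^ 2 + 4 * (C * (x + C * y)) ^ 2) * W
    + K ^ (d + 6) * Cc * (4 * (C * y) ^ 2 * (2 * (1 + (C * y) ^ 2)) ^ q) with hF
  obtain ⟨y₀, hy₀, hFy⟩ : ∃ y₀ : ℝ, 0 < y₀ ∧ F y₀ y₀ ≤ 1 / 16 := by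
    have hc : Filter.Tendsto (fun y => F y y) (nhdsWithin 0 (Ioi 0)) (nhds (F 0 0)) := by
      have : Continuous fun y => F y y := by simp only [hF]; fun_prop
      exact (this.tendsto 0).mono_left nhdsWithin_le_nhds
    have h0 : F 0 0 = 0 := by simp [hF]
    rw [h0] at hc
    obtain ⟨y, h2, h3⟩ := ((hc.eventually_le_const (u := 1 / 16) (by norm_num)).and
      self_mem_nhdsWithin).exists
    exact ⟨y, h3, h2⟩
  refine ⟨K, hK2, y₀, hy₀, fun D δ hD hδ μ hμ hμy hE => ?_⟩
  obtain ⟨l₀, l₁, hl₀, hl₁, hl⟩ := haffa D δ hD μ hμ hE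
  obtain ⟨hslice, hgrad⟩ := hcac D δ hD
  have hδ0 := hD.δ_nonneg
  have hFle : F δ μ ≤ 1 / 16 := by
    refine le_trans ?_ hFy
    simp only [hF]
    gcongr
  refine ⟨-l₁, l₀, ?_⟩
  set c := -l₁ with hc
  have hcn : ‖c‖ ≤ C * μ := by rw [hc, norm_neg]; exact hl₁
  set η := C' * ((δ + √μ + μ) * μ) with hη
  set e := ‖c‖ * (δ + ‖c‖) with he
  set L := C * μ with hL
  have hL0 : 0 ≤ L := by positivity
  set ρ : ℝ → ℝ := fun s => ∫ p, wt p * ‖D.r p s‖ ^ 2 with hρ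
  set α := K ^ (d + 4) * (4 * Cm * a ^ 2 + 4 * (‖c‖ ^ 2 * (2 * japSq c) ^ q)) with hα
  set γ := K ^ (d + 4) * (2 / K) ^ q * (4 * (Cc * μ ^ 2) + 8 * L ^ 2 * M) + 8 * L ^ 2 * M
    + K ^ 4 * (8 * η ^ 2 + 4 * e ^ 2) * W with hγ
  have hJc := japSq_pos c
  have hα0 : 0 ≤ α := by positivity
  have hKi : K⁻¹ ≤ 1 / 2 := by rw [inv_eq_one_div]; exact one_div_le_one_div_of_le (by norm_num) hK2
  have hKi0 : 0 < K⁻¹ := by positivity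
  have hKi2 : (K⁻¹) ^ 2 ≤ 1 / 4 := (pow_le_pow_left₀ hKi0.le hKi 2).trans (by norm_num)
  have htime : ∀ t ∈ Icc (-1 : ℝ) 0, (K⁻¹) ^ 2 * t ∈ Icc (-(1 / 4) : ℝ) 0 ∧
      |(K⁻¹) ^ 2 * t| ≤ (K⁻¹) ^ 2 := fun t ht => by
    have h1 := ht.1
    have h2 := ht.2
    have h3 : 0 ≤ (K⁻¹) ^ 2 := by positivity
    have h4 : |(K⁻¹) ^ 2 * t| ≤ (K⁻¹) ^ 2 := by
      rw [abs_mul, abs_of_nonneg h3]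
      exact mul_le_of_le_one_right h3 (abs_le.2 ⟨h1, by linarith⟩)
    exact ⟨⟨by linarith [neg_le_of_abs_le h4], mul_nonpos_of_nonneg_of_nonpos h3 h2⟩, h4⟩
  have key : ∀ t ∈ Icc (-1 : ℝ) 0,
      ∫ p, wt p * (D.rescale K⁻¹ (by positivity) c l₀).k p t ^ 2 ≤ α * ρ ((K⁻¹) ^ 2 * t) + γ := by
    intro t ht
    obtain ⟨hs, hs'⟩ := htime t ht
    set s := (K⁻¹) ^ 2 * t with hs_def
    have hs1 : s ∈ Icc (-1 : ℝ) 0 := ⟨by linarith [hs.1], hs.2⟩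
    have hs2 : s ∈ Icc (-(1 / 2) : ℝ) 0 := ⟨by linarith [hs.1], hs.2⟩
    have hf1 : Growth 1 fun p (_ : ℝ) => D.k p s :=
      ⟨D.cont_k.comp (by fun_prop : Continuous fun z : E × ℝ => (z.1, s)), by
        obtain ⟨B, hB, hb⟩ := hD.growth_k.bound
        exact ⟨B, hB, fun p _ _ => hb p s hs1⟩⟩
    have hg1 : Growth 1 fun p (_ : ℝ) => ‖D.r p s‖ :=
      ⟨(D.cont_r.comp (by fun_prop : Continuous fun z : E × ℝ => (z.1, s))).norm, by
        obtain ⟨B, hB, hb⟩ := hD.growth_r.bound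
        exact ⟨B, hB, fun p _ _ => hb p s hs1⟩⟩
    have hgc : Continuous fun p => D.r p s :=
      D.cont_r.comp (by fun_prop : Continuous fun p : E => (p, s))
    obtain ⟨im, hmo⟩ := hmol (fun p => D.k p s) (fun p => D.r p s) hgc (fun p => D.gradk p s)
      hf1 hg1 a ha
    have hsh := integral_wt_mul_sq_sub_le hgc (fun p => D.gradk p s) hf1 hg1 (-c)
    simp only [sub_neg_eq_add, norm_neg, japSq_neg] at hsh
    have hfc : Growth 1 fun p (_ : ℝ) => D.k (p + c) s := by
      refine hf1.comp (φ := fun p _ => p + c) (by fun_prop) (c := 2 * japSq c)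
        (fun p s hs => ?_) (fun p s hs => ?_)
      · linarith [japSq_add_le p c]
      · have h1 := japSq_sub_le (p + c) c
        rw [add_sub_cancel_right] at h1
        linarith
    have i2 := (growth_wt_mul hf1.sq (by norm_num)).integrable le_rfl ht
    have i3 := (growth_wt_mul (hf1.sub hfc).sq (by norm_num)).integrable le_rfl ht
    have hmain := integral_wt_mul_sq_smul_le (κ := fun p => D.v (p + c) s - l₀ - D.V p - D.G s)
      (k := fun p => D.k p s) (m := fun x => ∫ p, heat (a ^ 2) (x - p) * D.k p s)
      (d₁ := fun p => D.k (p + c) s - D.k p s) (K := K) (L := L) (η := η) (e := e) (l₀ := l₀)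
      (l₁ := l₁) (by linarith)
      (fun p => by
        have h1 := hD.abs_V_add_sub_le p c
        have h2 : inner ℝ c p = -inner ℝ l₁ p := by rw [hc, inner_neg_left]
        rw [h2] at h1
        refine le_trans (le_of_eq ?_) h1
        congr 1
        simp only [k]
        ring)
      hl₀ hl₁
      (fun p hp => (hl p hp s hs).trans (by
        rw [hη, mul_right_comm]
        gcongr))
      im i2 (i3.congr (Filter.Eventually.of_forall fun p => by
        simp only [sub_sq_comm]))
    have hk2 := (hslice s hs2).trans (mul_le_mul_of_nonneg_left hE hCc)
    have e1 : ∀ p, wt p * (D.rescale K⁻¹ (by positivity) c l₀).k p t ^ 2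
        = K ^ 4 * (wt p * (D.v (K⁻¹ • p + c) s - l₀ - D.V (K⁻¹ • p) - D.G s) ^ 2) := fun p => by
      rw [rescale_k, ← hs_def]
      generalize D.v (K⁻¹ • p + c) s - l₀ - D.V (K⁻¹ • p) - D.G s = y
      field_simp
    simp_rw [e1]
    rw [integral_const_mul]
    simp only [sub_sq_comm (D.k (_ + c) s)] at hmain
    calc _ ≤ K ^ 4 * (K ^ d * (4 * (Cm * a ^ 2 * ρ s) + 4 * (‖c‖ ^ 2 * (2 * japSq c) ^ q * ρ s)
          + (2 / K) ^ q * (4 * (Cc * μ ^ 2) + 8 * L ^ 2 * M))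
          + 8 * L ^ 2 * (K⁻¹) ^ 4 * M + (8 * η ^ 2 + 4 * e ^ 2) * W) := by
            refine mul_le_mul_of_nonneg_left (hmain.trans ?_) (by positivity)
            rw [← hd, ← hq, ← hM, ← hW]
            rw [← hq] at hsh
            gcongr
      _ = α * ρ s + γ := by
            rw [hα, hγ]
            field_simp
            ring
  have hρg := growth_wt_mul hD.growth_r.sq (by norm_num)
  have hρc : ContinuousOn ρ (Icc (-1) 0) := hρg.continuousOn_integral le_rfl
  have hρ0 : ∀ s, 0 ≤ ρ s := fun s => integral_nonneg fun p => mul_nonneg (wt_pos p).le (sq_nonneg _)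
  have hρi : IntervalIntegrable (fun t => ρ ((K⁻¹) ^ 2 * t)) volume (-1) 0 := by
    refine ContinuousOn.intervalIntegrable ?_
    rw [uIcc_of_le (by norm_num)]
    refine hρc.comp (by fun_prop) fun t ht => ?_
    obtain ⟨h1, -⟩ := htime t ht
    exact ⟨by linarith [h1.1], h1.2⟩
  have h1 : (D.rescale K⁻¹ (by positivity) c l₀).energy ≤
      ∫ t in (-1 : ℝ)..0, (α * ρ ((K⁻¹) ^ 2 * t) + γ) := by
    rw [energy, intervalIntegral.integral_of_le (by norm_num),
      intervalIntegral.integral_of_le (by norm_num)]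
    refine integral_mono_of_nonneg (Filter.Eventually.of_forall fun t => integral_nonneg fun p =>
      mul_nonneg (wt_pos p).le (sq_nonneg _)) ?_ ?_
    · exact ((hρi.const_mul α).add (by simp : IntervalIntegrable (fun _ => γ) volume (-1) 0)).1
    · exact (ae_restrict_iff' measurableSet_Ioc).2 (ae_of_all _ fun t ht => key t (Ioc_subset_Icc_self ht))
  have h2 : ∫ t in (-1 : ℝ)..0, ρ ((K⁻¹) ^ 2 * t) ≤ K ^ 2 * (Cc * μ ^ 2) := by
    rw [intervalIntegral.integral_comp_mul_left _ (by positivity), inv_pow, inv_inv, smul_eq_mul]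
    refine mul_le_mul_of_nonneg_left ?_ (by positivity)
    refine le_trans ?_ (hgrad.trans (mul_le_mul_of_nonneg_left hE hCc))
    rw [inv_pow] at hKi2
    refine intervalIntegral.integral_mono_interval (by linarith) (by simp; positivity) (by simp)
      (Filter.Eventually.of_forall hρ0) ?_
    exact hρg.intervalIntegrable le_rfl (by norm_num) (by norm_num)
  rw [intervalIntegral.integral_add (hρi.const_mul α) (by simp), intervalIntegral.integral_const_mul,
    intervalIntegral.integral_const] at h1
  have hJ : japSq c ≤ 1 + L ^ 2 := by unfold japSq; gcongr
  have h3 : α * (K ^ 2 * (Cc * μ ^ 2)) ≤ (1 / 16 + K ^ (d + 6) * Cc * (4 * (C * μ) ^ 2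
      * (2 * (1 + (C * μ) ^ 2)) ^ q)) * μ ^ 2 := by
    calc α * (K ^ 2 * (Cc * μ ^ 2)) = (K ^ (d + 6) * Cc * (4 * Cm * a ^ 2)
          + K ^ (d + 6) * Cc * (4 * ‖c‖ ^ 2 * (2 * japSq c) ^ q)) * μ ^ 2 := by rw [hα]; ring
      _ ≤ _ := by
        refine mul_le_mul_of_nonneg_right (add_le_add haK ?_) (by positivity)
        gcongr
  have h4 : K ^ (d + 4) * (2 / K) ^ q ≤ 2 ^ q := by
    rw [div_pow, mul_div_assoc', div_le_iff₀ (by positivity), mul_comm]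
    gcongr
    linarith
  have h5 : K ^ (d + 4) * (2 / K) ^ q * (4 * (Cc * μ ^ 2) + 8 * L ^ 2 * M) + 8 * L ^ 2 * M
      ≤ H * μ ^ 2 := by
    calc _ ≤ 2 ^ q * (4 * (Cc * μ ^ 2) + 8 * L ^ 2 * M) + 8 * L ^ 2 * M := by gcongr
      _ = _ := by rw [hH, hL]; ring
  have he' : e ≤ C * μ * (δ + C * μ) := by rw [he]; gcongr
  have h6 : K ^ 4 * (8 * η ^ 2 + 4 * e ^ 2) * W ≤ K ^ 4 * (8 * (C' * (δ + √μ + μ)) ^ 2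
      + 4 * (C * (δ + C * μ)) ^ 2) * W * μ ^ 2 := by
    calc _ ≤ K ^ 4 * (8 * η ^ 2 + 4 * (C * μ * (δ + C * μ)) ^ 2) * W := by gcongr
      _ = _ := by rw [hη]; ring
  have h7 : (D.rescale K⁻¹ (by positivity) c l₀).energy ≤ (1 / 16 + F δ μ + H) * μ ^ 2 := by
    have := mul_le_mul_of_nonneg_left h2 hα0
    simp only [hF, sub_neg_eq_add, zero_add, one_smul] at h1 ⊢
    rw [hγ] at h1
    linarith
  refine h7.trans (mul_le_mul_of_nonneg_right ?_ (by positivity))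
  linarith

end LegendreFlow

end PMA

namespace PMA

/-! ### Rigidity by iteration over scales -/

section Rigidity

variable {E : Type*} [NormedAddCommGroup E] [InnerProductSpace ℝ E] [FiniteDimensional ℝ E]
  [MeasurableSpace E] [BorelSpace E]

omit [InnerProductSpace ℝ E] [FiniteDimensional ℝ E] [MeasurableSpace E] [BorelSpace E] in
variable (E) in
/-- The infimum of the weight over the unit ball. -/
def wtMin [Module ℝ E] : ℝ := ((2 : ℝ) ^ wtExp E)⁻¹

omit [FiniteDimensional ℝ E] [MeasurableSpace E] [BorelSpace E] in
lemma wtMin_le {p : E} (hp : ‖p‖ ≤ 1) : wtMin E ≤ wt p := by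
  unfold wtMin wt
  have := japSq_pos p
  gcongr
  unfold japSq
  nlinarith [norm_nonneg p]

/-- A function with a large directional derivative has a large weighted norm. -/
lemma le_integral_wt_mul_sq {φ : E → ℝ} {F : E → E} (hφ : ∀ p, HasGradientAt φ (F p) p)
    (hint : Integrable fun p => wt p * φ p ^ 2) {e : E} (he : ‖e‖ = 1) {a : ℝ} (ha : 0 ≤ a)
    (h : ∀ p, ‖p‖ ≤ 1 → a ≤ inner ℝ (F p) e) :
    volume.real (Metric.ball (0 : E) (1 / 2)) * (wtMin E * (a / 2) ^ 2)
      ≤ 4 * ∫ p, wt p * φ p ^ 2 := by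
  have hmono : ∀ p : E, ‖p‖ ≤ 1 / 2 → a / 2 ≤ φ (p + (1 / 2 : ℝ) • e) - φ p := by
    intro p hp
    have hd : ∀ s : ℝ, HasDerivAt (fun s : ℝ => φ (p + s • e)) (inner ℝ (F (p + s • e)) e) s := by
      intro s
      have h1 : HasDerivAt (fun s : ℝ => p + s • e) e s := by
        simpa using ((hasDerivAt_id s).smul_const e).const_add p
      exact (hφ (p + s • e)).hasFDerivAt.comp_hasDerivAt s h1
    have h2 := (convex_Icc (0 : ℝ) (1 / 2)).mul_sub_le_image_sub_of_le_deriv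
      (f := fun s : ℝ => φ (p + s • e)) (C := a)
      (fun s _ => (hd s).continuousAt.continuousWithinAt)
      (fun s _ => (hd s).differentiableAt.differentiableWithinAt)
      (fun s hs => by
        rw [(hd s).deriv]
        apply h
        rw [interior_Icc] at hs
        refine (norm_add_le _ _).trans ?_
        rw [norm_smul, he, Real.norm_of_nonneg hs.1.le]
        linarith [hs.2])
      0 (by norm_num) (1 / 2) (by norm_num) (by norm_num)
    simp only [zero_smul, add_zero] at h2
    linarith
  have hint2 : Integrable fun p => wt (p + (1 / 2 : ℝ) • e) * φ (p + (1 / 2 : ℝ) • e) ^ 2 :=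
    hint.comp_add_right _
  have hsum : Integrable fun p => 2 * (wt (p + (1 / 2 : ℝ) • e) * φ (p + (1 / 2 : ℝ) • e) ^ 2
      + wt p * φ p ^ 2) := (hint2.add hint).const_mul 2
  have hpt : ∀ p ∈ Metric.ball (0 : E) (1 / 2), wtMin E * (a / 2) ^ 2 ≤
      2 * (wt (p + (1 / 2 : ℝ) • e) * φ (p + (1 / 2 : ℝ) • e) ^ 2 + wt p * φ p ^ 2) := by
    intro p hp
    have hp' : ‖p‖ ≤ 1 / 2 := (mem_ball_zero_iff.1 hp).le
    have h1 := hmono p hp'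
    have h2 : wtMin E ≤ wt p := wtMin_le (by linarith)
    have h3 : wtMin E ≤ wt (p + (1 / 2 : ℝ) • e) := by
      refine wtMin_le ((norm_add_le _ _).trans ?_)
      rw [norm_smul, he]; norm_num; linarith
    have h4 : (a / 2) ^ 2 ≤ 2 * (φ (p + (1 / 2 : ℝ) • e) ^ 2 + φ p ^ 2) := by
      have h5 : (a / 2) ^ 2 ≤ (φ (p + (1 / 2 : ℝ) • e) - φ p) ^ 2 := by gcongr
      nlinarith [sq_nonneg (φ (p + (1 / 2 : ℝ) • e) + φ p)]
    have h0 : 0 ≤ wtMin E := by unfold wtMin; positivity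
    calc wtMin E * (a / 2) ^ 2 ≤ wtMin E * (2 * (φ (p + (1 / 2 : ℝ) • e) ^ 2 + φ p ^ 2)) := by gcongr
      _ = 2 * (wtMin E * φ (p + (1 / 2 : ℝ) • e) ^ 2 + wtMin E * φ p ^ 2) := by ring
      _ ≤ _ := by gcongr
  calc _ = ∫ _ in Metric.ball (0 : E) (1 / 2), wtMin E * (a / 2) ^ 2 := by
        rw [setIntegral_const, smul_eq_mul]
    _ ≤ ∫ p in Metric.ball (0 : E) (1 / 2), 2 * (wt (p + (1 / 2 : ℝ) • e)
          * φ (p + (1 / 2 : ℝ) • e) ^ 2 + wt p * φ p ^ 2) :=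
        setIntegral_mono_on (integrableOn_const (by finiteness)) hsum.integrableOn
          measurableSet_ball hpt
    _ ≤ ∫ p, 2 * (wt (p + (1 / 2 : ℝ) • e) * φ (p + (1 / 2 : ℝ) • e) ^ 2 + wt p * φ p ^ 2) :=
        setIntegral_le_integral hsum (Filter.Eventually.of_forall fun p => by
          have := (wt_pos p).le
          have := (wt_pos (p + (1 / 2 : ℝ) • e)).le
          positivity)
    _ = 4 * ∫ p, wt p * φ p ^ 2 := by
        rw [integral_const_mul, integral_add hint2 hint,
          integral_add_right_eq_self (fun p => wt p * φ p ^ 2)]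
        ring

namespace LegendreFlow

variable {c₀ m₁ m₂ : ℝ} (D : LegendreFlow E c₀ m₁ m₂)

/-- Quantitative closeness of a flow to the heat flow of a quadratic polynomial at large scales. -/
structure Asymptotic (C₁ C₂ C₃ β : ℝ) : Prop where
  Y_near : ∀ p, ‖D.Y p - p‖ ≤ C₁
  X_near : ∀ p, ∀ s, 0 ≤ s → ∀ t ∈ Icc (-s ^ 2) 0, ‖D.X p t - p‖ ≤ 1 / 200 * (‖p‖ + s) + C₂
  k_le : ∀ R, 1 ≤ R → ∀ p, ∀ t ∈ Icc (-1 : ℝ) 0,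
    |D.k (R • p) (R ^ 2 * t)| ≤ C₃ * R ^ (2 - β) * japSq p

namespace Asymptotic

variable {D} {C₁ C₂ C₃ β : ℝ} (hD : D.Asymptotic C₁ C₂ C₃ β)
include hD

lemma C₁_nonneg : 0 ≤ C₁ := (norm_nonneg _).trans (hD.Y_near 0)

lemma C₂_nonneg : 0 ≤ C₂ := by
  simpa using (norm_nonneg _).trans (hD.X_near 0 0 le_rfl 0 (by simp))

lemma C₃_nonneg : 0 ≤ C₃ := by
  simpa [japSq] using (abs_nonneg _).trans (hD.k_le 1 le_rfl 0 0 (by simp))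

lemma rescale_X_near {R : ℝ} (hR : 0 < R) (c : E) (d : ℝ) (p : E) {t : ℝ}
    (ht : t ∈ Icc (-1 : ℝ) 0) :
    ‖(D.rescale R hR c d).X p t - p - R⁻¹ • c‖ ≤
      1 / 200 * (‖p‖ + R⁻¹ * ‖c‖ + 1) + R⁻¹ * C₂ := by
  have h1 := hD.X_near (R • p + c) R hR.le (R ^ 2 * t) (by
    have := sq_pos_of_pos hR
    constructor <;> nlinarith [ht.1, ht.2])
  have h2 : (D.rescale R hR c d).X p t - p - R⁻¹ • c =
      R⁻¹ • (D.X (R • p + c) (R ^ 2 * t) - (R • p + c)) := by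
    simp only [rescale, smul_sub, smul_add, smul_smul, inv_mul_cancel₀ hR.ne', one_smul]
    abel
  rw [h2, norm_smul, Real.norm_of_nonneg (inv_pos.2 hR).le]
  have h3 : ‖R • p + c‖ ≤ R * ‖p‖ + ‖c‖ := by
    refine (norm_add_le _ _).trans ?_
    rw [norm_smul, Real.norm_of_nonneg hR.le]
  calc _ ≤ R⁻¹ * (1 / 200 * (R * ‖p‖ + ‖c‖ + R) + C₂) := by gcongr; linarith
    _ = _ := by field_simp

lemma rescale_Y_near {R : ℝ} (hR : 0 < R) (c : E) (d : ℝ) (p : E) :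
    ‖(D.rescale R hR c d).Y p - p‖ ≤ C₁ / R := by
  have h2 : (D.rescale R hR c d).Y p - p = R⁻¹ • (D.Y (R • p) - R • p) := by
    simp only [rescale, smul_sub, smul_smul, inv_mul_cancel₀ hR.ne', one_smul]
  rw [h2, norm_smul, Real.norm_of_nonneg (inv_pos.2 hR).le, div_eq_inv_mul]
  gcongr
  exact hD.Y_near _

lemma near_rescale {R : ℝ} (hR : 0 < R) {c : E} (hc : ‖c‖ ≤ R / 10) (d : ℝ)
    (h1 : C₁ / R ≤ 1 / 4) (h2 : C₂ / R ≤ 1 / 100) : (D.rescale R hR c d).Near (C₁ / R) := by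
  refine ⟨hD.rescale_Y_near hR c d, h1, fun p t ht => ?_⟩
  have h3 := hD.rescale_X_near hR c d p ht
  have h4 : R⁻¹ * ‖c‖ ≤ 1 / 10 := by rw [inv_mul_le_iff₀ hR]; linarith
  have h5 : ‖(D.rescale R hR c d).X p t - p‖ ≤
      ‖(D.rescale R hR c d).X p t - p - R⁻¹ • c‖ + ‖R⁻¹ • c‖ := by
    simpa using norm_add_le ((D.rescale R hR c d).X p t - p - R⁻¹ • c) (R⁻¹ • c)
  rw [norm_smul, Real.norm_of_nonneg (inv_pos.2 hR).le] at h5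
  rw [div_eq_inv_mul] at h2
  have := norm_nonneg p
  linarith

lemma growth_rescale_k {R : ℝ} (hR : 0 < R) (c : E) (d : ℝ) : Growth 1 (D.rescale R hR c d).k := by
  refine Near.growth_of_gradient (cont_k _) (gradk _)
    (C := 1 + R⁻¹ * ‖c‖ + R⁻¹ * ‖c‖ + R⁻¹ * C₂ + C₁ / R) fun p t ht => ?_
  have h1 := hD.rescale_X_near hR c d p ht
  have h2 := hD.rescale_Y_near hR c d p
  have h3 : (D.rescale R hR c d).r p t = ((D.rescale R hR c d).X p t - p - R⁻¹ • c) + R⁻¹ • c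
      - ((D.rescale R hR c d).Y p - p) := by simp only [r]; abel
  have h4 : ‖R⁻¹ • c‖ = R⁻¹ * ‖c‖ := by
    rw [norm_smul, Real.norm_of_nonneg (inv_pos.2 hR).le]
  have h5 : ‖(D.rescale R hR c d).r p t‖ ≤ ‖(D.rescale R hR c d).X p t - p - R⁻¹ • c‖ + ‖R⁻¹ • c‖
      + ‖(D.rescale R hR c d).Y p - p‖ := by
    rw [h3]
    refine (norm_sub_le _ _).trans ?_
    gcongr
    exact norm_add_le _ _
  have h6 : 0 ≤ R⁻¹ * ‖c‖ := by positivity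
  have h7 : 0 ≤ R⁻¹ * C₂ := mul_nonneg (inv_pos.2 hR).le hD.C₂_nonneg
  have h8 : 0 ≤ C₁ / R := div_nonneg hD.C₁_nonneg hR.le
  have h9 := norm_nonneg p
  have h10 : 0 ≤ (R⁻¹ * ‖c‖ + R⁻¹ * ‖c‖ + R⁻¹ * C₂ + C₁ / R) * ‖p‖ := by positivity
  rw [h4] at h5
  linarith

lemma growth_energy {R : ℝ} (hR : 0 < R) (c : E) (d : ℝ) :
    Growth (-(Module.finrank ℝ E + 1 : ℤ)) fun p t => wt p * (D.rescale R hR c d).k p t ^ 2 :=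
  growth_wt_mul (hD.growth_rescale_k hR c d).sq (by norm_num)

lemma energy_zero_le {R : ℝ} (hR : 1 ≤ R) :
    (D.rescale R (by positivity) 0 0).energy ≤ (C₃ * √(wtMoment E) * R ^ (-β)) ^ 2 := by
  have hR0 : 0 < R := by positivity
  have g := hD.growth_energy hR0 0 0
  have h1 : ∀ t ∈ Icc (-1 : ℝ) 0, ∫ p, wt p * (D.rescale R hR0 0 0).k p t ^ 2 ≤
      (C₃ * √(wtMoment E) * R ^ (-β)) ^ 2 := by
    intro t ht
    calc _ ≤ ∫ p : E, (C₃ * R ^ (-β)) ^ 2 * (wt p * japSq p ^ 2) := by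
          refine integral_mono (g.integrable le_rfl ht)
            (integrable_wt_mul_japSq_sq.const_mul _) fun p => ?_
          have h2 := hD.k_le R hR p t ht
          have h3 : |(D.rescale R hR0 0 0).k p t| ≤ C₃ * R ^ (-β) * japSq p := by
            rw [rescale_k]
            simp only [k, add_zero, sub_zero] at h2 ⊢
            rw [abs_div, abs_of_pos (by positivity : 0 < R ^ 2), div_le_iff₀ (by positivity)]
            refine h2.trans (le_of_eq ?_)
            rw [sub_eq_add_neg, Real.rpow_add hR0, Real.rpow_two]
            ring
          have h4 : (D.rescale R hR0 0 0).k p t ^ 2 ≤ (C₃ * R ^ (-β) * japSq p) ^ 2 := by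
            rw [← sq_abs]; gcongr
          have := (wt_pos p).le
          calc _ ≤ wt p * (C₃ * R ^ (-β) * japSq p) ^ 2 := by gcongr
            _ = _ := by ring
      _ = _ := by
          rw [integral_const_mul, ← wtMoment, mul_pow, mul_pow, mul_pow,
            Real.sq_sqrt wtMoment_nonneg]
          ring
  calc _ ≤ ∫ _ in (-1 : ℝ)..0, (C₃ * √(wtMoment E) * R ^ (-β)) ^ 2 :=
        intervalIntegral.integral_mono_on (by norm_num)
          (g.intervalIntegrable le_rfl (by simp) (by simp)) (by simp) h1
    _ = _ := by simp

end Asymptotic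

end LegendreFlow

end Rigidity

end PMA

namespace PMA

section Rigidity

variable {E : Type*} [NormedAddCommGroup E] [InnerProductSpace ℝ E] [FiniteDimensional ℝ E]
  [MeasurableSpace E] [BorelSpace E]

open Filter Topology

namespace LegendreFlow

variable {c₀ m₁ m₂ : ℝ}

namespace Asymptotic

variable {D : LegendreFlow E c₀ m₁ m₂} {C₁ C₂ C₃ β : ℝ} (hD : D.Asymptotic C₁ C₂ C₃ β)
include hD

/-- The linear part of a good affine correction is controlled by the energies. -/
lemma norm_le_of_energy_le {R : ℝ} (hR : 0 < R) (h2 : C₂ / R ≤ 1 / 100) {c : E} {d μ : ℝ}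
    (hμ : 16 * μ ^ 2 < volume.real (Metric.ball (0 : E) (1 / 2)) * (wtMin E * (1 / 40) ^ 2))
    (he : (D.rescale R hR c d).energy ≤ μ ^ 2) (he0 : (D.rescale R hR 0 0).energy ≤ μ ^ 2) :
    ‖c‖ ≤ R / 10 := by
  by_contra hc
  push Not at hc
  have hc0 : 0 < ‖c‖ := by linarith
  set D₁ := D.rescale R hR c d with hD₁
  set D₀ := D.rescale R hR 0 0 with hD₀
  have g₁ := hD.growth_energy hR c d
  have g₀ := hD.growth_energy hR 0 0
  have gd : Growth (-(Module.finrank ℝ E + 1 : ℤ)) fun p t => wt p * (D₁.k p t - D₀.k p t) ^ 2 :=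
    growth_wt_mul ((hD.growth_rescale_k hR c d).sub (hD.growth_rescale_k hR 0 0)).sq (by norm_num)
  have hslice : ∀ t ∈ Icc (-1 : ℝ) 0,
      volume.real (Metric.ball (0 : E) (1 / 2)) * (wtMin E * (1 / 40) ^ 2) ≤
        8 * ((∫ p, wt p * D₁.k p t ^ 2) + ∫ p, wt p * D₀.k p t ^ 2) := by
    intro t ht
    have hgrad : ∀ p, HasGradientAt (fun p => D₁.k p t - D₀.k p t) (D₁.r p t - D₀.r p t) p := by
      intro p
      rw [hasGradientAt_iff_hasFDerivAt, map_sub]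
      exact (D₁.gradk p t).hasFDerivAt.sub (D₀.gradk p t).hasFDerivAt
    have h := le_integral_wt_mul_sq hgrad (gd.integrable le_rfl ht)
      (e := ‖c‖⁻¹ • c) (by rw [norm_smul, norm_inv, norm_norm, inv_mul_cancel₀ hc0.ne'])
      (a := 1 / 20) (by norm_num) fun p hp => by
        have e1 := hD.rescale_X_near hR c d p ht
        have e0 := hD.rescale_X_near hR 0 0 p ht
        rw [← hD₁] at e1
        rw [← hD₀] at e0
        simp only [smul_zero, sub_zero, norm_zero, mul_zero, add_zero] at e0
        have hY : D₁.Y p = D₀.Y p := rfl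
        set a₁ := D₁.X p t - p - R⁻¹ • c
        set a₀ := D₀.X p t - p
        have e2 : D₁.r p t - D₀.r p t = R⁻¹ • c + (a₁ - a₀) := by
          simp only [r, hY, a₁, a₀]; abel
        have e3 : inner ℝ (R⁻¹ • c) (‖c‖⁻¹ • c) = R⁻¹ * ‖c‖ := by
          rw [inner_smul_left, inner_smul_right, real_inner_self_eq_norm_sq]
          simp only [RCLike.conj_to_real]
          field_simp
        have e4 : |inner ℝ (a₁ - a₀) (‖c‖⁻¹ • c)| ≤ ‖a₁‖ + ‖a₀‖ := by
          refine (abs_real_inner_le_norm _ _).trans ?_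
          rw [norm_smul, norm_inv, norm_norm, inv_mul_cancel₀ hc0.ne', mul_one]
          exact norm_sub_le _ _
        have e5 := (abs_le.1 e4).1
        have e6 : 1 / 10 < R⁻¹ * ‖c‖ := by
          rw [lt_inv_mul_iff₀ hR]; linarith
        rw [div_eq_inv_mul] at h2
        rw [e2, inner_add_left, e3]
        linarith
    refine le_trans (le_of_eq (by norm_num)) (h.trans ?_)
    have i1 : Integrable fun p => wt p * D₁.k p t ^ 2 := g₁.integrable le_rfl ht
    have i0 : Integrable fun p => wt p * D₀.k p t ^ 2 := g₀.integrable le_rfl ht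
    have : ∫ p, wt p * (D₁.k p t - D₀.k p t) ^ 2 ≤
        ∫ p, 2 * (wt p * D₁.k p t ^ 2 + wt p * D₀.k p t ^ 2) := by
      refine integral_mono (gd.integrable le_rfl ht) ((i1.add i0).const_mul 2) fun p => ?_
      have h3 : (D₁.k p t - D₀.k p t) ^ 2 ≤ 2 * (D₁.k p t ^ 2 + D₀.k p t ^ 2) := by
        nlinarith [sq_nonneg (D₁.k p t + D₀.k p t)]
      have := (wt_pos p).le
      calc _ ≤ wt p * (2 * (D₁.k p t ^ 2 + D₀.k p t ^ 2)) := by gcongr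
        _ = _ := by ring
    rw [integral_const_mul, integral_add i1 i0] at this
    linarith
  have hI₁ := g₁.intervalIntegrable le_rfl (a := -1) (b := 0) (by simp) (by simp)
  have hI₀ := g₀.intervalIntegrable le_rfl (a := -1) (b := 0) (by simp) (by simp)
  have := intervalIntegral.integral_mono_on (a := -1) (b := 0) (by norm_num) (by simp)
    ((hI₁.add hI₀).const_mul 8) hslice
  have hsum : ∫ t in (-1 : ℝ)..0, 8 * ((∫ p, wt p * D₁.k p t ^ 2) + ∫ p, wt p * D₀.k p t ^ 2) =
      8 * (D₁.energy + D₀.energy) := by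
    rw [intervalIntegral.integral_const_mul, intervalIntegral.integral_add hI₁ hI₀]
    rfl
  rw [hsum, intervalIntegral.integral_const] at this
  simp only [sub_neg_eq_add, zero_add, one_smul] at this
  linarith

/-- Affine corrections whose energies tend to zero yield an exact affine correction. -/
lemma exists_rescale_k_eq_zero {R : ℝ} (hR : 0 < R) {c : ℕ → E} {d : ℕ → ℝ} {B : ℝ}
    (hc : ∀ j, ‖c j‖ ≤ B)
    (he : Tendsto (fun j => (D.rescale R hR (c j) (d j)).energy) atTop (𝓝 0)) :
    ∃ c d, ∀ p, ∀ t ∈ Icc (-1 : ℝ) 0, (D.rescale R hR c d).k p t = 0 := by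
  set μ : Measure (E × ℝ) := (volume : Measure E).prod (volume.restrict (Ioc (-1 : ℝ) 0)) with hμ
  set f : ℕ → E × ℝ → ℝ := fun j z => wt z.1 * (D.rescale R hR (c j) (d j)).k z.1 z.2 ^ 2 with hf
  have hfint : ∀ j, Integrable (f j) μ := fun j =>
    (hD.growth_energy hR (c j) (d j)).integrable_prod le_rfl le_rfl le_rfl
  have hf0 : ∀ j z, 0 ≤ f j z := fun j z => mul_nonneg (wt_pos _).le (sq_nonneg _)
  have hmeas : TendstoInMeasure μ f atTop (fun _ => (0 : ℝ)) := by
    refine tendstoInMeasure_of_tendsto_eLpNorm one_ne_zero (fun j => (hfint j).aestronglyMeasurable)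
      aestronglyMeasurable_const ?_
    have : ∀ j, eLpNorm (f j - fun _ => (0 : ℝ)) 1 μ =
        ENNReal.ofReal (D.rescale R hR (c j) (d j)).energy := by
      intro j
      have e1 : (f j - fun _ => (0 : ℝ)) = f j := by ext; simp
      rw [e1, eLpNorm_one_eq_lintegral_enorm, ← ofReal_integral_norm_eq_lintegral_enorm (hfint j)]
      congr 1
      simp_rw [Real.norm_of_nonneg (hf0 j _)]
      rw [integral_prod_symm _ (hfint j), energy, intervalIntegral.integral_of_le (by norm_num)]
    simp_rw [this]
    simpa using ENNReal.tendsto_ofReal he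
  obtain ⟨ns, hns, hae⟩ := hmeas.exists_seq_tendsto_ae
  obtain ⟨c', -, φ, hφ, hc'⟩ := (isCompact_closedBall (0 : E) B).tendsto_subseq
    (x := c ∘ ns) (fun j => by simpa using hc (ns j))
  have hae' : ∀ᵐ z ∂μ, Tendsto (fun i => (D.rescale R hR (c (ns (φ i))) (d (ns (φ i)))).k z.1 z.2)
      atTop (𝓝 0) := by
    filter_upwards [hae] with z hz
    have h1 := (hz.comp hφ.tendsto_atTop).const_mul (wt z.1)⁻¹
    have h2 : Tendsto (fun i => (D.rescale R hR (c (ns (φ i))) (d (ns (φ i)))).k z.1 z.2 ^ 2)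
        atTop (𝓝 0) := by
      rw [mul_zero] at h1
      refine h1.congr fun i => ?_
      simp only [hf, Function.comp]
      rw [← mul_assoc, inv_mul_cancel₀ (wt_pos z.1).ne', one_mul]
    have h3 := h2.sqrt
    rw [Real.sqrt_zero] at h3
    simp_rw [Real.sqrt_sq_eq_abs] at h3
    exact (tendsto_zero_iff_abs_tendsto_zero _).2 h3
  have hμ' : μ = ((volume : Measure E).prod (volume : Measure ℝ)).restrict
      (univ ×ˢ Ioc (-1 : ℝ) 0) := by
    rw [← Measure.prod_restrict, Measure.restrict_univ]
  have hμ0 : μ ≠ 0 := by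
    rw [hμ', Ne, Measure.restrict_eq_zero, Measure.prod_prod]
    have : (volume : Measure E) univ ≠ 0 := (isOpen_univ.measure_pos volume univ_nonempty).ne'
    simp only [Real.volume_Ioc, mul_eq_zero, this, false_or]
    norm_num
  have : (ae μ).NeBot := ae_neBot.2 hμ0
  obtain ⟨z₀, hz₀⟩ := hae'.exists
  have hv : ∀ z : E × ℝ, Tendsto (fun i => D.v (R • z.1 + c (ns (φ i))) (R ^ 2 * z.2)) atTop
      (𝓝 (D.v (R • z.1 + c') (R ^ 2 * z.2))) := by
    intro z
    have h1 : Continuous fun q : E => D.v (R • z.1 + q) (R ^ 2 * z.2) :=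
      D.cont_v.comp (f := fun q : E => (R • z.1 + q, R ^ 2 * z.2)) (by fun_prop)
    exact (h1.tendsto c').comp hc'
  obtain ⟨d', hd'⟩ : ∃ d', Tendsto (fun i => d (ns (φ i))) atTop (𝓝 d') := by
    refine ⟨_, ((((hv z₀).sub_const (D.V (R • z₀.1))).sub_const (D.G (R ^ 2 * z₀.2))).sub
      (hz₀.mul_const (R ^ 2))).congr fun i => ?_⟩
    rw [rescale_k]
    field_simp
    ring
  have hzero : ∀ᵐ z ∂μ, (D.rescale R hR c' d').k z.1 z.2 = 0 := by
    filter_upwards [hae'] with z hz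
    refine tendsto_nhds_unique ?_ hz
    simp_rw [rescale_k]
    exact ((((hv z).sub hd').sub_const _).sub_const _).div_const _
  refine ⟨c', d', ?_⟩
  have hopen : EqOn (fun z : E × ℝ => (D.rescale R hR c' d').k z.1 z.2) (fun _ => 0)
      (univ ×ˢ Ioo (-1 : ℝ) 0) := by
    refine Measure.eqOn_open_of_ae_eq (μ := (volume : Measure E).prod (volume : Measure ℝ)) ?_
      (isOpen_univ.prod isOpen_Ioo) (cont_k _).continuousOn continuousOn_const
    rw [hμ'] at hzero
    exact ae_restrict_of_ae_restrict_of_subset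
      (prod_mono_right Ioo_subset_Ioc_self) hzero
  intro p t ht
  have hcl := hopen.closure (cont_k _) continuous_const
  refine hcl (x := (p, t)) ?_
  rw [closure_prod_eq, closure_univ, closure_Ioo (by norm_num)]
  exact ⟨mem_univ _, ht⟩

/-- At every large scale, an exact affine correction exists. -/
lemma exists_affine (hc₀ : 0 < c₀) (hm₁ : 0 < m₁) (hm₂ : 0 < m₂) (hβ : 0 < β) :
    ∃ R₀ : ℝ, 1 ≤ R₀ ∧ ∀ R, R₀ ≤ R → ∃ (c : E) (d : ℝ), ∀ p, ∀ t ∈ Icc (-R ^ 2) 0,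
      D.v (p + c) t = D.V p + D.G t + d := by
  obtain ⟨K, hK, y₀, hy₀, hstep⟩ := exists_one_step (E := E) hc₀ hm₁ hm₂ hβ
  set S := C₃ * √(wtMoment E) + 1 with hS
  have hS0 : 0 < S := by
    have := hD.C₃_nonneg
    positivity
  set b := volume.real (Metric.ball (0 : E) (1 / 2)) * (wtMin E * (1 / 40) ^ 2) with hb
  have hb0 : 0 < b := by
    have h1 : 0 < volume.real (Metric.ball (0 : E) (1 / 2)) :=
      ENNReal.toReal_pos (Metric.measure_ball_pos _ _ (by norm_num)).ne' (by finiteness)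
    have h2 : 0 < wtMin E := by unfold wtMin; positivity
    positivity
  have t1 : Tendsto (fun R : ℝ => S * R ^ (-β)) atTop (𝓝 0) := by
    simpa using (tendsto_rpow_neg_atTop hβ).const_mul S
  have t2 : Tendsto (fun R : ℝ => 16 * (S * R ^ (-β)) ^ 2) atTop (𝓝 0) := by
    simpa using (t1.pow 2).const_mul 16
  have t3 : Tendsto (fun R : ℝ => C₁ / R) atTop (𝓝 0) := tendsto_const_nhds.div_atTop tendsto_id
  have t4 : Tendsto (fun R : ℝ => C₂ / R) atTop (𝓝 0) := tendsto_const_nhds.div_atTop tendsto_id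
  obtain ⟨R₁, hR₁⟩ := eventually_atTop.1 (((t1.eventually_le_const hy₀).and
    (t2.eventually_lt_const hb0)).and (((t3.eventually_le_const hy₀).and
    (t3.eventually_le_const (by norm_num : (0 : ℝ) < 1 / 4))).and
    (t4.eventually_le_const (by norm_num : (0 : ℝ) < 1 / 100))))
  set R₀ := max R₁ 1 with hR₀
  have hsmall : ∀ R, R₀ ≤ R → ∀ μ, 0 ≤ μ → μ ≤ S * R ^ (-β) → ∀ hR : 0 < R, ∀ c d,
      (D.rescale R hR c d).energy ≤ μ ^ 2 → ‖c‖ ≤ R / 10 := by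
    intro R hRR μ hμ0 hμ hR c d he
    obtain ⟨⟨h1, h2⟩, ⟨h3, h4⟩, h5⟩ := hR₁ R ((le_max_left _ _).trans hRR)
    have h1R : 1 ≤ R := (le_max_right _ _).trans hRR
    refine hD.norm_le_of_energy_le hR h5 h2 (he.trans (by gcongr)) ((hD.energy_zero_le h1R).trans ?_)
    have := hD.C₃_nonneg
    have : 0 ≤ R ^ (-β) := by positivity
    gcongr
    linarith
  have hiter : ∀ j : ℕ, ∀ R, R₀ ≤ R → ∀ hR : 0 < R, ∃ c d,
      (D.rescale R hR c d).energy ≤ (S * R ^ (-β) * (1 / 2) ^ j) ^ 2 := by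
    intro j
    induction j with
    | zero =>
      intro R hRR hR
      have h1R : 1 ≤ R := (le_max_right _ _).trans hRR
      refine ⟨0, 0, (hD.energy_zero_le h1R).trans ?_⟩
      have := hD.C₃_nonneg
      have : 0 ≤ R ^ (-β) := by positivity
      rw [pow_zero, mul_one]
      gcongr
      linarith
    | succ j ih =>
      intro R hRR hR
      have hK0 : 0 < K := by linarith
      have hKR : R₀ ≤ K * R := by nlinarith
      have hKR0 : 0 < K * R := by positivity
      obtain ⟨c, d, hcd⟩ := ih (K * R) hKR hKR0
      obtain ⟨⟨h1, h2⟩, ⟨h3, h4⟩, h5⟩ := hR₁ (K * R) ((le_max_left _ _).trans hKR)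
      have hr0 : 0 < (K * R) ^ (-β) := by positivity
      have hμle : S * (K * R) ^ (-β) * (1 / 2) ^ j ≤ S * (K * R) ^ (-β) :=
        mul_le_of_le_one_right (by positivity) (pow_le_one₀ (by norm_num) (by norm_num))
      have hc := hsmall (K * R) hKR _ (by positivity) hμle hKR0 c d hcd
      obtain ⟨c', d', h⟩ := hstep _ _ (hD.near_rescale hKR0 hc d h4 h5) h3 _ (by positivity)
        (hμle.trans h1) hcd
      have e : K * R / K = R := by field_simp
      rw [energy_rescale_rescale D (K * R) K hKR0 hK0] at h
      simp only [e] at h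
      refine ⟨_, _, h.trans (le_of_eq ?_)⟩
      rw [Real.mul_rpow hK0.le hR.le, mul_pow, mul_pow, mul_pow, ← Real.rpow_natCast (K ^ (-β)),
        ← Real.rpow_mul hK0.le]
      have e2 : K ^ (2 * β) * K ^ (-β * (2 : ℕ)) = 1 := by
        rw [← Real.rpow_add hK0]
        have : 2 * β + -β * (2 : ℕ) = 0 := by push_cast; ring
        rw [this, Real.rpow_zero]
      calc _ = (K ^ (2 * β) * K ^ (-β * (2 : ℕ))) * (1 / 4 * S ^ 2 * (R ^ (-β)) ^ 2
            * ((1 / 2) ^ j) ^ 2) := by ring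
        _ = _ := by rw [e2]; ring
  refine ⟨R₀, le_max_right _ _, fun R hRR => ?_⟩
  have hR : 0 < R := by linarith [(le_max_right R₁ 1).trans hRR]
  choose c d hcd using fun j => hiter j R hRR hR
  have hr0 : 0 < R ^ (-β) := by positivity
  have hlim : Tendsto (fun j : ℕ => (S * R ^ (-β) * (1 / 2 : ℝ) ^ j) ^ 2) atTop (𝓝 0) := by
    simpa using ((tendsto_pow_atTop_nhds_zero_of_lt_one (by norm_num : (0 : ℝ) ≤ 1 / 2)
      (by norm_num)).const_mul (S * R ^ (-β))).pow 2
  obtain ⟨c', d', h⟩ := hD.exists_rescale_k_eq_zero hR (c := c) (d := d) (B := R / 10)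
    (fun j => hsmall R hRR _ (by positivity) (mul_le_of_le_one_right (by positivity)
      (pow_le_one₀ (by norm_num) (by norm_num))) hR _ _ (hcd j))
    (squeeze_zero (fun j => intervalIntegral.integral_nonneg (by norm_num) fun t _ =>
      integral_nonneg fun p => mul_nonneg (wt_pos p).le (sq_nonneg _)) hcd hlim)
  refine ⟨c', d', fun p t ht => ?_⟩
  have h1 := h (R⁻¹ • p) (t / R ^ 2) ⟨by rw [le_div_iff₀ (by positivity)]; linarith [ht.1],
    div_nonpos_of_nonpos_of_nonneg ht.2 (by positivity)⟩
  rw [rescale_k, smul_smul, mul_inv_cancel₀ hR.ne', one_smul, mul_div_cancel₀ _ (by positivity),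
    div_eq_zero_iff] at h1
  have := h1.resolve_right (by positivity)
  linarith

/-- Rigidity: an asymptotically flat flow is the stationary profile moving in time, up to an affine
function. -/
theorem exists_u_eq (hc₀ : 0 < c₀) (hm₁ : 0 < m₁) (hm₂ : 0 < m₂) (hβ : 0 < β) :
    ∃ (c : E) (d : ℝ), ∀ x, ∀ t ≤ 0, D.u x t = D.U x + inner ℝ c x - D.G t - d := by
  obtain ⟨R₀, hR₀, h⟩ := hD.exists_affine hc₀ hm₁ hm₂ hβ
  have hX : ∀ {c : E} {d t : ℝ}, (∀ p, D.v (p + c) t = D.V p + D.G t + d) →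
      ∀ p, D.X (p + c) t = D.Y p := by
    intro c d t hv p
    have h1 : HasGradientAt (fun q => D.v (q + c) t) (D.X (p + c) t) p := by
      rw [hasGradientAt_iff_hasFDerivAt]
      have := (D.gradv (p + c) t).hasFDerivAt.comp p ((hasFDerivAt_id p).add_const c)
      exact this
    have h2 : HasGradientAt (fun q => D.v (q + c) t) (D.Y p) p := by
      simp_rw [hv]
      rw [hasGradientAt_iff_hasFDerivAt]
      exact ((D.gradV p).hasFDerivAt.add_const _).add_const _
    exact h1.unique h2
  obtain ⟨c, d, hcd⟩ := h R₀ le_rfl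
  have hmem : ∀ R : ℝ, (0 : ℝ) ∈ Icc (-R ^ 2) 0 := fun R => ⟨by nlinarith, le_rfl⟩
  have hall : ∀ t ≤ 0, ∀ p, D.v (p + c) t = D.V p + D.G t + d := by
    intro t ht
    obtain ⟨c', d', hcd'⟩ := h (R₀ + -t) (by linarith)
    have hc : c' = c := by
      have e1 := hX (fun p => hcd p 0 (hmem _)) (-c)
      have e2 := hX (fun p => hcd' p 0 (hmem _)) (-c')
      rw [neg_add_cancel] at e1 e2
      have := congrArg D.P (e1.symm.trans e2)
      rw [D.P_Y, D.P_Y] at this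
      exact (neg_injective this).symm
    subst hc
    have hd : d' = d := by
      have e1 := hcd 0 0 (hmem _)
      have e2 := hcd' 0 0 (hmem _)
      linarith
    subst hd
    exact fun p => hcd' p t ⟨by nlinarith, ht⟩
  refine ⟨c, d, fun x t ht => ?_⟩
  have e1 := hX (hall t ht) (D.P x)
  have e2 := D.u_X (D.P x + c) t
  have e3 := D.U_Y (D.P x)
  rw [D.Y_P] at e1 e3
  rw [e1, hall t ht, inner_add_left] at e2
  linarith

end Asymptotic

end LegendreFlow

end Rigidity

end PMA

namespace PMA

/-! ### Gradient maps of convex functions -/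

section Gradient

variable {E : Type*} [NormedAddCommGroup E] [InnerProductSpace ℝ E] [FiniteDimensional ℝ E]

open Filter Topology

lemma hasDerivAt_comp_line {φ : E → ℝ} {F : E → E} (hφ : ∀ x, HasGradientAt φ (F x) x) (x v : E)
    (s : ℝ) : HasDerivAt (fun s : ℝ => φ (x + s • v)) (inner ℝ (F (x + s • v)) v) s := by
  have h1 : HasDerivAt (fun s : ℝ => x + s • v) v s := by
    simpa using ((hasDerivAt_id s).smul_const v).const_add x
  exact (hφ (x + s • v)).hasFDerivAt.comp_hasDerivAt s h1

/-- A differentiable convex function lies above its tangent planes. -/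
lemma add_inner_le_of_convexOn {φ : E → ℝ} (hc : ConvexOn ℝ univ φ) {F : E → E}
    (hφ : ∀ x, HasGradientAt φ (F x) x) (x y : E) : φ x + inner ℝ (F x) (y - x) ≤ φ y := by
  have hc' : ConvexOn ℝ univ (fun s : ℝ => φ (x + s • (y - x))) := by
    have h1 := hc.comp_affineMap (AffineMap.lineMap x y : ℝ →ᵃ[ℝ] E)
    rw [preimage_univ] at h1
    have e : (fun s : ℝ => φ (x + s • (y - x))) = φ ∘ (AffineMap.lineMap x y : ℝ →ᵃ[ℝ] E) := by
      ext s
      simp [AffineMap.lineMap_apply, add_comm]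
    rw [e]
    exact h1
  have hd := hasDerivAt_comp_line hφ x (y - x) 0
  have := hc'.deriv_le_slope (mem_univ 0) (mem_univ 1) zero_lt_one hd.differentiableAt
  rw [hd.deriv, slope_def_field] at this
  simp only [zero_smul, add_zero, one_smul, sub_zero, div_one] at this
  have e : x + (y - x) = y := by abel
  rw [e] at this
  linarith

lemma gradient_eq_of_forall_le {φ : E → ℝ} {F : E → E} (hφ : ∀ x, HasGradientAt φ (F x) x)
    {p x : E} (h : ∀ y, φ x - inner ℝ p x ≤ φ y - inner ℝ p y) : F x = p := by
  have h1 : HasGradientAt (fun y => φ y - inner ℝ p y) (F x - p) x := by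
    rw [hasGradientAt_iff_hasFDerivAt, map_sub]
    exact (hφ x).hasFDerivAt.sub ((InnerProductSpace.toDual ℝ E p).hasFDerivAt)
  have h2 : IsLocalMin (fun y => φ y - inner ℝ p y) x := Eventually.of_forall h
  have h3 := h2.hasFDerivAt_eq_zero h1.hasFDerivAt
  rwa [map_eq_zero_iff _ (InnerProductSpace.toDual ℝ E).injective, sub_eq_zero] at h3

/-- The gradient map of a convex function with nondegenerate Hessian is injective. -/
lemma gradient_injective_of_convexOn {φ : E → ℝ} (hc : ConvexOn ℝ univ φ) {F : E → E}
    (hφ : ∀ x, HasGradientAt φ (F x) x) {H : E → E →L[ℝ] E} (hF : ∀ x, HasFDerivAt F (H x) x)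
    (hdet : ∀ x, (H x).det ≠ 0) : Function.Injective F := by
  intro x y hxy
  have hseg : ∀ s ∈ Icc (0 : ℝ) 1, F (x + s • (y - x)) = F x := by
    intro s hs
    refine gradient_eq_of_forall_le hφ fun z => ?_
    have h1 := add_inner_le_of_convexOn hc hφ x z
    have h2 := add_inner_le_of_convexOn hc hφ y x
    have h3 := hc.2 (mem_univ x) (mem_univ y) (sub_nonneg.2 hs.2) hs.1 (by ring)
    have e : (1 - s) • x + s • y = x + s • (y - x) := by
      rw [sub_smul, one_smul, smul_sub]; abel
    rw [e, smul_eq_mul, smul_eq_mul] at h3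
    rw [← hxy] at h2
    simp only [inner_sub_right, inner_add_right, inner_smul_right] at h1 h2 ⊢
    nlinarith [hs.1]
  have hd : HasDerivAt (fun s : ℝ => F (x + s • (y - x))) (H x (y - x)) 0 := by
    have h1 : HasDerivAt (fun s : ℝ => x + s • (y - x)) (y - x) 0 := by
      simpa using ((hasDerivAt_id (0 : ℝ)).smul_const (y - x)).const_add x
    have h2 : HasFDerivAt F (H x) (x + (0 : ℝ) • (y - x)) := by simpa using hF x
    exact h2.comp_hasDerivAt 0 h1
  have h0 : H x (y - x) = 0 := by
    have h1 : HasDerivWithinAt (fun s : ℝ => F (x + s • (y - x))) 0 (Icc 0 1) 0 :=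
      (hasDerivWithinAt_const (0 : ℝ) (Icc 0 1) (F x)).congr hseg (by simp)
    exact (uniqueDiffOn_Icc zero_lt_one 0 (by simp)).eq_deriv _ hd.hasDerivWithinAt h1
  have hinj : Function.Injective (H x) := by
    have : LinearMap.ker (H x : E →ₗ[ℝ] E) = ⊥ := by
      by_contra hne
      exact hdet x (LinearMap.det_eq_zero_iff_ker_ne_bot.2 hne)
    exact LinearMap.ker_eq_bot.1 this
  have := hinj (h0.trans (map_zero (H x)).symm)
  exact (sub_eq_zero.1 this).symm

/-- The gradient map of a coercive function is surjective. -/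
lemma gradient_surjective {φ : E → ℝ} {F : E → E} (hφ : ∀ x, HasGradientAt φ (F x) x) {a : ℝ}
    (ha : ∀ x, 1 / 4 * ‖x‖ ^ 2 - a ≤ φ x) : Function.Surjective F := by
  intro p
  have hcont : Continuous fun x => φ x - inner ℝ p x := by
    have : Continuous φ := continuous_iff_continuousAt.2 fun x => (hφ x).hasFDerivAt.continuousAt
    fun_prop
  have hlim : Tendsto (fun x => φ x - inner ℝ p x) (cocompact E) atTop := by
    have h1 : Tendsto (fun x : E => ‖x‖ - (a + (‖p‖ + 1) ^ 2)) (cocompact E) atTop :=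
      tendsto_atTop_add_const_right _ _ (tendsto_norm_cocompact_atTop (E := E))
    refine tendsto_atTop_mono (fun x => ?_) h1
    have h2 := real_inner_le_norm p x
    have h3 := ha x
    nlinarith [sq_nonneg (‖x‖ / 2 - (‖p‖ + 1))]
  obtain ⟨x, hx⟩ := hcont.exists_forall_le hlim
  exact ⟨x, gradient_eq_of_forall_le hφ hx⟩

/-- Change of variables along a bijective differentiable map. -/
lemma integral_comp_inverse [MeasurableSpace E] [BorelSpace E] {F Z : E → E} {H : E → E →L[ℝ] E}
    (hF : ∀ x, HasFDerivAt F (H x) x) (hZF : ∀ x, Z (F x) = x) (hFZ : ∀ p, F (Z p) = p)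
    (η : E → ℝ) : ∫ p, η (Z p) = ∫ x, |(H x).det| * η x := by
  have h := integral_image_eq_integral_abs_det_fderiv_smul volume MeasurableSet.univ
    (fun x _ => (hF x).hasFDerivWithinAt) (fun x _ y _ hxy => by rw [← hZF x, hxy, hZF])
    (fun p => η (Z p))
  have hs : F '' univ = univ := image_univ_of_surjective fun p => ⟨Z p, hFZ p⟩
  simpa [hs, hZF] using h

omit [FiniteDimensional ℝ E] in
/-- A lower bound for the Hessian makes the gradient strongly monotone. -/
lemma le_inner_gradient_sub {P : E → E} {H : E → E →L[ℝ] E} (hP : ∀ x, HasFDerivAt P (H x) x)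
    {c : ℝ} (hH : ∀ x v, 2 * c * ‖v‖ ^ 2 ≤ inner ℝ (H x v) v) (x y : E) :
    2 * c * ‖y - x‖ ^ 2 ≤ inner ℝ (P y - P x) (y - x) := by
  have hd : ∀ s : ℝ, HasDerivAt (fun s : ℝ => inner ℝ (P (x + s • (y - x))) (y - x))
      (inner ℝ (H (x + s • (y - x)) (y - x)) (y - x)) s := by
    intro s
    have h1 : HasDerivAt (fun s : ℝ => x + s • (y - x)) (y - x) s := by
      simpa using ((hasDerivAt_id s).smul_const (y - x)).const_add x
    have h2 := (hP (x + s • (y - x))).comp_hasDerivAt s h1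
    simpa using h2.inner ℝ (hasDerivAt_const s (y - x))
  have h2 := (convex_Icc (0 : ℝ) 1).mul_sub_le_image_sub_of_le_deriv
    (fun s _ => (hd s).continuousAt.continuousWithinAt)
    (fun s _ => (hd s).differentiableAt.differentiableWithinAt)
    (fun s _ => by rw [(hd s).deriv]; exact hH _ _) 0 (by simp) 1 (by simp) zero_le_one
  have e : x + (y - x) = y := by abel
  simpa [e, inner_sub_left] using h2

/-- A lower bound for the Hessian makes the function strongly convex. -/
lemma add_inner_add_le {U : E → ℝ} {P : E → E} (hU : ∀ x, HasGradientAt U (P x) x)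
    {H : E → E →L[ℝ] E} (hP : ∀ x, HasFDerivAt P (H x) x)
    {c : ℝ} (hH : ∀ x v, 2 * c * ‖v‖ ^ 2 ≤ inner ℝ (H x v) v) (x y : E) :
    U x + inner ℝ (P x) (y - x) + c * ‖y - x‖ ^ 2 ≤ U y := by
  have hd : ∀ s : ℝ, HasDerivAt (fun s : ℝ => U (x + s • (y - x)) - s * inner ℝ (P x) (y - x)
      - s ^ 2 * (c * ‖y - x‖ ^ 2))
      (inner ℝ (P (x + s • (y - x))) (y - x) - inner ℝ (P x) (y - x)
        - 2 * s * (c * ‖y - x‖ ^ 2)) s := by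
    intro s
    have h1 := (hasDerivAt_comp_line hU x (y - x) s).sub
      ((hasDerivAt_id s).mul_const (inner ℝ (P x) (y - x)))
    have h2 := h1.sub (((hasDerivAt_id s).pow 2).mul_const (c * ‖y - x‖ ^ 2))
    exact h2.congr_deriv (by simp)
  have h2 := (convex_Icc (0 : ℝ) 1).mul_sub_le_image_sub_of_le_deriv (C := 0)
    (fun s _ => (hd s).continuousAt.continuousWithinAt)
    (fun s _ => (hd s).differentiableAt.differentiableWithinAt)
    (fun s hs => by
      rw [interior_Icc] at hs
      rw [(hd s).deriv]
      have h3 := le_inner_gradient_sub hP hH x (x + s • (y - x))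
      rw [add_sub_cancel_left, norm_smul, inner_smul_right, Real.norm_of_nonneg hs.1.le,
        inner_sub_left] at h3
      have h4 : s * (2 * s * (c * ‖y - x‖ ^ 2)) ≤
          s * (inner ℝ (P (x + s • (y - x))) (y - x) - inner ℝ (P x) (y - x)) := by
        refine le_trans (le_of_eq (by ring)) h3
      have h5 := le_of_mul_le_mul_left h4 hs.1
      linarith) 0 (by simp) 1 (by simp) zero_le_one
  have e : x + (y - x) = y := by abel
  simp [e] at h2
  linarith

/-- The Legendre transform is differentiable, with gradient the inverse of the gradient map. -/
lemma hasGradientAt_legendre {φ : E → ℝ} {Z : E → E} (hZ : Continuous Z)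
    (hφ : ∀ p x, inner ℝ p x - (inner ℝ p (Z p) - φ (Z p)) ≤ φ x) (p : E) :
    HasGradientAt (fun q => inner ℝ q (Z q) - φ (Z q)) (Z p) p := by
  rw [hasGradientAt_iff_hasFDerivAt, hasFDerivAt_iff_isLittleO_nhds_zero]
  have h1 : Tendsto (fun y => Z (p + y) - Z p) (𝓝 0) (𝓝 0) := by
    have : Continuous fun y => Z (p + y) - Z p := by fun_prop
    simpa using this.tendsto 0
  rw [Asymptotics.isLittleO_iff]
  intro c hc
  filter_upwards [h1.norm.eventually_le_const (by simpa using hc)] with y hy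
  have h2 := hφ (p + y) (Z p)
  have h3 := hφ p (Z (p + y))
  simp only [InnerProductSpace.toDual_apply_apply]
  have h4 : inner ℝ y (Z (p + y) - Z p) ≤ c * ‖y‖ := by
    refine (real_inner_le_norm _ _).trans ?_
    rw [mul_comm]
    gcongr
  rw [inner_sub_right] at h4
  simp only [inner_add_left] at h2 h3 ⊢
  rw [real_inner_comm y (Z p), Real.norm_eq_abs, abs_le]
  constructor <;> nlinarith [norm_nonneg y]

end Gradient

end PMA

namespace PMA

/-! ### From potentials to Legendre flows -/

section Potential

variable {E : Type*} [NormedAddCommGroup E] [InnerProductSpace ℝ E] [FiniteDimensional ℝ E]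
  [MeasurableSpace E] [BorelSpace E]

open Filter Topology

lemma exists_rpow_le_mul_add {θ : ℝ} (hθ0 : 0 ≤ θ) (hθ : θ < 1) {η : ℝ} (hη : 0 < η) :
    ∃ C, 0 ≤ C ∧ ∀ z : ℝ, 0 ≤ z → z ^ θ ≤ η * z + C := by
  have h1 := (tendsto_rpow_neg_atTop (sub_pos.2 hθ)).eventually_le_const hη
  obtain ⟨Z, hZ⟩ := eventually_atTop.1 h1
  refine ⟨(max Z 1) ^ θ, by positivity, fun z hz => ?_⟩
  rcases le_total z (max Z 1) with h | h
  · have := Real.rpow_le_rpow hz h hθ0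
    nlinarith
  · have hz1 : 0 < z := by linarith [le_max_right Z 1]
    have h2 := hZ z ((le_max_left _ _).trans h)
    have h3 : z ^ θ = z ^ (-(1 - θ)) * z := by
      nth_rw 3 [← Real.rpow_one z]
      rw [← Real.rpow_add hz1]
      ring_nf
    rw [h3]
    have h4 : 0 ≤ (max Z 1) ^ θ := by positivity
    nlinarith

variable (E) in
/-- A convex evolution `u` and a stationary strongly convex potential `U` solving the same parabolic
Monge-Ampère equation, both asymptotic to a quadratic polynomial. -/
structure PotentialFlow (c₀ m₁ m₂ τ θ C : ℝ) where
  U : E → ℝ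
  P : E → E
  P' : E → E →L[ℝ] E
  u : E → ℝ → ℝ
  F : E → ℝ → E
  H : E → ℝ → E →L[ℝ] E
  w : E → ℝ → ℝ
  g : ℝ → ℝ
  G : ℝ → ℝ
  gradU : ∀ x, HasGradientAt U (P x) x
  fderivP : ∀ x, HasFDerivAt P (P' x) x
  hessU : ∀ x v, 2 * c₀ * ‖v‖ ^ 2 ≤ inner ℝ (P' x v) v
  P_near : ∀ x, ‖P x - x‖ ≤ C
  U_near : ∀ x, |U x - 1 / 2 * ‖x‖ ^ 2| ≤ C
  cont_u : Continuous fun z : E × ℝ => u z.1 z.2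
  cont_F : Continuous fun z : E × ℝ => F z.1 z.2
  cont_w : Continuous fun z : E × ℝ => w z.1 z.2
  gradu : ∀ x t, HasGradientAt (fun y => u y t) (F x t) x
  fderivF : ∀ x t, HasFDerivAt (fun y => F y t) (H x t) x
  det_ne : ∀ x t, (H x t).det ≠ 0
  convex : ∀ t, ConvexOn ℝ univ fun x => u x t
  deriv_u : ∀ x, ∀ t < 0, HasDerivAt (u x) (-w x t) t
  w_mem : ∀ x t, w x t ∈ Icc m₁ m₂
  g_mem : ∀ t, g t ∈ Icc m₁ m₂
  cont_g : Continuous g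
  deriv_G : ∀ t, HasDerivAt G (g t) t
  G_near : ∀ t ≤ 0, |G t - τ * t| ≤ C
  det_eq : ∀ x t, w x t * |(H x t).det| = g t * |(P' x).det|
  u_near : ∀ x t, |u x t - (1 / 2 * ‖x‖ ^ 2 - τ * min t 0)| ≤ C * (1 + ‖x‖ ^ 2 + |t|) ^ θ

namespace PotentialFlow

variable {c₀ m₁ m₂ τ θ C : ℝ} (D : PotentialFlow E c₀ m₁ m₂ τ θ C)

lemma C_nonneg (D : PotentialFlow E c₀ m₁ m₂ τ θ C) : 0 ≤ C :=
  (norm_nonneg _).trans (D.P_near 0)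

lemma exists_u_near (hθ0 : 0 ≤ θ) (hθ : θ < 1) {η : ℝ} (hη : 0 < η) : ∃ C', 0 ≤ C' ∧ ∀ x t,
    |D.u x t - (1 / 2 * ‖x‖ ^ 2 - τ * min t 0)| ≤ η * (‖x‖ ^ 2 + |t|) + C' := by
  have hC := D.C_nonneg
  obtain ⟨B, hB, h⟩ := exists_rpow_le_mul_add hθ0 hθ (η := η / (C + 1)) (by positivity)
  refine ⟨η + C * B, by positivity, fun x t => (D.u_near x t).trans ?_⟩
  have hz : 0 ≤ 1 + ‖x‖ ^ 2 + |t| := by positivity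
  have h1 := h _ hz
  have h2 : C * (η / (C + 1) * (1 + ‖x‖ ^ 2 + |t|)) ≤ η * (1 + ‖x‖ ^ 2 + |t|) := by
    rw [← mul_assoc]
    gcongr
    rw [mul_div_assoc', div_le_iff₀ (by positivity)]
    nlinarith
  have h3 : C * (1 + ‖x‖ ^ 2 + |t|) ^ θ ≤ C * (η / (C + 1) * (1 + ‖x‖ ^ 2 + |t|) + B) := by gcongr
  linarith

lemma le_u (x y : E) (t : ℝ) : D.u x t + inner ℝ (D.F x t) (y - x) ≤ D.u y t :=
  add_inner_le_of_convexOn (D.convex t) (fun x => D.gradu x t) x y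

lemma exists_F_near (hθ0 : 0 ≤ θ) (hθ : θ < 1) {κ : ℝ} (hκ : 0 < κ) (hκ1 : κ ≤ 1) :
    ∃ C', 0 ≤ C' ∧ ∀ x t, ‖D.F x t - x‖ ≤ κ * (‖x‖ + √|t|) + C' := by
  obtain ⟨B, hB, h⟩ := D.exists_u_near hθ0 hθ (η := κ ^ 2 / 14) (by positivity)
  refine ⟨κ + 2 * B / κ, by positivity, fun x t => ?_⟩
  set a := D.F x t - x with ha
  rcases eq_or_ne a 0 with h0 | h0
  · rw [h0, norm_zero]; positivity
  have hna : 0 < ‖a‖ := norm_pos_iff.2 h0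
  set M := ‖x‖ + √|t| + 1 with hM
  have hM1 : 1 ≤ M := by
    have := Real.sqrt_nonneg |t|
    have := norm_nonneg x
    linarith
  have hxM : ‖x‖ ≤ M := by have := Real.sqrt_nonneg |t|; linarith
  have htM : |t| ≤ M ^ 2 := by
    rw [← Real.sq_sqrt (abs_nonneg t)]
    gcongr
    linarith [norm_nonneg x]
  set ρ := κ * M with hρ
  have hρ0 : 0 < ρ := by positivity
  have hρM : ρ ≤ M := mul_le_of_le_one_left (by linarith) hκ1
  set e := ‖a‖⁻¹ • a with he
  have hne : ‖e‖ = 1 := by rw [he, norm_smul, norm_inv, norm_norm, inv_mul_cancel₀ hna.ne']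
  have hae : inner ℝ a e = ‖a‖ := by
    rw [he, inner_smul_right, real_inner_self_eq_norm_sq]; field_simp
  have hFe : inner ℝ (D.F x t) e = ‖a‖ + inner ℝ x e := by
    rw [← hae, ha, inner_sub_left]; ring
  have h1 := D.le_u x (x + ρ • e) t
  rw [add_sub_cancel_left, inner_smul_right, hFe] at h1
  have h2 := (abs_le.1 (h (x + ρ • e) t)).2
  have h3 := (abs_le.1 (h x t)).1
  have h4 : ‖x + ρ • e‖ ^ 2 = ‖x‖ ^ 2 + 2 * ρ * inner ℝ x e + ρ ^ 2 := by
    rw [norm_add_sq_real, norm_smul, hne, inner_smul_right, Real.norm_of_nonneg hρ0.le]; ring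
  have h5 : ‖x + ρ • e‖ ^ 2 ≤ 4 * M ^ 2 := by
    have : ‖x + ρ • e‖ ≤ 2 * M := by
      refine (norm_add_le _ _).trans ?_
      rw [norm_smul, hne, Real.norm_of_nonneg hρ0.le]
      linarith
    calc _ ≤ (2 * M) ^ 2 := by gcongr
      _ = _ := by ring
  have h6 : ‖x‖ ^ 2 ≤ M ^ 2 := by gcongr
  have h7 : κ ^ 2 / 14 * (‖x + ρ • e‖ ^ 2 + |t|) + κ ^ 2 / 14 * (‖x‖ ^ 2 + |t|) ≤
      κ ^ 2 / 14 * (4 * M ^ 2 + M ^ 2) + κ ^ 2 / 14 * (M ^ 2 + M ^ 2) := by gcongr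
  have h8 : ρ * ‖a‖ ≤ 1 / 2 * ρ ^ 2 + κ ^ 2 / 2 * M ^ 2 + 2 * B := by
    rw [h4] at h2
    rw [h4] at h7
    linarith
  have h9 : ‖a‖ ≤ κ * M + 2 * B / κ := by
    have : ρ * ‖a‖ ≤ ρ * (κ * M + 2 * B / κ) := by
      refine h8.trans ?_
      have : ρ * (κ * M + 2 * B / κ) = κ ^ 2 * M ^ 2 + 2 * B * M := by rw [hρ]; field_simp
      rw [this, hρ]
      nlinarith
    exact le_of_mul_le_mul_left this hρ0
  linarith

lemma bijective_F (hθ0 : 0 ≤ θ) (hθ : θ < 1) (t : ℝ) : Function.Bijective fun x => D.F x t := by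
  refine ⟨gradient_injective_of_convexOn (D.convex t) (fun x => D.gradu x t)
    (fun x => D.fderivF x t) (fun x => D.det_ne x t), ?_⟩
  obtain ⟨B, hB, h⟩ := D.exists_u_near hθ0 hθ (η := 1 / 4) (by norm_num)
  refine gradient_surjective (fun x => D.gradu x t) (a := τ * min t 0 + 1 / 4 * |t| + B) fun x => ?_
  have := (abs_le.1 (h x t)).1
  linarith

lemma bijective_P (hc₀ : 0 < c₀) : Function.Bijective D.P := by
  constructor
  · intro x y hxy
    have h := le_inner_gradient_sub D.fderivP D.hessU x y
    rw [hxy, sub_self, inner_zero_left] at h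
    have h1 : ‖y - x‖ ^ 2 ≤ 0 := by
      by_contra hne
      push Not at hne
      have : 0 < 2 * c₀ * ‖y - x‖ ^ 2 := by positivity
      linarith
    have h2 : ‖y - x‖ = 0 := by nlinarith [norm_nonneg (y - x)]
    exact (sub_eq_zero.1 (norm_eq_zero.1 h2)).symm
  · refine gradient_surjective D.gradU (a := C) fun x => ?_
    have := (abs_le.1 (D.U_near x)).1
    nlinarith [sq_nonneg ‖x‖]

/-- The inverse of the gradient map of the evolution. -/
def X (p : E) (t : ℝ) : E := Function.invFun (fun x => D.F x t) p

/-- The inverse of the gradient map of the stationary potential. -/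
def Y (p : E) : E := Function.invFun D.P p

lemma F_X (hθ0 : 0 ≤ θ) (hθ : θ < 1) (p : E) (t : ℝ) : D.F (D.X p t) t = p :=
  Function.invFun_eq ((D.bijective_F hθ0 hθ t).2 p)

lemma X_F (hθ0 : 0 ≤ θ) (hθ : θ < 1) (x : E) (t : ℝ) : D.X (D.F x t) t = x :=
  Function.leftInverse_invFun (D.bijective_F hθ0 hθ t).1 x

lemma P_Y (hc₀ : 0 < c₀) (p : E) : D.P (D.Y p) = p := Function.invFun_eq ((D.bijective_P hc₀).2 p)

lemma Y_P (hc₀ : 0 < c₀) (x : E) : D.Y (D.P x) = x :=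
  Function.leftInverse_invFun (D.bijective_P hc₀).1 x

lemma cont_Y (hc₀ : 0 < c₀) : Continuous D.Y := by
  refine (LipschitzWith.of_dist_le_mul (K := (2 * c₀)⁻¹.toNNReal) fun p q => ?_).continuous
  rw [Real.coe_toNNReal _ (by positivity), dist_eq_norm, dist_eq_norm]
  have h := le_inner_gradient_sub D.fderivP D.hessU (D.Y q) (D.Y p)
  rw [D.P_Y hc₀, D.P_Y hc₀] at h
  have h1 := h.trans (real_inner_le_norm _ _)
  rw [le_inv_mul_iff₀ (by positivity)]
  rcases (norm_nonneg (D.Y p - D.Y q)).eq_or_lt with h0 | h0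
  · rw [← h0, mul_zero]; positivity
  · exact le_of_mul_le_mul_right (by linarith) h0

lemma cont_X (hθ0 : 0 ≤ θ) (hθ : θ < 1) : Continuous fun z : E × ℝ => D.X z.1 z.2 := by
  set Φ : E × ℝ → E × ℝ := fun z => (D.F z.1 z.2, z.2) with hΦ
  have hcont : Continuous Φ := D.cont_F.prodMk continuous_snd
  obtain ⟨B, hB, hF⟩ := D.exists_F_near hθ0 hθ (κ := 1 / 2) (by norm_num) (by norm_num)
  have hproper : IsProperMap Φ := by
    rw [isProperMap_iff_tendsto_cocompact]
    refine ⟨hcont, ?_⟩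
    rw [← Metric.cobounded_eq_cocompact, ← tendsto_norm_atTop_iff_cobounded]
    have h1 : Tendsto (fun z : E × ℝ => (‖z‖ - (2 * B + 1)) / 4) (Bornology.cobounded (E × ℝ)) atTop :=
      (tendsto_atTop_add_const_right _ _ tendsto_norm_cobounded_atTop).atTop_div_const (by norm_num)
    refine tendsto_atTop_mono (fun z => ?_) h1
    have h2 := hF z.1 z.2
    have h3 : ‖z.1‖ ≤ ‖D.F z.1 z.2‖ + ‖D.F z.1 z.2 - z.1‖ := by
      have := norm_sub_le (D.F z.1 z.2) (D.F z.1 z.2 - z.1)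
      simpa using this
    have h4 : √|z.2| ≤ |z.2| + 1 := by
      rw [Real.sqrt_le_left (by positivity)]
      nlinarith [abs_nonneg z.2]
    have h5 : ‖D.F z.1 z.2‖ ≤ ‖Φ z‖ := norm_fst_le (Φ z)
    have h6 : |z.2| ≤ ‖Φ z‖ := norm_snd_le (Φ z)
    have h7 : ‖z‖ ≤ ‖z.1‖ + |z.2| := by
      rw [Prod.norm_def]
      exact max_le (by linarith [abs_nonneg z.2]) (by rw [Real.norm_eq_abs]; linarith [norm_nonneg z.1])
    have h8 : |z.2| ≤ ‖z‖ := norm_snd_le z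
    linarith
  let e : E × ℝ ≃ E × ℝ :=
    { toFun := Φ
      invFun := fun z => (D.X z.1 z.2, z.2)
      left_inv := fun z => by simp [hΦ, D.X_F hθ0 hθ]
      right_inv := fun z => by simp [hΦ, D.F_X hθ0 hθ] }
  exact continuous_fst.comp
    (e.toHomeomorphOfContinuousClosed hcont hproper.isClosedMap).symm.continuous

end PotentialFlow

end Potential

end PMA

namespace PMA

section Potential

variable {E : Type*} [NormedAddCommGroup E] [InnerProductSpace ℝ E] [FiniteDimensional ℝ E]
  [MeasurableSpace E] [BorelSpace E]

open Filter Topology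

omit [FiniteDimensional ℝ E] [InnerProductSpace ℝ E] [MeasurableSpace E] [BorelSpace E] in
/-- Time increments of `u` are, locally uniformly in space, close to the linear ones. -/
lemma eventually_abs_sub_le_of_continuous {u w : E → ℝ → ℝ}
    (hw : Continuous fun z : E × ℝ => w z.1 z.2)
    (hu : ∀ x, ∀ t < 0, HasDerivAt (u x) (-w x t) t) (x₀ : E) {t : ℝ} (ht : t < 0) {ε : ℝ}
    (hε : 0 < ε) : ∀ᶠ z : E × ℝ in 𝓝 (x₀, t),
      |u z.1 t - u z.1 z.2 - w x₀ t * (z.2 - t)| ≤ ε * |z.2 - t| := by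
  have h1 : ∀ᶠ z : E × ℝ in 𝓝 (x₀, t), |w z.1 z.2 - w x₀ t| < ε ∧ z.2 < 0 :=
    ((hw.tendsto (x₀, t)).eventually (Metric.ball_mem_nhds (w x₀ t) hε)).and
      (continuous_snd.tendsto (x₀, t) |>.eventually (gt_mem_nhds ht))
  obtain ⟨r, hr, h⟩ := Metric.eventually_nhds_iff_ball.1 h1
  refine Metric.eventually_nhds_iff_ball.2 ⟨r, hr, fun z hz => ?_⟩
  rw [← ball_prod_same] at hz
  obtain ⟨hz1, hz2⟩ := hz
  have hmem : ∀ s ∈ Metric.ball t r, |w z.1 s - w x₀ t| < ε ∧ s < 0 := fun s hs =>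
    h (z.1, s) (by rw [← ball_prod_same]; exact ⟨hz1, hs⟩)
  have hder : ∀ s ∈ Metric.ball t r, HasDerivWithinAt (fun s => u z.1 s + w x₀ t * s)
      (-w z.1 s + w x₀ t) (Metric.ball t r) s := fun s hs => by
    have := (hu z.1 s (hmem s hs).2).add ((hasDerivAt_id s).const_mul (w x₀ t))
    exact (this.congr_deriv (by simp)).hasDerivWithinAt
  have h2 := (convex_ball t r).norm_image_sub_le_of_norm_hasDerivWithin_le hder
    (C := ε) (fun s hs => by
      rw [Real.norm_eq_abs, ← abs_neg]
      refine (le_of_eq ?_).trans (hmem s hs).1.le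
      congr 1; ring) (Metric.mem_ball_self hr) hz2
  rw [Real.norm_eq_abs, Real.norm_eq_abs, ← abs_neg] at h2
  refine (le_of_eq ?_).trans h2
  congr 1; ring

namespace PotentialFlow

variable {c₀ m₁ m₂ τ θ C : ℝ} (D : PotentialFlow E c₀ m₁ m₂ τ θ C)

/-- The Legendre transform of the evolution. -/
def v (p : E) (t : ℝ) : ℝ := inner ℝ p (D.X p t) - D.u (D.X p t) t

/-- The Legendre transform of the stationary potential. -/
def V (p : E) : ℝ := inner ℝ p (D.Y p) - D.U (D.Y p)

lemma inner_sub_v_le (hθ0 : 0 ≤ θ) (hθ : θ < 1) (p x : E) (t : ℝ) :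
    inner ℝ p x - D.v p t ≤ D.u x t := by
  have := D.le_u (D.X p t) x t
  rw [D.F_X hθ0 hθ, inner_sub_right] at this
  rw [v]
  linarith

lemma inner_sub_V_add_le (hc₀ : 0 < c₀) (p x : E) :
    inner ℝ p x - D.V p + c₀ * ‖x - D.Y p‖ ^ 2 ≤ D.U x := by
  have := add_inner_add_le D.gradU D.fderivP D.hessU (D.Y p) x
  rw [D.P_Y hc₀, inner_sub_right] at this
  rw [V]
  linarith

lemma cont_v (hθ0 : 0 ≤ θ) (hθ : θ < 1) : Continuous fun z : E × ℝ => D.v z.1 z.2 := by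
  have hX := D.cont_X hθ0 hθ
  exact (continuous_fst.inner hX).sub (D.cont_u.comp (hX.prodMk continuous_snd))

lemma hasDerivAt_v (hθ0 : 0 ≤ θ) (hθ : θ < 1) (p : E) {t : ℝ} (ht : t < 0) :
    HasDerivAt (D.v p) (D.w (D.X p t) t) t := by
  rw [hasDerivAt_iff_isLittleO, Asymptotics.isLittleO_iff]
  intro ε hε
  have hev := eventually_abs_sub_le_of_continuous D.cont_w D.deriv_u (D.X p t) ht hε
  have hX : Continuous fun s => D.X p s :=
    (D.cont_X hθ0 hθ).comp (continuous_const.prodMk continuous_id)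
  have h1 : ∀ᶠ s in 𝓝 t, |D.u (D.X p t) t - D.u (D.X p t) s - D.w (D.X p t) t * (s - t)|
      ≤ ε * |s - t| :=
    ((continuous_const (y := D.X p t)).prodMk continuous_id).tendsto t |>.eventually hev
  have h2 : ∀ᶠ s in 𝓝 t, |D.u (D.X p s) t - D.u (D.X p s) s - D.w (D.X p t) t * (s - t)|
      ≤ ε * |s - t| :=
    (hX.prodMk continuous_id).tendsto t |>.eventually hev
  filter_upwards [h1, h2] with s h1 h2
  have h3 := D.inner_sub_v_le hθ0 hθ p (D.X p t) s
  have h4 := D.inner_sub_v_le hθ0 hθ p (D.X p s) t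
  have h5 : D.v p t = inner ℝ p (D.X p t) - D.u (D.X p t) t := rfl
  have h6 : D.v p s = inner ℝ p (D.X p s) - D.u (D.X p s) s := rfl
  rw [Real.norm_eq_abs, Real.norm_eq_abs, smul_eq_mul, mul_comm (s - t), abs_le]
  have h7 := abs_le.1 h1
  have h8 := abs_le.1 h2
  constructor <;> linarith [h7.1, h8.2]

/-- The Legendre flow attached to a pair of potentials. -/
def toLegendreFlow (hc₀ : 0 < c₀) (hθ0 : 0 ≤ θ) (hθ : θ < 1) : LegendreFlow E c₀ m₁ m₂ where
  U := D.U
  V := D.V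
  P := D.P
  Y := D.Y
  u := D.u
  v := D.v
  w := D.w
  X := D.X
  g := D.g
  G := D.G
  cont_U := continuous_iff_continuousAt.2 fun x => (D.gradU x).continuousAt
  cont_P := continuous_iff_continuousAt.2 fun x => (D.fderivP x).continuousAt
  cont_Y := D.cont_Y hc₀
  cont_u := D.cont_u
  cont_v := D.cont_v hθ0 hθ
  cont_w := D.cont_w
  cont_X := D.cont_X hθ0 hθ
  cont_g := D.cont_g
  cont_G := continuous_iff_continuousAt.2 fun t => (D.deriv_G t).continuousAt
  gradV := fun p => hasGradientAt_legendre (D.cont_Y hc₀) (fun p x => by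
    have h1 := D.inner_sub_V_add_le hc₀ p x
    have h2 : 0 ≤ c₀ * ‖x - D.Y p‖ ^ 2 := by positivity
    rw [V] at h1
    linarith) p
  gradv := fun p t => hasGradientAt_legendre (φ := fun x => D.u x t) (Z := fun p => D.X p t)
    ((D.cont_X hθ0 hθ).comp (continuous_id.prodMk continuous_const))
    (fun p x => D.inner_sub_v_le hθ0 hθ p x t) p
  Y_P := D.Y_P hc₀
  P_Y := D.P_Y hc₀
  young := D.inner_sub_V_add_le hc₀
  U_Y := fun p => by rw [V]; ring
  le_u := D.inner_sub_v_le hθ0 hθ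
  u_X := fun p t => by rw [v]; ring
  deriv_v := fun p t ht => D.hasDerivAt_v hθ0 hθ p ht
  deriv_u := D.deriv_u
  deriv_G := fun t _ => D.deriv_G t
  w_mem := D.w_mem
  g_mem := D.g_mem
  transport := fun t η => by
    rw [integral_comp_inverse D.fderivP (D.Y_P hc₀) (D.P_Y hc₀) η,
      integral_comp_inverse (Z := fun p => D.X p t) (fun x => D.fderivF x t) (fun x => D.X_F hθ0 hθ x t)
        (fun p => D.F_X hθ0 hθ p t) (fun x => η x * D.w x t), ← integral_const_mul]
    refine integral_congr_ae (Eventually.of_forall fun x => ?_)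
    have := D.det_eq x t
    simp only
    linear_combination η x * this
  growth_u := fun T => by
    obtain ⟨B, hB, h⟩ := D.exists_u_near hθ0 hθ (η := 1) one_pos
    refine ⟨2 + |τ| * |T| + |T| + B, fun x t ht => ?_⟩
    have h1 := h x t
    have hT : |t| ≤ |T| := by
      rw [abs_of_nonpos ht.2]
      exact (by linarith [ht.1] : -t ≤ T).trans (le_abs_self T)
    rw [min_eq_left ht.2] at h1
    have h2 : |D.u x t| ≤ |D.u x t - (1 / 2 * ‖x‖ ^ 2 - τ * t)| + |1 / 2 * ‖x‖ ^ 2 - τ * t| := by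
      refine (le_of_eq ?_).trans
        (abs_add_le (D.u x t - (1 / 2 * ‖x‖ ^ 2 - τ * t)) (1 / 2 * ‖x‖ ^ 2 - τ * t))
      congr 1
      ring
    have h3 : |1 / 2 * ‖x‖ ^ 2 - τ * t| ≤ 1 / 2 * ‖x‖ ^ 2 + |τ| * |T| := by
      refine (abs_sub _ _).trans ?_
      rw [abs_of_nonneg (by positivity), abs_mul]
      gcongr
    have h4 : 0 ≤ |τ| * |T| + |T| + B := by positivity
    rw [japSq]
    nlinarith [sq_nonneg ‖x‖, mul_nonneg h4 (sq_nonneg ‖x‖)]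

lemma abs_V_sub_le (hc₀ : 0 < c₀) (p : E) : |D.V p - 1 / 2 * ‖p‖ ^ 2| ≤ C := by
  have h1 := D.inner_sub_V_add_le hc₀ p p
  have h2 := abs_le.1 (D.U_near p)
  have h3 := abs_le.1 (D.U_near (D.Y p))
  have h4 : 0 ≤ c₀ * ‖p - D.Y p‖ ^ 2 := by positivity
  have h5 : D.V p = inner ℝ p (D.Y p) - D.U (D.Y p) := rfl
  have h6 := norm_sub_sq_real p (D.Y p)
  have h7 := sq_nonneg ‖p - D.Y p‖
  rw [real_inner_self_eq_norm_sq] at h1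
  rw [abs_le]
  constructor <;> linarith [h2.2, h3.1]

lemma exists_X_near (hθ0 : 0 ≤ θ) (hθ : θ < 1) : ∃ C', 0 ≤ C' ∧ ∀ p t,
    ‖D.X p t - p‖ ≤ 1 / 200 * (‖p‖ + √|t|) + C' := by
  obtain ⟨B, hB, h⟩ := D.exists_F_near hθ0 hθ (κ := 1 / 400) (by norm_num) (by norm_num)
  refine ⟨2 * B, by positivity, fun p t => ?_⟩
  have h1 := h (D.X p t) t
  rw [D.F_X hθ0 hθ, norm_sub_rev] at h1
  have h2 : ‖D.X p t‖ ≤ ‖D.X p t - p‖ + ‖p‖ := by simpa using norm_add_le (D.X p t - p) p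
  have h3 := Real.sqrt_nonneg |t|
  have h4 := norm_nonneg p
  linarith

lemma exists_abs_v_sub_le (hθ0 : 0 ≤ θ) (hθ : θ < 1) : ∃ K, 0 ≤ K ∧ ∀ p, ∀ t ≤ 0,
    |D.v p t - (1 / 2 * ‖p‖ ^ 2 + τ * t)| ≤ K * (1 + ‖p‖ ^ 2 + |t|) ^ θ := by
  have hC := D.C_nonneg
  obtain ⟨B, hB, h⟩ := D.exists_X_near hθ0 hθ
  refine ⟨C * (13 + 3 * B ^ 2), by positivity, fun p t ht => ?_⟩
  have h1 := D.inner_sub_v_le hθ0 hθ p p t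
  have h2 := abs_le.1 (D.u_near p t)
  have h3 := abs_le.1 (D.u_near (D.X p t) t)
  rw [min_eq_left ht] at h2 h3
  rw [real_inner_self_eq_norm_sq] at h1
  have h5 : D.v p t = inner ℝ p (D.X p t) - D.u (D.X p t) t := rfl
  have h6 := norm_sub_sq_real p (D.X p t)
  have h7 := sq_nonneg ‖p - D.X p t‖
  set z := 1 + ‖p‖ ^ 2 + |t| with hz
  have hz0 : 0 ≤ z := by positivity
  have h8 : 1 + ‖D.X p t‖ ^ 2 + |t| ≤ (13 + 3 * B ^ 2) * z := by
    have h9 : ‖D.X p t‖ ≤ 2 * ‖p‖ + √|t| + B := by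
      have h10 : ‖D.X p t‖ ≤ ‖D.X p t - p‖ + ‖p‖ := by simpa using norm_add_le (D.X p t - p) p
      have := h p t
      have := Real.sqrt_nonneg |t|
      have := norm_nonneg p
      linarith
    have h10 : ‖D.X p t‖ ^ 2 ≤ (2 * ‖p‖ + √|t| + B) ^ 2 := by gcongr
    have h11 := Real.sq_sqrt (abs_nonneg t)
    have h12 : (2 * ‖p‖ + √|t| + B) ^ 2 ≤ 3 * ((2 * ‖p‖) ^ 2 + √|t| ^ 2 + B ^ 2) := by
      nlinarith [sq_nonneg (2 * ‖p‖ - √|t|), sq_nonneg (2 * ‖p‖ - B), sq_nonneg (√|t| - B)]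
    rw [h11] at h12
    have h13 : 0 ≤ B ^ 2 * (‖p‖ ^ 2 + |t|) := by positivity
    have h14 := sq_nonneg ‖p‖
    have h15 := abs_nonneg t
    rw [hz]
    linarith
  have h9 : (1 + ‖D.X p t‖ ^ 2 + |t|) ^ θ ≤ (13 + 3 * B ^ 2) * z ^ θ := by
    refine (Real.rpow_le_rpow (by positivity) h8 hθ0).trans ?_
    rw [Real.mul_rpow (by positivity) hz0]
    gcongr
    refine (Real.rpow_le_rpow_of_exponent_le (by nlinarith) hθ.le).trans_eq (Real.rpow_one _)
  have h10 : C * (1 + ‖D.X p t‖ ^ 2 + |t|) ^ θ ≤ C * (13 + 3 * B ^ 2) * z ^ θ := by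
    rw [mul_assoc]
    gcongr
  have h11 : C * z ^ θ ≤ C * (13 + 3 * B ^ 2) * z ^ θ := by
    gcongr
    nlinarith
  rw [abs_le]
  constructor <;> linarith [h2.2, h3.1]

/-- The evolution differs from the stationary potential by an affine function. -/
theorem exists_u_eq (hc₀ : 0 < c₀) (hm₁ : 0 < m₁) (hm₂ : 0 < m₂) (hθ0 : 0 ≤ θ) (hθ : θ < 1) :
    ∃ (c : E) (d : ℝ), ∀ x, ∀ t ≤ 0, D.u x t = D.U x + inner ℝ c x - D.G t - d := by
  obtain ⟨B, hB, hX⟩ := D.exists_X_near hθ0 hθ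
  obtain ⟨K, hK, hv⟩ := D.exists_abs_v_sub_le hθ0 hθ
  have hC := D.C_nonneg
  have hD : (D.toLegendreFlow hc₀ hθ0 hθ).Asymptotic C B (2 * K + 2 * C) (2 - 2 * θ) :=
    { Y_near := fun p => by
        have := D.P_near (D.Y p)
        rwa [D.P_Y hc₀, norm_sub_rev] at this
      X_near := fun p s hs t ht => by
        refine (hX p t).trans ?_
        have : √|t| ≤ s := by
          rw [Real.sqrt_le_left hs, abs_of_nonpos ht.2]
          linarith [ht.1]
        gcongr
      k_le := fun R hR p t ht => by
        have hR0 : 0 < R := by linarith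
        have hRt : R ^ 2 * t ≤ 0 := mul_nonpos_of_nonneg_of_nonpos (sq_nonneg R) ht.2
        have h1 := hv (R • p) _ hRt
        have h2 := D.abs_V_sub_le hc₀ (R • p)
        have h3 := D.G_near _ hRt
        have hJ : 1 ≤ japSq p := by rw [japSq]; nlinarith [sq_nonneg ‖p‖]
        have h4 : 1 + ‖R • p‖ ^ 2 + |R ^ 2 * t| ≤ R ^ 2 * (2 * japSq p) := by
          have h5 : |t| ≤ 1 := abs_le.2 ⟨ht.1, ht.2.trans zero_le_one⟩
          have h6 : 1 ≤ R ^ 2 := one_le_pow₀ hR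
          rw [norm_smul, mul_pow, Real.norm_of_nonneg hR0.le, abs_mul, abs_of_nonneg (sq_nonneg R),
            japSq]
          have h7 : R ^ 2 * |t| ≤ R ^ 2 * 1 := by gcongr
          have h8 : 0 ≤ R ^ 2 * ‖p‖ ^ 2 := by positivity
          linarith
        have h5 : (1 + ‖R • p‖ ^ 2 + |R ^ 2 * t|) ^ θ ≤ R ^ (2 - (2 - 2 * θ)) * (2 * japSq p) := by
          refine (Real.rpow_le_rpow (by positivity) h4 hθ0).trans ?_
          rw [Real.mul_rpow (by positivity) (by positivity), ← Real.rpow_natCast R 2,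
            ← Real.rpow_mul hR0.le]
          have : 2 - (2 - 2 * θ) = ((2 : ℕ) : ℝ) * θ := by push_cast; ring
          rw [this]
          gcongr
          exact (Real.rpow_le_rpow_of_exponent_le (by linarith) hθ.le).trans_eq (Real.rpow_one _)
        have h6 : 1 ≤ R ^ (2 - (2 - 2 * θ)) := Real.one_le_rpow hR (by linarith)
        have h7 : 1 ≤ R ^ (2 - (2 - 2 * θ)) * japSq p := one_le_mul_of_one_le_of_one_le h6 hJ
        have h8 : K * (1 + ‖R • p‖ ^ 2 + |R ^ 2 * t|) ^ θ ≤
            K * (R ^ (2 - (2 - 2 * θ)) * (2 * japSq p)) := by gcongr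
        have h9 : C * 1 ≤ C * (R ^ (2 - (2 - 2 * θ)) * japSq p) := by gcongr
        have h10 : (D.toLegendreFlow hc₀ hθ0 hθ).k (R • p) (R ^ 2 * t) =
          D.v (R • p) (R ^ 2 * t) - D.V (R • p) - D.G (R ^ 2 * t) := rfl
        rw [h10]
        have h1' := abs_le.1 h1
        have h2' := abs_le.1 h2
        have h3' := abs_le.1 h3
        have h11 : (2 * K + 2 * C) * R ^ (2 - (2 - 2 * θ)) * japSq p =
          K * (R ^ (2 - (2 - 2 * θ)) * (2 * japSq p))
            + 2 * (C * (R ^ (2 - (2 - 2 * θ)) * japSq p)) := by ring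
        rw [h11, abs_le]
        constructor <;> linarith [h1'.1, h1'.2, h2'.1, h2'.2, h3'.1, h3'.2] }
  exact hD.exists_u_eq hc₀ hm₁ hm₂ (by linarith)

end PotentialFlow

end Potential

end PMA

namespace PMA

/-! ### Linear algebra and periodic functions on Euclidean space -/

section Euclidean

variable {n : ℕ}

open Filter Topology

open scoped MatrixOrder in
lemma exists_eq_transpose_mul_self {A : Matrix (Fin n) (Fin n) ℝ} (hA : A.PosDef) :
    ∃ B : Matrix (Fin n) (Fin n) ℝ, A = B.transpose * B := by
  obtain ⟨B, hB⟩ := CStarAlgebra.nonneg_iff_eq_star_mul_self.mp hA.posSemidef.nonneg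
  exact ⟨B, by simpa [Matrix.star_eq_conjTranspose] using hB⟩

lemma det_eq_of_inner_single (T : En n →L[ℝ] En n) {M : Matrix (Fin n) (Fin n) ℝ}
    (h : ∀ i j, inner ℝ (T (EuclideanSpace.single i 1)) (EuclideanSpace.single j 1) = M i j) :
    T.det = M.det := by
  have h1 := LinearMap.det_toMatrix (EuclideanSpace.basisFun (Fin n) ℝ).toBasis (T : En n →ₗ[ℝ] En n)
  have h2 : LinearMap.toMatrix (EuclideanSpace.basisFun (Fin n) ℝ).toBasis
    (EuclideanSpace.basisFun (Fin n) ℝ).toBasis (T : En n →ₗ[ℝ] En n) = M.transpose := by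
    ext i j
    rw [Matrix.transpose_apply, ← h, LinearMap.toMatrix_apply]
    simp [EuclideanSpace.inner_single_right]
  rw [h2, Matrix.det_transpose] at h1
  exact h1.symm

lemma inner_apply_self_eq_quadForm (T : En n →L[ℝ] En n) {M : Matrix (Fin n) (Fin n) ℝ}
    (h : ∀ i j, inner ℝ (T (EuclideanSpace.single i 1)) (EuclideanSpace.single j 1) = M i j)
    (x : En n) : inner ℝ (T x) x = quadForm M x := by
  have hx : x = ∑ i, x i • EuclideanSpace.single i (1 : ℝ) := by
    conv_lhs => rw [← (EuclideanSpace.basisFun (Fin n) ℝ).sum_repr x]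
    simp
  conv_lhs => rw [hx]
  rw [map_sum, sum_inner, quadForm]
  refine Finset.sum_congr rfl fun i _ => ?_
  rw [inner_sum]
  refine Finset.sum_congr rfl fun j _ => ?_
  rw [map_smul, inner_smul_left, inner_smul_right, h]
  simp; ring

lemma quadForm_pos {M : Matrix (Fin n) (Fin n) ℝ} (hM : M.PosDef) {x : En n} (hx : x ≠ 0) :
    0 < quadForm M x := by
  have h := hM.dotProduct_mulVec_pos (x := x.ofLp) (by simpa using hx)
  have h2 : quadForm M x = star x.ofLp ⬝ᵥ M.mulVec x.ofLp := by
    simp only [quadForm, dotProduct, Matrix.mulVec, Finset.mul_sum]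
    refine Finset.sum_congr rfl fun i _ => Finset.sum_congr rfl fun j _ => ?_
    simp; ring
  rwa [h2]

lemma exists_inner_eq {A : Matrix (Fin n) (Fin n) ℝ} (hA : A.PosDef) :
    ∃ L S : En n →L[ℝ] En n, (∀ x, L (S x) = x) ∧ (∀ x, S (L x) = x) ∧
      ∀ i j, inner ℝ (L (EuclideanSpace.single i 1)) (L (EuclideanSpace.single j 1)) = A i j := by
  obtain ⟨B, hB⟩ := exists_eq_transpose_mul_self hA
  have hdet : IsUnit B.det := by
    have := hA.det_pos
    rw [hB, Matrix.det_mul, Matrix.det_transpose] at this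
    exact isUnit_iff_ne_zero.2 fun h => by simp [h] at this
  refine ⟨Matrix.toEuclideanCLM (𝕜 := ℝ) B, Matrix.toEuclideanCLM (𝕜 := ℝ) B⁻¹,
    fun x => ?_, fun x => ?_, fun i j => ?_⟩
  · rw [← mul_apply_eq_comp, ← map_mul, Matrix.mul_nonsing_inv _ hdet, map_one]; rfl
  · rw [← mul_apply_eq_comp, ← map_mul, Matrix.nonsing_inv_mul _ hdet, map_one]; rfl
  · rw [hB, PiLp.inner_apply, Matrix.mul_apply]
    simp [Matrix.ofLp_toEuclideanCLM, mul_comm]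

/-- The Riesz representation as a linear map. -/
def riesz (n : ℕ) : StrongDual ℝ (En n) →L[ℝ] En n where
  toFun := (InnerProductSpace.toDual ℝ (En n)).symm
  map_add' := map_add _
  map_smul' := fun c ℓ => by simp
  cont := (InnerProductSpace.toDual ℝ (En n)).symm.continuous

lemma riesz_apply (ℓ : StrongDual ℝ (En n)) :
    riesz n ℓ = (InnerProductSpace.toDual ℝ (En n)).symm ℓ := rfl

/-- The second derivative of a function as an operator. -/
def hessOp (φ : En n → ℝ) (x : En n) : En n →L[ℝ] En n := riesz n ∘L fderiv ℝ (fderiv ℝ φ) x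

lemma inner_hessOp (φ : En n → ℝ) (x v z : En n) :
    inner ℝ (hessOp φ x v) z = iteratedFDeriv ℝ 2 φ x ![v, z] := by
  rw [iteratedFDeriv_two_apply]
  simp [hessOp, riesz_apply]

lemma hasFDerivAt_gradient {φ : En n → ℝ} {x : En n} (h : ContDiffAt ℝ 2 φ x) :
    HasFDerivAt (gradient φ) (hessOp φ x) x := by
  have h1 : DifferentiableAt ℝ (fderiv ℝ φ) x :=
    (h.fderiv_right (m := 1) (by norm_num)).differentiableAt (by norm_num)
  exact (riesz n).hasFDerivAt.comp x h1.hasFDerivAt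

lemma hasGradientAt_gradient {φ : En n → ℝ} {x : En n} (h : ContDiffAt ℝ 2 φ x) :
    HasGradientAt φ (gradient φ x) x :=
  (h.differentiableAt (by norm_num)).hasGradientAt

lemma hasGradientAt_comp_clm {φ : En n → ℝ} {S : En n →L[ℝ] En n} {g y : En n}
    (h : HasGradientAt φ g (S y)) :
    HasGradientAt (fun z => φ (S z)) (S.adjoint g) y := by
  rw [hasGradientAt_iff_hasFDerivAt] at h ⊢
  refine (h.comp y S.hasFDerivAt).congr_fderiv ?_
  ext z
  simp [ContinuousLinearMap.adjoint_inner_left]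

lemma exists_mem_closedBall_eq_of_periodic {β : Type*} {h : En n → β}
    (hh : ∀ x i, h (x + EuclideanSpace.single i 1) = h x) (x : En n) :
    ∃ y ∈ Metric.closedBall (0 : En n) (√n), h y = h x := by
  have hper : Function.Periodic h (∑ i, (-⌊x i⌋) • EuclideanSpace.single i (1 : ℝ)) :=
    Finset.sum_induction _ (Function.Periodic h) (fun _ _ ha hb => ha.add_period hb)
      (fun _ => by rw [add_zero]) fun i _ => Function.Periodic.zsmul (fun y => hh y i) _
  refine ⟨x + ∑ i, (-⌊x i⌋) • EuclideanSpace.single i (1 : ℝ), ?_, hper x⟩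
  have hy : ∀ j, (x + ∑ i, (-⌊x i⌋) • EuclideanSpace.single i (1 : ℝ)) j = Int.fract (x j) := by
    intro j
    simp [Finset.sum_apply, Int.fract, sub_eq_add_neg, Pi.single_apply]
  rw [mem_closedBall_zero_iff, EuclideanSpace.norm_eq]
  refine Real.sqrt_le_sqrt ?_
  calc _ ≤ ∑ _i : Fin n, (1 : ℝ) := by
        refine Finset.sum_le_sum fun i _ => ?_
        rw [hy, Real.norm_of_nonneg (Int.fract_nonneg _)]
        exact pow_le_one₀ (Int.fract_nonneg _) (Int.fract_lt_one _).le
    _ = n := by simp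

lemma exists_norm_le_of_periodic {F : Type*} [NormedAddCommGroup F] {h : En n → F}
    (hc : Continuous h) (hh : ∀ x i, h (x + EuclideanSpace.single i 1) = h x) :
    ∃ C, 0 ≤ C ∧ ∀ x, ‖h x‖ ≤ C := by
  obtain ⟨C, hC⟩ := (isCompact_closedBall (0 : En n) √n).exists_bound_of_continuousOn
    hc.continuousOn
  refine ⟨C, (norm_nonneg _).trans (hC 0 (by simp)), fun x => ?_⟩
  obtain ⟨y, hy, hxy⟩ := exists_mem_closedBall_eq_of_periodic hh x
  exact hxy ▸ hC y hy

lemma exists_mul_sq_le_inner_of_periodic {T : En n → En n →L[ℝ] En n} (hc : Continuous T)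
    (hT : ∀ x i, T (x + EuclideanSpace.single i 1) = T x)
    (hpos : ∀ x v, v ≠ 0 → 0 < inner ℝ (T x v) v) :
    ∃ c, 0 < c ∧ ∀ x v, c * ‖v‖ ^ 2 ≤ inner ℝ (T x v) v := by
  have hK := (isCompact_closedBall (0 : En n) √n).prod (isCompact_sphere (0 : En n) 1)
  have hcont : Continuous fun z : En n × En n => inner ℝ (T z.1 z.2) z.2 :=
    ((hc.comp continuous_fst).clm_apply continuous_snd).inner continuous_snd
  obtain ⟨c, hc0, hcle⟩ := hK.exists_forall_le' hcont.continuousOn (a := 0) fun z hz => by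
    refine hpos _ _ ?_
    have := hz.2
    rw [mem_sphere_zero_iff_norm] at this
    exact norm_ne_zero_iff.1 (by rw [this]; exact one_ne_zero)
  refine ⟨c, hc0, fun x v => ?_⟩
  rcases eq_or_ne v 0 with rfl | hv
  · simp
  obtain ⟨y, hy, hxy⟩ := exists_mem_closedBall_eq_of_periodic hT x
  have hv' : 0 < ‖v‖ := norm_pos_iff.2 hv
  have h1 := hcle (y, ‖v‖⁻¹ • v) ⟨hy, by simp [norm_smul, hv'.ne']⟩
  rw [← hxy]
  simp only [map_smul, inner_smul_left, inner_smul_right] at h1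
  have h2 : c * ‖v‖ ^ 2 ≤ (‖v‖⁻¹ * (‖v‖⁻¹ * inner ℝ (T y v) v)) * ‖v‖ ^ 2 := by
    gcongr
    simpa using h1
  refine h2.trans_eq ?_
  field_simp

lemma fderiv_add_eq_of_periodic {F : Type*} [NormedAddCommGroup F] [NormedSpace ℝ F]
    {h : En n → F} {a : En n} (hh : ∀ x, h (x + a) = h x) (x : En n) :
    fderiv ℝ h (x + a) = fderiv ℝ h x := by
  rw [← fderiv_comp_add_right]
  simp_rw [hh]

lemma exists_abs_intervalIntegral_le_of_periodic {φ : ℝ → ℝ} (hφ : Continuous φ)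
    (hper : ∀ t ≤ 0, φ (t - 1) = φ t) (hint : ∫ t in (-1 : ℝ)..0, φ t = 0) :
    ∃ C, 0 ≤ C ∧ ∀ t ≤ 0, |∫ s in (0 : ℝ)..t, φ s| ≤ C := by
  have hi : ∀ a b, IntervalIntegrable φ volume a b := fun a b => hφ.intervalIntegrable a b
  have hQ : ∀ t ≤ 0, ∫ s in (0 : ℝ)..(t - 1), φ s = ∫ s in (0 : ℝ)..t, φ s := by
    intro t ht
    rw [← intervalIntegral.integral_add_adjacent_intervals (hi 0 (-1)) (hi (-1) (t - 1)),
      intervalIntegral.integral_symm, hint, neg_zero, zero_add]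
    have h1 := intervalIntegral.integral_comp_sub_right (a := 0) (b := t) φ 1
    rw [zero_sub] at h1
    rw [← h1]
    refine intervalIntegral.integral_congr fun s hs => ?_
    rw [uIcc_of_ge ht] at hs
    exact hper s hs.2
  have hc : Continuous fun t => ∫ s in (0 : ℝ)..t, φ s :=
    intervalIntegral.continuous_primitive hi 0
  obtain ⟨C, hC⟩ := (isCompact_Icc (a := (-1 : ℝ)) (b := 0)).exists_bound_of_continuousOn
    hc.continuousOn
  refine ⟨C, (norm_nonneg _).trans (hC 0 (by simp)), ?_⟩
  have key : ∀ k : ℕ, ∀ t ≤ 0, -(k + 1 : ℝ) ≤ t → |∫ s in (0 : ℝ)..t, φ s| ≤ C := by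
    intro k
    induction k with
    | zero => exact fun t ht h => hC t ⟨by simpa using h, ht⟩
    | succ k ih =>
      intro t ht h
      rcases le_total (-1) t with h1 | h1
      · exact hC t ⟨h1, ht⟩
      · have h2 := hQ (t + 1) (by linarith)
        rw [add_sub_cancel_right] at h2
        rw [h2]
        push_cast at h
        exact ih (t + 1) (by linarith) (by linarith)
  intro t ht
  obtain ⟨k, hk⟩ := exists_nat_gt (-t)
  exact key k t ht (by linarith)

end Euclidean

end PMA

namespace PMA

/-! ### Solutions with periodic right-hand side -/

section Periodic

variable {n : ℕ}

open Filter Topology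

lemma IsC2kOn.continuousOn {u : En n → ℝ → ℝ} {D : Set (En n × ℝ)} (hu : IsC2kOn 1 u D) :
    ContinuousOn (fun p : En n × ℝ => u p.1 p.2) D := by
  have h := (hu 0 0 (by norm_num)).2
  have h1 := (ContinuousMultilinearMap.apply ℝ (fun _ : Fin 0 => En n) ℝ
    0).continuous.comp_continuousOn h
  simpa [Function.comp_def] using h1

lemma IsC2kOn.continuousOn_timeDeriv {u : En n → ℝ → ℝ} {D : Set (En n × ℝ)}
    (hu : IsC2kOn 1 u D) : ContinuousOn (fun p : En n × ℝ => timeDeriv u p.1 p.2) D := by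
  have h := (hu 0 1 (by norm_num)).2
  have h1 := (ContinuousMultilinearMap.apply ℝ (fun _ : Fin 0 => En n) ℝ
    0).continuous.comp_continuousOn h
  simpa [Function.comp_def, timeDeriv] using h1

lemma IsC2kOn.continuousOn_spaceGrad {u : En n → ℝ → ℝ} {D : Set (En n × ℝ)}
    (hu : IsC2kOn 1 u D) : ContinuousOn (fun p : En n × ℝ => spaceGrad u p.1 p.2) D := by
  have h := (hu 1 0 (by norm_num)).2
  have h1 : ContinuousOn (fun p : En n × ℝ => fderiv ℝ (fun y => u y p.2) p.1) D := by
    have h2 := (continuousMultilinearCurryFin1 ℝ (En n) ℝ).continuous.comp_continuousOn h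
    refine h2.congr fun p _ => ?_
    ext v
    simp
  exact (riesz n).continuous.comp_continuousOn h1

lemma IsC2kOn.contDiffAt {u : En n → ℝ → ℝ} {D : Set (En n × ℝ)} (hu : IsC2kOn 1 u D)
    {p : En n × ℝ} (hp : p ∈ D) : ContDiffAt ℝ 2 (fun y => u y p.2) p.1 := by
  simpa using ((hu 2 0 (by norm_num)).1 p hp).1

lemma IsC2kOn.hasDerivAt {u : En n → ℝ → ℝ} {D : Set (En n × ℝ)} (hu : IsC2kOn 1 u D)
    {p : En n × ℝ} (hp : p ∈ D) : HasDerivAt (u p.1) (timeDeriv u p.1 p.2) p.2 := by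
  have h : ContDiffAt ℝ 1 (u p.1) p.2 := by simpa using ((hu 0 1 (by norm_num)).1 p hp).2
  exact (h.differentiableAt (by norm_num)).hasDerivAt

lemma norm_sq_apply_eq_quadForm {A : Matrix (Fin n) (Fin n) ℝ} {L : En n →L[ℝ] En n}
    (hL : ∀ i j, inner ℝ (L (EuclideanSpace.single i 1)) (L (EuclideanSpace.single j 1)) = A i j)
    (x : En n) : ‖L x‖ ^ 2 = quadForm A x := by
  rw [← inner_apply_self_eq_quadForm (L.adjoint ∘L L) (fun i j => by
    simp [ContinuousLinearMap.adjoint_inner_left, hL])]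
  simp [ContinuousLinearMap.adjoint_inner_left]

/-- The quadratic asymptotics in linearly transformed coordinates. -/
lemma exists_abs_sub_le_mul_rpow {u : En n → ℝ → ℝ} (hu : IsC2kOn 1 u (halfSpace n))
    {A : Matrix (Fin n) (Fin n) ℝ} {τ θ C₀ : ℝ} (hC₀ : 0 < C₀) (hθ0 : 0 ≤ θ) (hθ1 : θ < 1)
    (hasym : ∀ (x : En n) (t : ℝ), t ≤ 0 → C₀ ≤ ‖x‖ ^ 2 - t →
      |u x t - ((1 / 2) * quadForm A x - τ * t)| ≤ C₀ * (‖x‖ ^ 2 - t) ^ θ)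
    {L S : En n →L[ℝ] En n} (hLS : ∀ x, L (S x) = x) (hL : ∀ x, ‖L x‖ ^ 2 = quadForm A x) :
    ∃ C, 0 ≤ C ∧ ∀ y t, |u (S y) (min t 0) - (1 / 2 * ‖y‖ ^ 2 - τ * min t 0)| ≤
      C * (1 + ‖y‖ ^ 2 + |t|) ^ θ := by
  have hcont : ContinuousOn (fun p : En n × ℝ => u p.1 p.2 - (1 / 2 * ‖L p.1‖ ^ 2 - τ * p.2))
      (halfSpace n) := by
    refine hu.continuousOn.sub (Continuous.continuousOn ?_)
    fun_prop
  have hK := (isCompact_closedBall (0 : En n) √C₀).prod (isCompact_Icc (a := -C₀) (b := 0))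
  obtain ⟨M, hM⟩ := hK.exists_bound_of_continuousOn (hcont.mono fun p hp => ⟨mem_univ _, hp.2.2⟩)
  have hM0 : 0 ≤ M := (norm_nonneg _).trans (hM (0, 0) ⟨by simp, by simp [hC₀.le]⟩)
  refine ⟨M + C₀ * (‖S‖ ^ 2 + 1), by positivity, fun y t => ?_⟩
  set z := 1 + ‖y‖ ^ 2 + |t| with hz
  have hz1 : 1 ≤ z := by
    rw [hz]
    linarith [sq_nonneg ‖y‖, abs_nonneg t]
  have hz0 : 0 ≤ z := by linarith
  have hzθ : 1 ≤ z ^ θ := Real.one_le_rpow hz1 hθ0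
  have ht : min t 0 ≤ 0 := min_le_right _ _
  have hmin : -min t 0 ≤ |t| := by
    rcases le_total t 0 with h | h
    · rw [min_eq_left h, abs_of_nonpos h]
    · simp [min_eq_right h]
  have hquad : ‖y‖ ^ 2 = quadForm A (S y) := by rw [← hL, hLS]
  rcases le_total C₀ (‖S y‖ ^ 2 - min t 0) with h | h
  · have h1 := hasym _ _ ht h
    rw [← hquad] at h1
    refine h1.trans ?_
    have h2 : ‖S y‖ ^ 2 - min t 0 ≤ (‖S‖ ^ 2 + 1) * z := by
      have h3 : ‖S y‖ ^ 2 ≤ ‖S‖ ^ 2 * ‖y‖ ^ 2 := by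
        rw [← mul_pow]
        gcongr
        exact S.le_opNorm y
      have h4 : 0 ≤ ‖S‖ ^ 2 * |t| := by positivity
      rw [hz]
      linarith [sq_nonneg ‖S‖, sq_nonneg ‖y‖]
    have h3 : (‖S y‖ ^ 2 - min t 0) ^ θ ≤ (‖S‖ ^ 2 + 1) * z ^ θ := by
      refine (Real.rpow_le_rpow (by linarith) h2 hθ0).trans ?_
      rw [Real.mul_rpow (by positivity) hz0]
      gcongr
      exact (Real.rpow_le_rpow_of_exponent_le (by linarith [sq_nonneg ‖S‖]) hθ1.le).trans_eq
        (Real.rpow_one _)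
    have h4 : C₀ * (‖S y‖ ^ 2 - min t 0) ^ θ ≤ C₀ * ((‖S‖ ^ 2 + 1) * z ^ θ) := by gcongr
    have h5 : 0 ≤ M * z ^ θ := by positivity
    linarith
  · have h1 := hM (S y, min t 0) ⟨by
      rw [mem_closedBall_zero_iff]
      exact Real.le_sqrt_of_sq_le (by linarith), by
      constructor
      · linarith [sq_nonneg ‖S y‖]
      · exact ht⟩
    rw [hLS, Real.norm_eq_abs] at h1
    refine h1.trans ?_
    have h2 : M * 1 ≤ M * z ^ θ := by gcongr
    have h3 : 0 ≤ C₀ * (‖S‖ ^ 2 + 1) * z ^ θ := by positivity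
    linarith

lemma det_clm_comp (S T : En n →L[ℝ] En n) : (S ∘L T).det = S.det * T.det :=
  LinearMap.det_comp _ _

lemma det_adjoint_comp_comp (S T : En n →L[ℝ] En n) :
    (S.adjoint ∘L T ∘L S).det = S.adjoint.det * S.det * T.det := by
  rw [det_clm_comp, det_clm_comp]
  ring

lemma det_ne_zero_of_leftInverse {L S : En n →L[ℝ] En n} (hLS : ∀ x, L (S x) = x) :
    S.adjoint.det * S.det ≠ 0 := by
  have h1 : L ∘L S = ContinuousLinearMap.id ℝ (En n) := by ext1 x; simp [hLS]
  have h2 : S.adjoint ∘L L.adjoint = ContinuousLinearMap.id ℝ (En n) := by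
    rw [← ContinuousLinearMap.adjoint_comp, h1, ContinuousLinearMap.adjoint_id]
  have h0 : (ContinuousLinearMap.id ℝ (En n)).det = 1 := LinearMap.det_id
  have h3 := congrArg ContinuousLinearMap.det h1
  have h4 := congrArg ContinuousLinearMap.det h2
  rw [det_clm_comp, h0] at h3 h4
  exact mul_ne_zero (left_ne_zero_of_mul_eq_one h4) (right_ne_zero_of_mul_eq_one h3)

lemma hasGradientAt_half_norm_sq (y : En n) : HasGradientAt (fun z : En n => 1 / 2 * ‖z‖ ^ 2) y y := by
  rw [hasGradientAt_iff_hasFDerivAt]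
  refine ((hasStrictFDerivAt_norm_sq y).hasFDerivAt.const_mul (1 / 2)).congr_fderiv ?_
  ext z
  simp

/-- The evolution and the stationary periodic potential agree up to an affine function. -/
theorem exists_eq_add_dotp
    {f₁ : En n → ℝ} {f₂ : ℝ → ℝ} (hf₁pos : ∀ x, 0 < f₁ x) (hf₂cont : ContinuousOn f₂ (Iic 0))
    (hf₂per : ∀ t : ℝ, t ≤ 0 → f₂ (t - 1) = f₂ t)
    (hf₂avg : ∫ t in Icc (-1 : ℝ) 0, f₂ t = 1) {lam Λ : ℝ} (hlam : 0 < lam)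
    (hfbdd : ∀ (x : En n) (t : ℝ), t ≤ 0 → lam ≤ f₁ x * f₂ t ∧ f₁ x * f₂ t ≤ Λ)
    {u : En n → ℝ → ℝ} (hureg : IsC2kOn 1 u (halfSpace n))
    (huconv : ParabolicallyConvexOn (halfSpace n) u) {m₁ m₂ : ℝ} (hm₁ : 0 < m₁)
    (hut : ∀ (x : En n) (t : ℝ), t ≤ 0 → m₁ ≤ -timeDeriv u x t ∧ -timeDeriv u x t ≤ m₂)
    (heq : ∀ (x : En n) (t : ℝ), t ≤ 0 →
      -timeDeriv u x t * (spaceHess u x t).det = f₁ x * f₂ t)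
    {τ : ℝ} (hτ : 0 < τ) {A : Matrix (Fin n) (Fin n) ℝ} (hApos : A.PosDef)
    (hdetA : τ * A.det = 1) {θ C₀ : ℝ} (hθ0 : 0 ≤ θ) (hθ1 : θ < 1) (hC₀ : 0 < C₀)
    (hasym : ∀ (x : En n) (t : ℝ), t ≤ 0 → C₀ ≤ ‖x‖ ^ 2 - t →
      |u x t - ((1 / 2) * quadForm A x - τ * t)| ≤ C₀ * (‖x‖ ^ 2 - t) ^ θ)
    {ξ : En n → ℝ} (hξreg : ContDiff ℝ 2 ξ)
    (hξper : ∀ (x : En n) (i : Fin n), ξ (x + EuclideanSpace.single i 1) = ξ x)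
    (hξpos : ∀ x : En n, (A + spaceHess (fun y _ => ξ y) x 0).PosDef)
    (hξeq : ∀ x : En n, (A + spaceHess (fun y _ => ξ y) x 0).det = A.det * f₁ x) :
    ∃ (c : En n) (d : ℝ), ∀ x, ∀ t ≤ 0,
      u x t = 1 / 2 * quadForm A x + ξ x + dotp c x - τ * (∫ s in (0 : ℝ)..t, f₂ (min s 0)) - d := by
  obtain ⟨L, S, hLS, hSL, hLA⟩ := exists_inner_eq hApos
  have hL := norm_sq_apply_eq_quadForm hLA
  set T : En n → En n →L[ℝ] En n := fun x => L.adjoint ∘L L + hessOp ξ x with hT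
  have hT_inner : ∀ x i j, inner ℝ (T x (EuclideanSpace.single i 1)) (EuclideanSpace.single j 1) =
      (A + spaceHess (fun y _ => ξ y) x 0) i j := fun x i j => by
    rw [hT, Matrix.add_apply, ← hLA, spaceHess, ← inner_hessOp]
    simp [inner_add_left, ContinuousLinearMap.adjoint_inner_left]
  have hT_det : ∀ x, (T x).det = A.det * f₁ x := fun x => by
    rw [det_eq_of_inner_single _ (hT_inner x), hξeq]
  have hdξ : Continuous (fderiv ℝ ξ) := hξreg.continuous_fderiv (by norm_num)
  have hddξ : Continuous (fderiv ℝ (fderiv ℝ ξ)) :=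
    (hξreg.fderiv_right (m := 1) (by norm_num)).continuous_fderiv (by norm_num)
  have hT_cont : Continuous T := continuous_const.add (continuous_const.clm_comp hddξ)
  have hdper : ∀ x i, fderiv ℝ ξ (x + EuclideanSpace.single i 1) = fderiv ℝ ξ x :=
    fun x i => fderiv_add_eq_of_periodic (fun x => hξper x i) x
  have hT_per : ∀ x i, T (x + EuclideanSpace.single i 1) = T x := fun x i => by
    rw [hT]
    simp only [hessOp]
    rw [fderiv_add_eq_of_periodic (fun x => hdper x i) x]
  obtain ⟨c, hc, hcT⟩ := exists_mul_sq_le_inner_of_periodic hT_cont hT_per fun x v hv => by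
    rw [inner_apply_self_eq_quadForm _ (hT_inner x)]
    exact quadForm_pos (hξpos x) hv
  obtain ⟨C₁, hC₁, hξ_le⟩ := exists_norm_le_of_periodic hξreg.continuous hξper
  obtain ⟨C₂, hC₂, hdξ_le⟩ := exists_norm_le_of_periodic hdξ hdper
  set φ : ℝ → ℝ := fun t => f₂ (min t 0) with hφ
  have hφ_cont : Continuous φ :=
    hf₂cont.comp_continuous (f := fun t : ℝ => min t 0) (by fun_prop) fun t => min_le_right t 0
  have hφ_int : ∫ t in (-1 : ℝ)..0, φ t = 1 := by
    rw [intervalIntegral.integral_of_le (by norm_num), ← integral_Icc_eq_integral_Ioc]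
    refine (setIntegral_congr_fun measurableSet_Icc fun t ht => ?_).trans hf₂avg
    simp [hφ, min_eq_left ht.2]
  obtain ⟨C₃, hC₃, hφ_le⟩ := exists_abs_intervalIntegral_le_of_periodic
    (φ := fun t => φ t - 1) (by fun_prop) (fun t ht => by
      simp only [hφ]
      rw [min_eq_left ht, min_eq_left (by linarith), hf₂per t ht]) (by
      rw [intervalIntegral.integral_sub (hφ_cont.intervalIntegrable _ _)
        intervalIntegrable_const, hφ_int]
      simp)
  obtain ⟨C₄, hC₄, hu_near⟩ := exists_abs_sub_le_mul_rpow hureg hC₀ hθ0 hθ1 hasym hLS hL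
  have hmem : ∀ x t, (x, min t 0) ∈ halfSpace n := fun x t => ⟨mem_univ _, min_le_right t 0⟩
  have hcmap : Continuous fun z : En n × ℝ => (S z.1, min z.2 0) := by fun_prop
  have hδ := det_ne_zero_of_leftInverse hLS
  have hHess : ∀ x t, (hessOp (fun y => u y t) x).det = (spaceHess u x t).det := fun x t =>
    det_eq_of_inner_single _ fun i j => by rw [inner_hessOp, spaceHess]
  have hHess_pos : ∀ x, ∀ t ≤ 0, 0 < (spaceHess u x t).det := fun x t ht => by
    have h1 := heq x t ht
    have h2 := (hfbdd x t ht).1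
    have h3 : 0 < -timeDeriv u x t := hm₁.trans_le (hut x t ht).1
    exact pos_of_mul_pos_right (by rw [h1]; linarith) h3.le
  have hf0 := hf₁pos 0
  let D : PotentialFlow (En n) (c / (2 * (‖L‖ ^ 2 + 1))) (min m₁ (τ * (lam / f₁ 0)))
      (max m₂ (τ * (Λ / f₁ 0))) τ θ (C₁ + ‖S.adjoint‖ * C₂ + τ * C₃ + C₄) :=
    { U := fun y => 1 / 2 * ‖y‖ ^ 2 + ξ (S y)
      P := fun y => y + S.adjoint (gradient ξ (S y))
      P' := fun y => S.adjoint ∘L T (S y) ∘L S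
      u := fun y t => u (S y) (min t 0)
      F := fun y t => S.adjoint (spaceGrad u (S y) (min t 0))
      H := fun y t => S.adjoint ∘L hessOp (fun x => u x (min t 0)) (S y) ∘L S
      w := fun y t => -timeDeriv u (S y) (min t 0)
      g := fun t => τ * φ t
      G := fun t => τ * ∫ s in (0 : ℝ)..t, φ s
      gradU := fun y => by
        have h1 := hasGradientAt_comp_clm (hasGradientAt_gradient (hξreg.contDiffAt (x := S y)))
        rw [hasGradientAt_iff_hasFDerivAt] at h1 ⊢
        rw [map_add]
        exact (hasGradientAt_half_norm_sq y).hasFDerivAt.add h1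
      fderivP := fun y => by
        have h1 := S.adjoint.hasFDerivAt.comp y
          ((hasFDerivAt_gradient (hξreg.contDiffAt (x := S y))).comp y S.hasFDerivAt)
        refine ((hasFDerivAt_id y).add h1).congr_fderiv ?_
        have h2 : S.adjoint ∘L (L.adjoint ∘L L) ∘L S = ContinuousLinearMap.id ℝ (En n) := by
          have h3 : L ∘L S = ContinuousLinearMap.id ℝ (En n) := by ext1 x; simp [hLS]
          rw [ContinuousLinearMap.comp_assoc, h3, ContinuousLinearMap.comp_id,
            ← ContinuousLinearMap.adjoint_comp, h3, ContinuousLinearMap.adjoint_id]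
        rw [hT, ContinuousLinearMap.add_comp, ContinuousLinearMap.comp_add, h2]
      hessU := fun y v => by
        have h1 := hcT (S y) (S v)
        have h2 : ‖v‖ ≤ ‖L‖ * ‖S v‖ := by simpa [hLS] using L.le_opNorm (S v)
        have h3 : ‖v‖ ^ 2 ≤ (‖L‖ ^ 2 + 1) * ‖S v‖ ^ 2 := by
          have : ‖v‖ ^ 2 ≤ (‖L‖ * ‖S v‖) ^ 2 := by gcongr
          rw [mul_pow] at this
          linarith [sq_nonneg ‖S v‖]
        have h4 : inner ℝ ((S.adjoint ∘L T (S y) ∘L S) v) v = inner ℝ (T (S y) (S v)) (S v) := by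
          simp [ContinuousLinearMap.adjoint_inner_left]
        rw [h4]
        refine le_trans ?_ h1
        have h5 : 2 * (c / (2 * (‖L‖ ^ 2 + 1))) = c / (‖L‖ ^ 2 + 1) := by field_simp
        rw [h5, div_mul_eq_mul_div, div_le_iff₀ (by positivity)]
        calc c * ‖v‖ ^ 2 ≤ c * ((‖L‖ ^ 2 + 1) * ‖S v‖ ^ 2) := by gcongr
          _ = _ := by ring
      P_near := fun y => by
        rw [add_sub_cancel_left]
        have h1 : ‖gradient ξ (S y)‖ ≤ C₂ := by
          rw [gradient, LinearIsometryEquiv.norm_map]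
          exact hdξ_le _
        have h2 : ‖S.adjoint (gradient ξ (S y))‖ ≤ ‖S.adjoint‖ * C₂ :=
          (S.adjoint.le_opNorm _).trans (by gcongr)
        have : 0 ≤ τ * C₃ := by positivity
        linarith
      U_near := fun y => by
        rw [add_sub_cancel_left]
        have h1 := hξ_le (S y)
        rw [Real.norm_eq_abs] at h1
        have h2 : 0 ≤ τ * C₃ := by positivity
        have h3 : 0 ≤ ‖S.adjoint‖ * C₂ := by positivity
        linarith
      cont_u := hureg.continuousOn.comp_continuous hcmap fun z => hmem _ _
      cont_F := S.adjoint.continuous.comp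
        (hureg.continuousOn_spaceGrad.comp_continuous hcmap fun z => hmem _ _)
      cont_w := (hureg.continuousOn_timeDeriv.comp_continuous hcmap fun z => hmem _ _).neg
      gradu := fun y t => hasGradientAt_comp_clm
        (hasGradientAt_gradient (hureg.contDiffAt (hmem (S y) t)))
      fderivF := fun y t => S.adjoint.hasFDerivAt.comp y
        ((hasFDerivAt_gradient (hureg.contDiffAt (hmem (S y) t))).comp y S.hasFDerivAt)
      det_ne := fun y t => by
        rw [det_adjoint_comp_comp, hHess]
        exact mul_ne_zero hδ (hHess_pos _ _ (min_le_right _ _)).ne'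
      convex := fun t => by
        have h1 := huconv.1 (min t 0)
        have h2 : {x : En n | (x, min t 0) ∈ halfSpace n} = univ :=
          eq_univ_of_forall fun x => hmem x t
        rw [h2] at h1
        exact h1.comp_linearMap S.toLinearMap
      deriv_u := fun y t ht => by
        have h1 := hureg.hasDerivAt (hmem (S y) t)
        simp only [min_eq_left ht.le, neg_neg] at h1 ⊢
        refine h1.congr_of_eventuallyEq ?_
        filter_upwards [gt_mem_nhds ht] with s hs
        rw [min_eq_left hs.le]
      w_mem := fun y t => by
        have h1 := hut (S y) _ (min_le_right t 0)
        exact ⟨(min_le_left _ _).trans h1.1, h1.2.trans (le_max_left _ _)⟩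
      g_mem := fun t => by
        have h1 := hfbdd 0 _ (min_le_right t 0)
        refine ⟨(min_le_right _ _).trans ?_, le_trans ?_ (le_max_right _ _)⟩
        · gcongr
          rw [div_le_iff₀ hf0]
          linarith [h1.1]
        · gcongr
          rw [le_div_iff₀ hf0]
          linarith [h1.2]
      cont_g := by fun_prop
      deriv_G := fun t => (hφ_cont.integral_hasStrictDerivAt 0 t).hasDerivAt.const_mul τ
      G_near := fun t ht => by
        have h1 := hφ_le t ht
        rw [intervalIntegral.integral_sub (hφ_cont.intervalIntegrable _ _)
          intervalIntegrable_const, intervalIntegral.integral_const, smul_eq_mul, mul_one,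
          sub_zero] at h1
        rw [← mul_sub, abs_mul, abs_of_pos hτ]
        have h2 : τ * |(∫ s in (0 : ℝ)..t, φ s) - t| ≤ τ * C₃ := by gcongr
        have h3 : 0 ≤ ‖S.adjoint‖ * C₂ := by positivity
        linarith
      det_eq := fun y t => by
        rw [det_adjoint_comp_comp, det_adjoint_comp_comp, hHess, hT_det, abs_mul, abs_mul _ (A.det * _)]
        have h1 := heq (S y) _ (min_le_right t 0)
        rw [abs_of_pos (hHess_pos _ _ (min_le_right _ _)),
          abs_of_pos (mul_pos hApos.det_pos (hf₁pos _))]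
        linear_combination |S.adjoint.det * S.det| * h1
          - |S.adjoint.det * S.det| * φ t * f₁ (S y) * hdetA
      u_near := fun y t => by
        refine (hu_near y t).trans ?_
        gcongr
        have h2 : 0 ≤ τ * C₃ := by positivity
        have h3 : 0 ≤ ‖S.adjoint‖ * C₂ := by positivity
        linarith }
  obtain ⟨c', d, h⟩ := D.exists_u_eq (by positivity)
    (lt_min hm₁ (by positivity)) (lt_max_of_lt_left (hm₁.trans_le ((hut 0 0 le_rfl).1.trans (hut 0 0 le_rfl).2)))
    hθ0 hθ1
  refine ⟨L.adjoint c', d, fun x t ht => ?_⟩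
  have h1 := h (L x) t ht
  simp only [D, hSL, min_eq_left ht] at h1
  have h2 : dotp (L.adjoint c') x = inner ℝ c' (L x) := by
    rw [← ContinuousLinearMap.adjoint_inner_left, PiLp.inner_apply, dotp]
    simp [mul_comm]
  rw [h1, h2, hL]

end Periodic

end PMA

/-- the function `h = w̃ − ξ₁ − ξ₂` is bounded above. -/
theorem stmt19
    (n : ℕ) (hn : 1 ≤ n) (α : ℝ) (hα : α ∈ Set.Ioo (0:ℝ) 1)
    (f₁ : En n → ℝ) (f₂ : ℝ → ℝ)
    (hf₁pos : ∀ x, 0 < f₁ x) (hf₂pos : ∀ t : ℝ, t ≤ 0 → 0 < f₂ t)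
    (hf₁hold : ∃ K : NNReal, HolderWith K α.toNNReal f₁)
    (hf₂hold : ∃ K : NNReal, HolderOnWith K (α/2).toNNReal f₂ (Set.Iic 0))
    (hf₁per : ∀ (x : En n) (i : Fin n), f₁ (x + EuclideanSpace.single i 1) = f₁ x)
    (hf₂per : ∀ t : ℝ, t ≤ 0 → f₂ (t - 1) = f₂ t)
    (hf₁avg : ∫ x in {x : En n | ∀ i, x i ∈ Set.Icc (0:ℝ) 1}, f₁ x = 1)
    (hf₂avg : ∫ t in Set.Icc (-1:ℝ) 0, f₂ t = 1)
    (lam Λ : ℝ) (hlam : 0 < lam)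
    (hfbdd : ∀ (x : En n) (t : ℝ), t ≤ 0 → lam ≤ f₁ x * f₂ t ∧ f₁ x * f₂ t ≤ Λ)
    (u : En n → ℝ → ℝ)
    (hureg : PMA.IsC2kOn 1 u (PMA.halfSpace n))
    (huconv : PMA.ParabolicallyConvexOn (PMA.halfSpace n) u)
    (m₁ m₂ : ℝ) (hm₁ : 0 < m₁) (hm₂ : 0 < m₂)
    (hut : ∀ (x : En n) (t : ℝ), t ≤ 0 →
      m₁ ≤ -PMA.timeDeriv u x t ∧ -PMA.timeDeriv u x t ≤ m₂)
    (heq : ∀ (x : En n) (t : ℝ), t ≤ 0 →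
      -PMA.timeDeriv u x t * (PMA.spaceHess u x t).det = f₁ x * f₂ t)
    (hu0 : u 0 0 = 0) (hDu0 : PMA.spaceGrad u 0 0 = 0)
    (τ : ℝ) (hτ : τ ∈ Set.Icc m₁ m₂)
    (A : Matrix (Fin n) (Fin n) ℝ) (hAsymm : A.IsSymm) (hApos : A.PosDef)
    (hdetA : τ * A.det = 1)
    (ε C₀ : ℝ) (hε : ε ∈ Set.Ioo (0:ℝ) 1) (hC₀ : 0 < C₀)
    (hasym : ∀ (x : En n) (t : ℝ), t ≤ 0 → C₀ ≤ ‖x‖^2 - t →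
      |u x t - ((1/2) * PMA.quadForm A x - τ * t)| ≤ C₀ * (‖x‖^2 - t) ^ ((4-ε)/4))
    (b : En n)
    (hb : ∀ k : Fin n,
      u (EuclideanSpace.single k 1) 0
          - (-τ * 0 + (1/2) * PMA.quadForm A (EuclideanSpace.single k 1)
              + PMA.dotp b (EuclideanSpace.single k 1))
        = u (-EuclideanSpace.single k 1) 0
          - (-τ * 0 + (1/2) * PMA.quadForm A (-EuclideanSpace.single k 1)
              + PMA.dotp b (-EuclideanSpace.single k 1)))
    (ξ₁ : En n → ℝ)
    (hξ₁reg : ContDiff ℝ 2 ξ₁)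
    (hξ₁per : ∀ (x : En n) (i : Fin n), ξ₁ (x + EuclideanSpace.single i 1) = ξ₁ x)
    (hξ₁zero : ξ₁ 0 = 0)
    (hξ₁pos : ∀ x : En n, (A + PMA.spaceHess (fun y _ => ξ₁ y) x 0).PosDef)
    (hξ₁eq : ∀ x : En n, (A + PMA.spaceHess (fun y _ => ξ₁ y) x 0).det = A.det * f₁ x)
    (hξ₁uniq : ∀ η : En n → ℝ, ContDiff ℝ 2 η →
      (∀ (x : En n) (i : Fin n), η (x + EuclideanSpace.single i 1) = η x) →
      η 0 = 0 →
      (∀ x : En n, (A + PMA.spaceHess (fun y _ => η y) x 0).PosDef) →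
      (∀ x : En n, (A + PMA.spaceHess (fun y _ => η y) x 0).det = A.det * f₁ x) →
      η = ξ₁) :
    ∃ M : ℝ, ∀ (x : En n) (t : ℝ), t ≤ 0 →
      (u x t - (-τ * t + (1/2) * PMA.quadForm A x + PMA.dotp b x))
          - ξ₁ x - (-τ * ∫ s in (0:ℝ)..t, (f₂ s - 1)) ≤ M := by
  have hf₂cont : ContinuousOn f₂ (Set.Iic 0) := by
    obtain ⟨K, hK⟩ := hf₂hold
    exact hK.continuousOn (Real.toNNReal_pos.2 (half_pos hα.1))
  obtain ⟨c, d, h⟩ := PMA.exists_eq_add_dotp hf₁pos hf₂cont hf₂per hf₂avg hlam hfbdd hureg huconv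
    hm₁ hut heq (hm₁.trans_le hτ.1) hApos hdetA (θ := (4 - ε) / 4) (by linarith [hε.2])
    (by linarith [hε.1]) hC₀ hasym hξ₁reg hξ₁per hξ₁pos hξ₁eq
  have hcb : c = b := by
    ext k
    have h1 := hb k
    rw [h _ 0 le_rfl, h _ 0 le_rfl] at h1
    have h2 := hξ₁per 0 k
    have h3 := hξ₁per (-EuclideanSpace.single k 1) k
    rw [zero_add] at h2
    rw [neg_add_cancel] at h3
    rw [h2, ← h3] at h1
    have h4 : ∀ v : En n, PMA.dotp v (EuclideanSpace.single k 1) = v k := fun v => by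
      simp [PMA.dotp]
    have h5 : ∀ v : En n, PMA.dotp v (-EuclideanSpace.single k 1) = -v k := fun v => by
      simp [PMA.dotp]
    rw [h4, h4, h5, h5] at h1
    linarith
  refine ⟨-d, fun x t ht => le_of_eq ?_⟩
  have hint : ∫ s in (0 : ℝ)..t, (f₂ s - 1) = (∫ s in (0 : ℝ)..t, f₂ (min s 0)) - t := by
    have hφ : Continuous fun s : ℝ => f₂ (min s 0) :=
      hf₂cont.comp_continuous (f := fun s : ℝ => min s 0) (by fun_prop) fun s => min_le_right s 0
    have h1 : ∫ s in (0 : ℝ)..t, (f₂ s - 1) = ∫ s in (0 : ℝ)..t, (f₂ (min s 0) - 1) := by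
      refine intervalIntegral.integral_congr fun s hs => ?_
      rw [Set.uIcc_of_ge ht] at hs
      simp only [min_eq_left hs.2]
    rw [h1, intervalIntegral.integral_sub (hφ.intervalIntegrable _ _) intervalIntegrable_const]
    simp
  rw [hint, h x t ht, hcb]
  ring
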